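/- arXiv:1306.2904 — 3 statements merged into one kernel-verified Lean document; each statement's English description precedes it below -/
import Mathlib

section
/- Let T > 0, let r ≥ 1 be an integer and γ > 0 a real number, and let s, ζ be as in the definition of the class Q*_{r,γ}. Suppose the kernel H : [0,T] × [0,T] → ℝ has continuous mixed partial derivatives ∂^{k₁+k₂}H/∂t^{k₁}∂τ^{k₂} of all total orders k₁ + k₂ ≤ s on {(t,τ) : 0 < t ≤ T, 0 ≤ τ ≤ T} (continuous on all of [0,T]² for k₁ + k₂ ≤ r), satisfying |∂^{k₁+k₂}H/∂t^{k₁}∂τ^{k₂}(t,τ)| ≤ 1 for 0 ≤ k₁ + k₂ ≤ r and |∂^{k₁+k₂}H/∂t^{k₁}∂τ^{k₂}(t,τ)| ≤ t^{−(k₁+k₂−r−ζ)} for r < k₁ + k₂ ≤ s and t ∈ (0,T], and suppose f ∈ Q*_{r,γ}([0,T],1). Then the Volterra integral equation x(t) − ∫₀ᵗ H(t,τ)x(τ)dτ = f(t), 0 ≤ t ≤ T, has a unique continuous solution x on [0,T], and there exists a constant M > 0 such that x ∈ Q*_{r,γ}([0,T],M). -/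
open Set MeasureTheory intervalIntegral

/-- The class `Q*_{r,γ}([0,T], M)` (one-dimensional case), with smoothness/ singularity
parameters `s` and `ζ` determined by `r` and `γ` as in the paper. -/
def MemQStar (T M : ℝ) (r s : ℕ) (ζ : ℝ) (f : ℝ → ℝ) : Prop :=
  ContDiffOn ℝ r f (Set.Icc 0 T) ∧
  ContDiffOn ℝ s f (Set.Ioc 0 T) ∧
  (∀ k : ℕ, k ≤ r → ∀ t ∈ Set.Icc (0:ℝ) T,
      |iteratedDerivWithin k f (Set.Icc 0 T) t| ≤ M) ∧
  (∀ k : ℕ, r < k → k ≤ s → ∀ t ∈ Set.Ioc (0:ℝ) T,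
      |iteratedDerivWithin k f (Set.Ioc 0 T) t| ≤ M * t ^ (-((k : ℝ) - r - ζ)))

/-- Directions in `ℝ × ℝ`: `e 0 = (1,0)` (the `t`-direction), `e 1 = (0,1)`
(the `τ`-direction). -/
def dir2 : Fin 2 → ℝ × ℝ := ![(1, 0), (0, 1)]


open Topology in
lemma aux_prim_deriv {T : ℝ} (hT : 0 < T) {g : ℝ → ℝ} (hg : ContinuousOn g (Icc 0 T))
    {t : ℝ} (ht : t ∈ Icc 0 T) :
    HasDerivWithinAt (fun u => ∫ τ in (0:ℝ)..u, g τ) (g t) (Icc 0 T) t := by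
  have hc : Continuous (IccExtend hT.le ((Icc 0 T).domRestrict g)) :=
    (continuousOn_iff_continuous_domRestrict.1 hg).Icc_extend'
  have he : ∀ u ∈ Icc 0 T, IccExtend hT.le ((Icc 0 T).domRestrict g) u = g u := by
    intro u hu
    rw [IccExtend_of_mem hT.le _ hu]; rfl
  have h1 := (hc.integral_hasStrictDerivAt 0 t).hasDerivAt.hasDerivWithinAt (s := Icc 0 T)
  rw [he t ht] at h1
  refine h1.congr_of_mem (fun u hu => ?_) ht
  refine intervalIntegral.integral_congr (fun τ hτ => ?_)
  rw [uIcc_of_le hu.1] at hτ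
  exact (he τ ⟨hτ.1, hτ.2.trans hu.2⟩).symm

lemma aux_slice {S : Set ℝ} {T : ℝ} {G : ℝ × ℝ → ℝ}
    (hG : ContinuousOn G (S ×ˢ Icc 0 T)) {t : ℝ} (ht : t ∈ S) :
    ContinuousOn (fun τ => G (t, τ)) (Icc 0 T) :=
  hG.comp (by fun_prop) (fun τ hτ => ⟨ht, hτ⟩)

lemma aux_ii {T : ℝ} {g : ℝ → ℝ} (hg : ContinuousOn g (Icc 0 T)) {u : ℝ} (hu : u ∈ Icc 0 T) :
    IntervalIntegrable g volume 0 u := by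
  apply ContinuousOn.intervalIntegrable
  rw [uIcc_of_le hu.1]
  exact hg.mono (Icc_subset_Icc le_rfl hu.2)

lemma aux_bd {T : ℝ} {g : ℝ → ℝ} {u C : ℝ} (hu : u ∈ Icc 0 T)
    (h : ∀ τ ∈ Icc 0 T, |g τ| ≤ C) : |∫ τ in (0:ℝ)..u, g τ| ≤ C * u := by
  have := intervalIntegral.norm_integral_le_of_norm_le_const (a := 0) (b := u) (f := g) (C := C)
    (fun τ hτ => by
      rw [uIoc_of_le hu.1] at hτ
      exact h τ ⟨hτ.1.le, hτ.2.trans hu.2⟩)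
  rw [sub_zero, abs_of_nonneg hu.1] at this
  exact this

open Topology in
lemma aux_unif {S : Set ℝ} {T : ℝ} {G : ℝ × ℝ → ℝ}
    (hG : ContinuousOn G (S ×ˢ Icc 0 T)) {t : ℝ} (ht : t ∈ S) {ε : ℝ} (hε : 0 < ε) :
    ∃ δ > 0, ∀ u ∈ S, |u - t| < δ → ∀ τ ∈ Icc 0 T, |G (u, τ) - G (t, τ)| ≤ ε := by
  obtain ⟨v, hv, h⟩ := (isCompact_Icc (a := (0:ℝ)) (b := T)).mem_uniformity_of_prod
    (f := fun a b => G (a, b)) (s := S) (q := t) hG ht (Metric.dist_mem_uniformity hε)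
  obtain ⟨δ, hδ, hv⟩ := Metric.mem_nhdsWithin_iff.1 hv
  refine ⟨δ, hδ, fun u hu hut τ hτ => ?_⟩
  have := h u (hv ⟨by simpa [Real.dist_eq] using hut, hu⟩) τ hτ
  simp only [mem_ofPred_eq, Real.dist_eq] at this
  exact this.le

open Topology in
lemma aux_J_cont {S : Set ℝ} {T : ℝ} (hT : 0 < T) (hS : S ⊆ Icc 0 T) {G : ℝ × ℝ → ℝ}
    (hG : ContinuousOn G (S ×ˢ Icc 0 T)) :
    ContinuousOn (fun t => ∫ τ in (0:ℝ)..t, G (t, τ)) S := by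
  intro t ht
  have hA : ContinuousWithinAt (fun u => ∫ τ in (0:ℝ)..u, G (t, τ)) S t :=
    ((aux_prim_deriv hT (aux_slice hG ht) (hS ht)).mono hS).continuousWithinAt
  have hB : ContinuousWithinAt (fun u => ∫ τ in (0:ℝ)..u, (G (u, τ) - G (t, τ))) S t := by
    rw [Metric.continuousWithinAt_iff]
    intro ε hε
    obtain ⟨δ, hδ, h⟩ := aux_unif hG ht (ε := ε / (2 * T)) (by positivity)
    refine ⟨δ, hδ, fun u hu hut => ?_⟩
    rw [Real.dist_eq] at hut ⊢
    simp only [sub_self, intervalIntegral.integral_zero, sub_zero]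
    calc _ ≤ ε / (2 * T) * u := aux_bd (hS hu) (h u hu hut)
      _ ≤ ε / (2 * T) * T := by gcongr; exact (hS hu).2
      _ < ε := by field_simp; linarith
  refine (hA.add hB).congr_of_mem (fun u hu => ?_) ht
  simp only [Pi.add_apply]
  rw [← intervalIntegral.integral_add]
  · simp
  · exact aux_ii (aux_slice hG ht) (hS hu)
  · exact aux_ii ((aux_slice hG hu).sub (aux_slice hG ht)) (hS hu)

open Topology in
lemma aux_J_deriv {S : Set ℝ} {T : ℝ} (hT : 0 < T) (hS : S ⊆ Icc 0 T) (hSc : Convex ℝ S)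
    {G G1 : ℝ × ℝ → ℝ}
    (hG : ContinuousOn G (S ×ˢ Icc 0 T)) (hG1 : ContinuousOn G1 (S ×ˢ Icc 0 T))
    (hd : ∀ u ∈ S, ∀ τ ∈ Icc 0 T, HasDerivWithinAt (fun v => G (v, τ)) (G1 (u, τ)) S u)
    {t : ℝ} (ht : t ∈ S) :
    HasDerivWithinAt (fun t => ∫ τ in (0:ℝ)..t, G (t, τ))
      (G (t, t) + ∫ τ in (0:ℝ)..t, G1 (t, τ)) S t := by
  have hA : HasDerivWithinAt (fun u => ∫ τ in (0:ℝ)..u, G (t, τ)) (G (t, t)) S t :=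
    (aux_prim_deriv hT (aux_slice hG ht) (hS ht)).mono hS
  have hC : HasDerivWithinAt (fun u => (u - t) * ∫ τ in (0:ℝ)..u, G1 (t, τ))
      (∫ τ in (0:ℝ)..t, G1 (t, τ)) S t := by
    have h1 : HasDerivWithinAt (fun u => ∫ τ in (0:ℝ)..u, G1 (t, τ)) (G1 (t, t)) S t :=
      (aux_prim_deriv hT (aux_slice hG1 ht) (hS ht)).mono hS
    have h2 := ((hasDerivWithinAt_id t S).sub_const t).mul h1
    simp only [id, sub_self, zero_mul, one_mul, add_zero] at h2
    exact h2
  have hB : HasDerivWithinAt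
      (fun u => ∫ τ in (0:ℝ)..u, (G (u, τ) - G (t, τ) - (u - t) * G1 (t, τ))) 0 S t := by
    rw [hasDerivWithinAt_iff_isLittleO, Asymptotics.isLittleO_iff]
    intro ε hε
    obtain ⟨δ, hδ, h⟩ := aux_unif hG1 ht (ε := ε / T) (by positivity)
    have hev : ∀ᶠ u in 𝓝[S] t, u ∈ S ∩ Metric.ball t δ :=
      Filter.inter_mem self_mem_nhdsWithin (mem_nhdsWithin_of_mem_nhds (Metric.ball_mem_nhds t hδ))
    filter_upwards [hev] with u hu
    simp only [sub_self, zero_mul, intervalIntegral.integral_zero, sub_zero, smul_zero]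
    have key : ∀ τ ∈ Icc 0 T, |G (u, τ) - G (t, τ) - (u - t) * G1 (t, τ)| ≤ ε / T * |u - t| := by
      intro τ hτ
      have := Convex.norm_image_sub_le_of_norm_hasDerivWithin_le
        (f := fun v => G (v, τ) - v * G1 (t, τ)) (f' := fun v => G1 (v, τ) - G1 (t, τ))
        (s := S ∩ Metric.ball t δ) (C := ε / T) (x := t) (y := u)
        (fun v hv => by
          have h3 := ((hd v hv.1 τ hτ).sub
            ((hasDerivWithinAt_id v S).mul_const (G1 (t, τ)))).mono
            (inter_subset_left (t := Metric.ball t δ))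
          simp only [id, one_mul] at h3
          exact h3)
        (fun v hv => h v hv.1 (by simpa [Real.dist_eq] using hv.2) τ hτ)
        (hSc.inter (convex_ball t δ)) ⟨ht, Metric.mem_ball_self hδ⟩ hu
      simp only [Real.norm_eq_abs] at this
      refine le_trans (le_of_eq ?_) this
      congr 1; ring
    have h4 := aux_bd (hS hu.1) key
    rw [Real.norm_eq_abs, Real.norm_eq_abs]
    calc _ ≤ ε / T * |u - t| * u := h4
      _ ≤ ε / T * |u - t| * T := by gcongr; exact (hS hu.1).2
      _ = ε * |u - t| := by field_simp
  have := (hA.add hC).add hB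
  rw [add_zero] at this
  refine this.congr_of_mem (fun u hu => ?_) ht
  have i1 := aux_ii (aux_slice hG ht) (hS hu)
  have i2 := aux_ii (aux_slice hG hu) (hS hu)
  have i3 := (aux_ii (aux_slice hG1 ht) (hS hu)).const_mul (u - t)
  simp only [Pi.add_apply]
  rw [intervalIntegral.integral_sub (i2.sub i1) i3, intervalIntegral.integral_sub i2 i1,
    intervalIntegral.integral_const_mul]
  ring

/-- Weighted smoothness class (recursive). -/
def BP (S : Set ℝ) (w : ℕ → ℝ → ℝ) : ℕ → ℕ → (ℝ → ℝ) → Prop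
  | m, 0, g => (∃ C, 0 ≤ C ∧ ∀ t ∈ S, |g t| ≤ C * w m t) ∧ ContinuousOn g S
  | m, n + 1, g => (∃ C, 0 ≤ C ∧ ∀ t ∈ S, |g t| ≤ C * w m t) ∧
      ∃ g' : ℝ → ℝ, (∀ t ∈ S, HasDerivWithinAt g (g' t) S t) ∧ BP S w (m + 1) n g'

/-- Weighted smoothness class for kernels (recursive). -/
def BK (S : Set ℝ) (T : ℝ) (w : ℕ → ℝ → ℝ) : ℕ → ℕ → (ℝ × ℝ → ℝ) → Prop
  | m, 0, K => (∃ C, 0 ≤ C ∧ ∀ p ∈ S ×ˢ Icc 0 T, |K p| ≤ C * w m p.1) ∧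
      ContinuousOn K (S ×ˢ Icc 0 T)
  | m, n + 1, K => (∃ C, 0 ≤ C ∧ ∀ p ∈ S ×ˢ Icc 0 T, |K p| ≤ C * w m p.1) ∧
      ∃ K1 K2 : ℝ × ℝ → ℝ, (∀ p ∈ S ×ˢ Icc 0 T, HasFDerivWithinAt K
        (K1 p • ContinuousLinearMap.fst ℝ ℝ ℝ + K2 p • ContinuousLinearMap.snd ℝ ℝ ℝ)
        (S ×ˢ Icc 0 T) p) ∧ BK S T w (m + 1) n K1 ∧ BK S T w (m + 1) n K2

/-- Standing assumptions on set and weights. -/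
structure WOK (S : Set ℝ) (T : ℝ) (w : ℕ → ℝ → ℝ) : Prop where
  sub : S ⊆ Icc 0 T
  conv : Convex ℝ S
  ud : UniqueDiffOn ℝ S
  nonneg : ∀ m, ∀ t ∈ S, 0 ≤ w m t
  mul : ∀ m n, ∃ C, 0 ≤ C ∧ ∀ t ∈ S, w m t * w n t ≤ C * w (m + n) t
  step : ∀ m, ∃ C, 0 ≤ C ∧ ∀ t ∈ S, w m t ≤ C * w (m + 1) t
  zero : ∀ t ∈ S, w 0 t = 1

section
variable {S : Set ℝ} {T : ℝ} {w : ℕ → ℝ → ℝ}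

lemma BP.bd {m n : ℕ} {g : ℝ → ℝ} (h : BP S w m n g) :
    ∃ C, 0 ≤ C ∧ ∀ t ∈ S, |g t| ≤ C * w m t := by
  cases n <;> exact h.1

lemma BP.cont {m n : ℕ} {g : ℝ → ℝ} (h : BP S w m n g) : ContinuousOn g S := by
  cases n with
  | zero => exact h.2
  | succ n => obtain ⟨-, g', hg, -⟩ := h; exact fun t ht => (hg t ht).continuousWithinAt

lemma BK.bd {m n : ℕ} {K : ℝ × ℝ → ℝ} (h : BK S T w m n K) :
    ∃ C, 0 ≤ C ∧ ∀ p ∈ S ×ˢ Icc 0 T, |K p| ≤ C * w m p.1 := by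
  cases n <;> exact h.1

lemma BK.cont {m n : ℕ} {K : ℝ × ℝ → ℝ} (h : BK S T w m n K) :
    ContinuousOn K (S ×ˢ Icc 0 T) := by
  cases n with
  | zero => exact h.2
  | succ n => obtain ⟨-, g', g2, hg, -⟩ := h; exact fun t ht => (hg t ht).continuousWithinAt

lemma BP.pred {n : ℕ} : ∀ {m : ℕ} {g : ℝ → ℝ}, BP S w m (n + 1) g → BP S w m n g := by
  induction n with
  | zero => intro m g h; exact ⟨h.bd, h.cont⟩
  | succ n ih =>
    intro m g h
    obtain ⟨hb, g', hg, h'⟩ := h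
    exact ⟨hb, g', hg, ih h'⟩

lemma BP.of_le {n k : ℕ} (hk : k ≤ n) {m : ℕ} {g : ℝ → ℝ} (h : BP S w m n g) : BP S w m k g := by
  induction n, hk using Nat.le_induction with
  | base => exact h
  | succ n _ ih => exact ih h.pred

lemma BK.pred {n : ℕ} : ∀ {m : ℕ} {g : ℝ × ℝ → ℝ}, BK S T w m (n + 1) g → BK S T w m n g := by
  induction n with
  | zero => intro m g h; exact ⟨h.bd, h.cont⟩
  | succ n ih =>
    intro m g h
    obtain ⟨hb, g', g2, hg, h', h2⟩ := h
    exact ⟨hb, g', g2, hg, ih h', ih h2⟩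

lemma BK.of_le {n k : ℕ} (hk : k ≤ n) {m : ℕ} {g : ℝ × ℝ → ℝ} (h : BK S T w m n g) :
    BK S T w m k g := by
  induction n, hk using Nat.le_induction with
  | base => exact h
  | succ n _ ih => exact ih h.pred

lemma BP.congr {m n : ℕ} {g h : ℝ → ℝ} (hg : BP S w m n g) (e : ∀ t ∈ S, h t = g t) :
    BP S w m n h := by
  have hb : ∃ C, 0 ≤ C ∧ ∀ t ∈ S, |h t| ≤ C * w m t := by
    obtain ⟨C, hC, hb⟩ := hg.bd
    exact ⟨C, hC, fun t ht => by rw [e t ht]; exact hb t ht⟩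
  cases n with
  | zero => exact ⟨hb, hg.2.congr e⟩
  | succ n =>
    obtain ⟨-, g', hg', h'⟩ := hg
    exact ⟨hb, g', fun t ht => (hg' t ht).congr_of_mem e ht, h'⟩

lemma bd_add {m : ℕ} {g h : ℝ → ℝ} (hg : ∃ C, 0 ≤ C ∧ ∀ t ∈ S, |g t| ≤ C * w m t)
    (hh : ∃ C, 0 ≤ C ∧ ∀ t ∈ S, |h t| ≤ C * w m t) :
    ∃ C, 0 ≤ C ∧ ∀ t ∈ S, |g t + h t| ≤ C * w m t := by
  obtain ⟨C, hC, hg⟩ := hg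
  obtain ⟨D, hD, hh⟩ := hh
  refine ⟨C + D, by positivity, fun t ht => ?_⟩
  have := abs_add_le (g t) (h t)
  have := hg t ht
  have := hh t ht
  linarith

lemma BP.add {n : ℕ} : ∀ {m : ℕ} {g h : ℝ → ℝ}, BP S w m n g → BP S w m n h →
    BP S w m n (fun t => g t + h t) := by
  induction n with
  | zero => intro m g h hg hh; exact ⟨bd_add hg.bd hh.bd, hg.2.add hh.2⟩
  | succ n ih =>
    intro m g h hg hh
    refine ⟨bd_add hg.bd hh.bd, ?_⟩
    obtain ⟨-, g', hg', h1⟩ := hg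
    obtain ⟨-, h', hh', h2⟩ := hh
    exact ⟨_, fun t ht => (hg' t ht).add (hh' t ht), ih h1 h2⟩

lemma bd_mul (hw : WOK S T w) {m m' : ℕ} {g h : ℝ → ℝ}
    (hg : ∃ C, 0 ≤ C ∧ ∀ t ∈ S, |g t| ≤ C * w m t)
    (hh : ∃ C, 0 ≤ C ∧ ∀ t ∈ S, |h t| ≤ C * w m' t) :
    ∃ C, 0 ≤ C ∧ ∀ t ∈ S, |g t * h t| ≤ C * w (m + m') t := by
  obtain ⟨C, hC, hg⟩ := hg
  obtain ⟨D, hD, hh⟩ := hh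
  obtain ⟨E, hE, he⟩ := hw.mul m m'
  refine ⟨C * D * E, by positivity, fun t ht => ?_⟩
  rw [abs_mul]
  have := hw.nonneg m t ht
  have := hw.nonneg m' t ht
  have hCD : 0 ≤ C * D := by positivity
  calc _ ≤ (C * w m t) * (D * w m' t) := by gcongr; exacts [hg t ht, hh t ht]
    _ = C * D * (w m t * w m' t) := by ring
    _ ≤ C * D * (E * w (m + m') t) := mul_le_mul_of_nonneg_left (he t ht) hCD
    _ = _ := by ring

lemma BP.mul (hw : WOK S T w) {n : ℕ} : ∀ {m m' : ℕ} {g h : ℝ → ℝ}, BP S w m n g →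
    BP S w m' n h → BP S w (m + m') n (fun t => g t * h t) := by
  induction n with
  | zero => intro m m' g h hg hh; exact ⟨bd_mul hw hg.bd hh.bd, hg.2.mul hh.2⟩
  | succ n ih =>
    intro m m' g h hg hh
    refine ⟨bd_mul hw hg.bd hh.bd, ?_⟩
    have pg := hg.pred
    have ph := hh.pred
    obtain ⟨-, g', hg', h1⟩ := hg
    obtain ⟨-, h', hh', h2⟩ := hh
    refine ⟨_, fun t ht => (hg' t ht).mul (hh' t ht), ?_⟩
    have a := ih h1 ph
    have b := ih pg h2
    rw [show m + 1 + m' = m + m' + 1 by ring] at a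
    exact a.add b

lemma bd_step (hw : WOK S T w) {m : ℕ} {g : ℝ → ℝ}
    (hg : ∃ C, 0 ≤ C ∧ ∀ t ∈ S, |g t| ≤ C * w m t) :
    ∃ C, 0 ≤ C ∧ ∀ t ∈ S, |g t| ≤ C * w (m + 1) t := by
  obtain ⟨C, hC, hg⟩ := hg
  obtain ⟨E, hE, he⟩ := hw.step m
  refine ⟨C * E, by positivity, fun t ht => ?_⟩
  calc _ ≤ C * w m t := hg t ht
    _ ≤ C * (E * w (m + 1) t) := by gcongr; exact he t ht
    _ = _ := by ring

lemma BP.step (hw : WOK S T w) {n : ℕ} : ∀ {m : ℕ} {g : ℝ → ℝ}, BP S w m n g →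
    BP S w (m + 1) n g := by
  induction n with
  | zero => intro m g hg; exact ⟨bd_step hw hg.bd, hg.2⟩
  | succ n ih =>
    intro m g hg
    refine ⟨bd_step hw hg.bd, ?_⟩
    obtain ⟨-, g', hg', h1⟩ := hg
    exact ⟨g', hg', ih h1⟩

lemma BK.diag (hw : WOK S T w) {n : ℕ} : ∀ {m : ℕ} {K : ℝ × ℝ → ℝ}, BK S T w m n K →
    BP S w m n (fun t => K (t, t)) := by
  have hmaps : MapsTo (fun t : ℝ => (t, t)) S (S ×ˢ Icc 0 T) := fun t ht => ⟨ht, hw.sub ht⟩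
  have hbd : ∀ {m n : ℕ} {K : ℝ × ℝ → ℝ}, BK S T w m n K →
      ∃ C, 0 ≤ C ∧ ∀ t ∈ S, |K (t, t)| ≤ C * w m t := by
    intro m n K hK
    obtain ⟨C, hC, hb⟩ := hK.bd
    exact ⟨C, hC, fun t ht => hb (t, t) (hmaps ht)⟩
  induction n with
  | zero => intro m K hK; exact ⟨hbd hK, hK.2.comp (by fun_prop) hmaps⟩
  | succ n ih =>
    intro m K hK
    refine ⟨hbd hK, ?_⟩
    obtain ⟨-, K1, K2, hd, h1, h2⟩ := hK
    refine ⟨fun t => K1 (t, t) + K2 (t, t), fun t ht => ?_, (ih h1).add (ih h2)⟩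
    have := (hd (t, t) (hmaps ht)).comp_hasDerivWithinAt (f := fun t : ℝ => (t, t)) t
      ((hasDerivWithinAt_id t S).prodMk (hasDerivWithinAt_id t S)) hmaps
    exact this.congr_deriv (by simp)

lemma BK.integral (hT : 0 < T) (hw : WOK S T w) {x : ℝ → ℝ} (hx : ContinuousOn x (Icc 0 T))
    {n : ℕ} : ∀ {m : ℕ} {K : ℝ × ℝ → ℝ},
    BK S T w m n K → BP S w 0 (n - 1) x →
    BP S w m n (fun t => ∫ τ in (0:ℝ)..t, K (t, τ) * x τ) := by
  obtain ⟨B, hB⟩ := isCompact_Icc.exists_bound_of_continuousOn hx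
  have hB0 : 0 ≤ B := (norm_nonneg _).trans (hB 0 ⟨le_rfl, hT.le⟩)
  have hbd : ∀ {m n : ℕ} {K : ℝ × ℝ → ℝ}, BK S T w m n K →
      ∃ C, 0 ≤ C ∧ ∀ t ∈ S, |∫ τ in (0:ℝ)..t, K (t, τ) * x τ| ≤ C * w m t := by
    intro m n K hK
    obtain ⟨C, hC, hb⟩ := hK.bd
    refine ⟨C * B * T, by positivity, fun t ht => ?_⟩
    have hwn := hw.nonneg m t ht
    have := aux_bd (g := fun τ => K (t, τ) * x τ) (C := C * w m t * B) (hw.sub ht)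
      (fun τ hτ => by
        rw [abs_mul]
        gcongr
        exacts [hb (t, τ) ⟨ht, hτ⟩, hB τ hτ])
    calc _ ≤ _ := this
      _ ≤ C * w m t * B * T := by gcongr; exact (hw.sub ht).2
      _ = _ := by ring
  have hxc : ContinuousOn (fun p : ℝ × ℝ => x p.2) (S ×ˢ Icc 0 T) :=
    hx.comp (by fun_prop) (fun p hp => hp.2)
  induction n with
  | zero =>
    intro m K hK _
    exact ⟨hbd hK, aux_J_cont hT hw.sub (G := fun p => K p * x p.2) (hK.2.mul hxc)⟩
  | succ n ih =>
    intro m K hK hP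
    refine ⟨hbd hK, ?_⟩
    have hKp := hK.pred
    have hKc := hK.cont
    obtain ⟨-, K1, K2, hd, h1, h2⟩ := hK
    refine ⟨fun t => K (t, t) * x t + ∫ τ in (0:ℝ)..t, K1 (t, τ) * x τ, fun t ht => ?_, ?_⟩
    · refine aux_J_deriv hT hw.sub hw.conv (G := fun p => K p * x p.2)
        (G1 := fun p => K1 p * x p.2) (hKc.mul hxc) (h1.cont.mul hxc) ?_ ht
      intro u hu τ hτ
      have hmp : MapsTo (fun v : ℝ => (v, τ)) S (S ×ˢ Icc 0 T) := fun v hv => ⟨hv, hτ⟩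
      have := (hd (u, τ) ⟨hu, hτ⟩).comp_hasDerivWithinAt (f := fun v : ℝ => (v, τ)) u
        ((hasDerivWithinAt_id u S).prodMk (hasDerivWithinAt_const u S τ)) hmp
      have := this.mul_const (x τ)
      simpa using this
    · refine BP.add ?_ (ih h1 (hP.of_le (by omega)))
      have : BP S w 0 n x := by simpa using hP
      exact ((hKp.diag hw).mul hw this).step hw

lemma BP.toCD (hw : WOK S T w) {n : ℕ} : ∀ {m : ℕ} {g : ℝ → ℝ}, BP S w m n g →
    ContDiffOn ℝ n g S ∧ ∃ C, 0 ≤ C ∧ ∀ k ≤ n, ∀ t ∈ S,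
      |iteratedDerivWithin k g S t| ≤ C * w (m + k) t := by
  induction n with
  | zero =>
    intro m g hg
    obtain ⟨C, hC, hb⟩ := hg.bd
    refine ⟨by simpa using hg.2, C, hC, fun k hk t ht => ?_⟩
    obtain rfl : k = 0 := by omega
    simpa using hb t ht
  | succ n ih =>
    intro m g hg
    obtain ⟨C, hC, hb⟩ := hg.bd
    obtain ⟨-, g', hg', h1⟩ := hg
    have e : ∀ t ∈ S, derivWithin g S t = g' t := fun t ht => (hg' t ht).derivWithin (hw.ud t ht)
    obtain ⟨hc, D, hD, hd⟩ := ih (h1.congr e)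
    refine ⟨?_, max C D, le_max_of_le_left hC, fun k hk t ht => ?_⟩
    · push_cast
      rw [contDiffOn_succ_iff_derivWithin hw.ud]
      exact ⟨fun t ht => (hg' t ht).differentiableWithinAt, by simp, hc⟩
    · have := hw.nonneg (m + k) t ht
      cases k with
      | zero =>
        simp only [iteratedDerivWithin_zero]
        exact (hb t ht).trans (mul_le_mul_of_nonneg_right (le_max_left _ _) this)
      | succ k =>
        rw [iteratedDerivWithin_succ']
        refine (hd k (by omega) t ht).trans ?_
        rw [show m + 1 + k = m + (k + 1) by ring]
        gcongr; simp

lemma BP.ofCD (hw : WOK S T w) {N : ℕ} {g : ℝ → ℝ} (hg : ContDiffOn ℝ N g S) {C : ℝ} (hC : 0 ≤ C)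
    (hb : ∀ k ≤ N, ∀ t ∈ S, |iteratedDerivWithin k g S t| ≤ C * w k t) (n : ℕ) :
    ∀ j, j + n = N → BP S w j n (iteratedDerivWithin j g S) := by
  induction n with
  | zero =>
    intro j hj
    exact ⟨⟨C, hC, hb j (by omega)⟩,
      hg.continuousOn_iteratedDerivWithin (by exact_mod_cast (by omega : j ≤ N)) hw.ud⟩
  | succ n ih =>
    intro j hj
    refine ⟨⟨C, hC, hb j (by omega)⟩, iteratedDerivWithin (j + 1) g S, fun t ht => ?_,
      ih (j + 1) (by omega)⟩
    rw [iteratedDerivWithin_succ]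
    exact (hg.differentiableOn_iteratedDerivWithin
      (by exact_mod_cast (by omega : j < N)) hw.ud t ht).hasDerivWithinAt

end


section
variable {S : Set ℝ} {T : ℝ} {w : ℕ → ℝ → ℝ}
lemma BK.ofCD (hT : 0 < T) (hw : WOK S T w) {N : ℕ} {K : ℝ × ℝ → ℝ}
    (hK : ContDiffOn ℝ N K (S ×ˢ Icc 0 T))
    (hb : ∀ k ≤ N, ∀ m : Fin k → Fin 2, ∀ p ∈ S ×ˢ Icc 0 T,
      |iteratedFDerivWithin ℝ k K (S ×ˢ Icc 0 T) p (fun j => dir2 (m j))| ≤ w k p.1) (n : ℕ) :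
    ∀ j, j + n = N → ∀ m : Fin j → Fin 2, BK S T w j n
      (fun p => iteratedFDerivWithin ℝ j K (S ×ˢ Icc 0 T) p (fun i => dir2 (m i))) := by
  have hud : UniqueDiffOn ℝ (S ×ˢ Icc 0 T) := hw.ud.prod (uniqueDiffOn_Icc hT)
  induction n with
  | zero =>
    intro j hj m
    refine ⟨⟨1, zero_le_one, fun p hp => by rw [one_mul]; exact hb j (by omega) m p hp⟩, ?_⟩
    have := hK.continuousOn_iteratedFDerivWithin (m := j)
      (by exact_mod_cast (by omega : j ≤ N)) hud
    exact (ContinuousMultilinearMap.apply ℝ (fun _ : Fin j => ℝ × ℝ) ℝ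
      (fun i => dir2 (m i))).continuous.comp_continuousOn this
  | succ n ih =>
    intro j hj m
    refine ⟨⟨1, zero_le_one, fun p hp => by rw [one_mul]; exact hb j (by omega) m p hp⟩,
      _, _, fun p hp => ?_, ih (j + 1) (by omega) (Fin.cons 0 m),
      ih (j + 1) (by omega) (Fin.cons 1 m)⟩
    have h1 := (hK.differentiableOn_iteratedFDerivWithin (m := j)
      (by exact_mod_cast (by omega : j < N)) hud p hp).hasFDerivWithinAt
    have h2 := (ContinuousMultilinearMap.apply ℝ (fun _ : Fin j => ℝ × ℝ) ℝ
      (fun i => dir2 (m i))).hasFDerivAt.comp_hasFDerivWithinAt p h1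
    refine h2.congr_fderiv ?_
    have e : ∀ a : Fin 2, iteratedFDerivWithin ℝ (j + 1) K (S ×ˢ Icc 0 T) p
        (fun i => dir2 ((Fin.cons a m : Fin (j + 1) → Fin 2) i)) =
        fderivWithin ℝ (iteratedFDerivWithin ℝ j K (S ×ˢ Icc 0 T)) (S ×ˢ Icc 0 T) p (dir2 a)
          (fun i => dir2 (m i)) := by
      intro a
      rw [iteratedFDerivWithin_succ_apply_left]
      rfl
    rw [e 0, e 1]
    ext <;> simp [dir2]
end

lemma aux_exp_int (t : ℝ) : ∫ τ in (0:ℝ)..t, Real.exp (-2 * (t - τ)) ≤ 1 / 2 := by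
  have h : ∀ τ ∈ uIcc 0 t, HasDerivAt (fun τ => Real.exp (-2 * (t - τ)) / 2)
      (Real.exp (-2 * (t - τ))) τ := by
    intro τ _
    have := ((((hasDerivAt_id τ).const_sub t).const_mul (-2)).exp).div_const 2
    refine this.congr_deriv ?_
    simp only [id]; ring
  rw [intervalIntegral.integral_eq_sub_of_hasDerivAt h
    (Continuous.intervalIntegrable (by fun_prop) _ _)]
  have := Real.exp_pos (-2 * (t - 0))
  simp only [sub_self, mul_zero, Real.exp_zero]
  linarith

lemma aux_volterra {T : ℝ} (hT : 0 < T) {H : ℝ × ℝ → ℝ} {f : ℝ → ℝ}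
    (hH : ContinuousOn H (Icc 0 T ×ˢ Icc 0 T))
    (hb : ∀ p ∈ Icc (0:ℝ) T ×ˢ Icc (0:ℝ) T, |H p| ≤ 1) (hf : ContinuousOn f (Icc 0 T)) :
    ∃ x : ℝ → ℝ,
      (ContinuousOn x (Set.Icc 0 T) ∧
        ∀ t ∈ Set.Icc (0:ℝ) T, x t - ∫ τ in (0:ℝ)..t, H (t, τ) * x τ = f t) ∧
      (∀ y : ℝ → ℝ, ContinuousOn y (Set.Icc 0 T) →
        (∀ t ∈ Set.Icc (0:ℝ) T, y t - ∫ τ in (0:ℝ)..t, H (t, τ) * y τ = f t) →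
        ∀ t ∈ Set.Icc (0:ℝ) T, y t = x t) := by
  let π : ℝ → ℝ := fun u => (projIcc 0 T hT.le u : ℝ)
  have hπc : Continuous π := continuous_subtype_val.comp continuous_projIcc
  have hπm : ∀ u, π u ∈ Icc 0 T := fun u => (projIcc 0 T hT.le u).2
  have hπe : ∀ u ∈ Icc 0 T, π u = u := fun u hu => by simp [π, projIcc_of_mem hT.le hu]
  let Ht : ℝ → ℝ → ℝ := fun t τ => H (π t, π τ)
  have hHt : Continuous (Function.uncurry Ht) :=
    hH.comp_continuous (f := fun p : ℝ × ℝ => (π p.1, π p.2)) (by fun_prop)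
      (fun p => ⟨hπm _, hπm _⟩)
  have hHb : ∀ t τ, |Ht t τ| ≤ 1 := fun t τ => hb _ ⟨hπm _, hπm _⟩
  have hfc : Continuous (fun t => f (π t)) := hf.comp_continuous hπc hπm
  let E : C(Icc (0:ℝ) T, ℝ) → ℝ → ℝ := fun y => IccExtend hT.le y
  have hE : ∀ y, Continuous (E y) := fun y => y.continuous.Icc_extend'
  let I : C(Icc (0:ℝ) T, ℝ) → ℝ → ℝ := fun y t =>
    ∫ τ in (0:ℝ)..t, Real.exp (-2 * (t - τ)) * Ht t τ * E y τ
  have hint : ∀ y, Continuous (Function.uncurry fun t τ : ℝ =>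
      Real.exp (-2 * (t - τ)) * Ht t τ * E y τ) := by
    intro y
    have h1 := hE y
    have h2 : Continuous (fun p : ℝ × ℝ => Ht p.1 p.2) := hHt
    simp only [Function.uncurry_def]
    fun_prop
  have hI : ∀ y, Continuous (I y) := fun y =>
    intervalIntegral.continuous_parametric_intervalIntegral_of_continuous (hint y) continuous_id
  let Φ : C(Icc (0:ℝ) T, ℝ) → C(Icc (0:ℝ) T, ℝ) := fun y =>
    ⟨fun t => Real.exp (-2 * t) * f (π t) + I y t, by
      have h1 : Continuous (fun t : Icc (0:ℝ) T => I y t) := (hI y).comp continuous_subtype_val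
      have h2 : Continuous (fun t : Icc (0:ℝ) T => f (π t)) := hfc.comp continuous_subtype_val
      have h3 : Continuous (fun t : Icc (0:ℝ) T => Real.exp (-2 * t)) := by fun_prop
      exact (h3.mul h2).add h1⟩
  have hΦ : ContractingWith (1 / 2) Φ := by
    refine ⟨by rw [← NNReal.coe_lt_coe]; norm_num, LipschitzWith.of_dist_le_mul fun y z => ?_⟩
    rw [ContinuousMap.dist_le (by positivity)]
    intro t
    have e : Φ y t - Φ z t = ∫ τ in (0:ℝ)..t,
        Real.exp (-2 * (t - τ)) * Ht t τ * (E y τ - E z τ) := by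
      have c1 : Continuous (fun τ : ℝ => Real.exp (-2 * (t - τ)) * Ht t τ * E y τ) :=
        (hint y).comp (Continuous.prodMk_right (t : ℝ))
      have c2 : Continuous (fun τ : ℝ => Real.exp (-2 * (t - τ)) * Ht t τ * E z τ) :=
        (hint z).comp (Continuous.prodMk_right (t : ℝ))
      have : I y t - I z t = _ := (intervalIntegral.integral_sub
        (c1.intervalIntegrable 0 (t:ℝ)) (c2.intervalIntegrable 0 (t:ℝ))).symm
      simp only [Φ, ContinuousMap.coe_mk, add_sub_add_left_eq_sub, this]
      congr 1; ext τ; ring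
    rw [Real.dist_eq, e, ← Real.norm_eq_abs]
    have hle := intervalIntegral.norm_integral_le_of_norm_le (μ := volume) (a := 0) (b := (t:ℝ))
      (f := fun τ => Real.exp (-2 * (t - τ)) * Ht t τ * (E y τ - E z τ))
      (g := fun τ => Real.exp (-2 * (t - τ)) * dist y z) t.2.1
      (Filter.Eventually.of_forall fun τ _ => by
        rw [norm_mul, norm_mul, Real.norm_eq_abs, abs_of_pos (Real.exp_pos _)]
        have h1 : ‖E y τ - E z τ‖ ≤ dist y z := by
          rw [← dist_eq_norm]; exact ContinuousMap.dist_apply_le_dist _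
        calc _ ≤ Real.exp (-2 * (t - τ)) * 1 * dist y z := by gcongr; exact hHb t τ
          _ = _ := by ring)
      (Continuous.intervalIntegrable (by fun_prop) _ _)
    refine hle.trans ?_
    rw [intervalIntegral.integral_mul_const]
    have := aux_exp_int (t : ℝ)
    push_cast
    gcongr
  have key : ∀ (y : C(Icc (0:ℝ) T, ℝ)) (z : ℝ → ℝ),
      (∀ τ : Icc (0:ℝ) T, z τ = Real.exp (2 * τ) * y τ) → ∀ t : Icc (0:ℝ) T,
      Φ y t = Real.exp (-2 * t) * (f t + ∫ τ in (0:ℝ)..t, H (t, τ) * z τ) := by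
    intro y z hz t
    simp only [Φ, ContinuousMap.coe_mk, I]
    rw [hπe t t.2, mul_add, ← intervalIntegral.integral_const_mul]
    congr 1
    refine intervalIntegral.integral_congr fun τ hτ => ?_
    rw [uIcc_of_le t.2.1] at hτ
    have hτ' : τ ∈ Icc 0 T := ⟨hτ.1, hτ.2.trans t.2.2⟩
    simp only [Ht, E]
    rw [hπe t t.2, hπe τ hτ', IccExtend_of_mem hT.le _ hτ', hz ⟨τ, hτ'⟩,
      show -2 * ((t:ℝ) - τ) = -2 * t + 2 * τ by ring, Real.exp_add]
    ring
  have hee : ∀ t : ℝ, Real.exp (2 * t) * Real.exp (-2 * t) = 1 := by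
    intro t; rw [← Real.exp_add]; simp
  let y0 := hΦ.fixedPoint Φ
  have hy0 : Φ y0 = y0 := hΦ.fixedPoint_isFixedPt
  have hz0 : ∀ τ : Icc (0:ℝ) T, Real.exp (2 * (τ : ℝ)) * E y0 τ = Real.exp (2 * τ) * y0 τ := by
    intro τ
    simp only [E]
    rw [IccExtend_val]
  refine ⟨fun t => Real.exp (2 * t) * E y0 t, ⟨?_, fun t ht => ?_⟩, fun z hz he t ht => ?_⟩
  · have := hE y0
    exact Continuous.continuousOn (by fun_prop)
  · have h := key y0 (fun t => Real.exp (2 * t) * E y0 t) hz0 ⟨t, ht⟩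
    have h3 := hz0 ⟨t, ht⟩
    rw [hy0] at h
    rw [h, ← mul_assoc, hee, one_mul] at h3
    simp only at h3 ⊢
    rw [h3]; ring
  · let yz : C(Icc (0:ℝ) T, ℝ) := ⟨fun t => Real.exp (-2 * t) * z t, by
      have := continuousOn_iff_continuous_domRestrict.1 hz
      have h2 : Continuous (fun t : Icc (0:ℝ) T => z t) := this
      have h3 : Continuous (fun t : Icc (0:ℝ) T => Real.exp (-2 * t)) := by fun_prop
      exact h3.mul h2⟩
    have hyz : ∀ τ : Icc (0:ℝ) T, z τ = Real.exp (2 * τ) * yz τ := by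
      intro τ
      simp only [yz, ContinuousMap.coe_mk]
      rw [← mul_assoc, hee, one_mul]
    have hfix : Φ yz = yz := by
      ext τ
      rw [key yz z hyz τ, ← he τ τ.2]
      simp [yz]
    have : yz = y0 := hΦ.fixedPoint_unique hfix
    have h3 := hz0 ⟨t, ht⟩
    simp only at h3 ⊢
    rw [h3, ← this]
    exact hyz ⟨t, ht⟩

lemma aux_boot {S : Set ℝ} {T : ℝ} {w : ℕ → ℝ → ℝ} (hT : 0 < T) (hw : WOK S T w)
    {H : ℝ × ℝ → ℝ} {f x : ℝ → ℝ} (hx : ContinuousOn x (Icc 0 T))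
    (he : ∀ t ∈ Icc (0:ℝ) T, x t - ∫ τ in (0:ℝ)..t, H (t, τ) * x τ = f t) {N : ℕ}
    (hH : BK S T w 0 N H) (hf : BP S w 0 N f) : ∀ n ≤ N, BP S w 0 n x := by
  have e : ∀ t ∈ S, x t = f t + ∫ τ in (0:ℝ)..t, H (t, τ) * x τ := fun t ht => by
    rw [← he t (hw.sub ht)]; ring
  intro n
  induction n with
  | zero =>
    intro _
    obtain ⟨B, hB⟩ := isCompact_Icc.exists_bound_of_continuousOn hx
    have hB0 : 0 ≤ B := (norm_nonneg _).trans (hB 0 ⟨le_rfl, hT.le⟩)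
    refine ⟨⟨B, hB0, fun t ht => ?_⟩, hx.mono hw.sub⟩
    rw [hw.zero t ht, mul_one]; exact hB t (hw.sub ht)
  | succ n ih =>
    intro hn
    exact ((hf.of_le hn).add ((hH.of_le hn).integral hT hw hx (ih (by omega)))).congr e

lemma WOK_one {T : ℝ} (hT : 0 < T) : WOK (Icc 0 T) T (fun _ _ => 1) where
  sub := le_rfl
  conv := convex_Icc 0 T
  ud := uniqueDiffOn_Icc hT
  nonneg := by simp
  mul := fun _ _ => ⟨1, by simp⟩
  step := fun _ => ⟨1, by simp⟩
  zero := by simp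

/-- The singular weights. -/
noncomputable def sw (r : ℕ) (ζ : ℝ) (m : ℕ) (t : ℝ) : ℝ :=
  t ^ (-(if m ≤ r then 0 else (m : ℝ) - r - ζ))

lemma aux_rpow {T a b : ℝ} (hT : 0 < T) (hab : a ≤ b) :
    ∃ C, 0 ≤ C ∧ ∀ t ∈ Ioc 0 T, t ^ (-a) ≤ C * t ^ (-b) := by
  refine ⟨T ^ (b - a), by positivity, fun t ht => ?_⟩
  have ht0 := ht.1
  rw [show -a = (b - a) + -b by ring, Real.rpow_add ht.1]
  gcongr
  exact ht.2

lemma WOK_sw {T : ℝ} (hT : 0 < T) (r : ℕ) {ζ : ℝ} (h0 : 0 ≤ ζ) (h1 : ζ ≤ 1) :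
    WOK (Ioc 0 T) T (sw r ζ) where
  sub := Ioc_subset_Icc_self
  conv := convex_Ioc 0 T
  ud := uniqueDiffOn_Ioc 0 T
  nonneg := fun m t ht => Real.rpow_nonneg ht.1.le _
  mul := fun m n => by
    obtain ⟨C, hC, h⟩ := aux_rpow (a := (if m ≤ r then 0 else (m : ℝ) - r - ζ) +
      (if n ≤ r then 0 else (n : ℝ) - r - ζ))
      (b := if m + n ≤ r then 0 else ((m + n : ℕ) : ℝ) - r - ζ) hT (by
        have hm : (0:ℝ) ≤ m := by positivity
        have hn : (0:ℝ) ≤ n := by positivity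
        have hr : (0:ℝ) ≤ r := by positivity
        have hle : ∀ k : ℕ, ¬ k ≤ r → (r : ℝ) + 1 ≤ k := fun k hk => by
          exact_mod_cast (by omega : r + 1 ≤ k)
        split_ifs with a b c c b c c
        · simp
        · have := hle _ c; linarith
        · omega
        · push_cast; linarith
        · omega
        · push_cast; linarith
        · omega
        · push_cast; linarith)
    refine ⟨C, hC, fun t ht => ?_⟩
    have := h t ht
    rw [neg_add, Real.rpow_add ht.1] at this
    exact this
  step := fun m => by
    refine aux_rpow hT ?_
    have hle : ∀ k : ℕ, ¬ k ≤ r → (r : ℝ) + 1 ≤ k := fun k hk => by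
      exact_mod_cast (by omega : r + 1 ≤ k)
    split_ifs with a b b
    · simp
    · have := hle _ b; linarith
    · omega
    · push_cast; linarith
  zero := fun t ht => by simp [sw]

lemma aux_congr_set {T : ℝ} {p : ℝ × ℝ} (hp : 0 < p.1) :
    ((Ioc 0 T ×ˢ Icc 0 T : Set (ℝ × ℝ))) =ᶠ[nhds p] (Icc 0 T ×ˢ Icc 0 T : Set (ℝ × ℝ)) := by
  have : ∀ᶠ q : ℝ × ℝ in nhds p, 0 < q.1 :=
    (continuous_fst.tendsto p).eventually (lt_mem_nhds hp)
  rw [Filter.eventuallyEq_set]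
  filter_upwards [this] with q hq
  simp only [mem_prod, mem_Ioc, mem_Icc, hq, hq.le]

lemma aux_congr_set1 {T t : ℝ} (hp : 0 < t) :
    (Ioc 0 T : Set ℝ) =ᶠ[nhds t] (Icc 0 T : Set ℝ) := by
  rw [Filter.eventuallyEq_set]
  filter_upwards [lt_mem_nhds hp] with q hq
  simp only [mem_Ioc, mem_Icc, hq, hq.le]

theorem smoothness_QStar
    (T : ℝ) (hT : 0 < T) (r s : ℕ) (γ ζ : ℝ) (hr : 1 ≤ r) (hγ : 0 < γ)
    (hsζ : ((∃ n : ℤ, γ = n) ∧ (s : ℝ) = r + γ ∧ ζ = 0) ∨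
           ((¬ ∃ n : ℤ, γ = n) ∧ (s : ℝ) = r + ⌊γ⌋ + 1 ∧ ζ = 1 - Int.fract γ))
    (H : ℝ × ℝ → ℝ)
    -- `H` has continuous mixed partials of all orders `≤ r` on `[0,T]²`
    (hHr : ContDiffOn ℝ r H (Set.Icc 0 T ×ˢ Set.Icc 0 T))
    -- `H` has continuous mixed partials of all orders `≤ s` on `(0,T] × [0,T]`
    (hHs : ContDiffOn ℝ s H (Set.Ioc 0 T ×ˢ Set.Icc 0 T))
    -- bounds `|∂^{k₁+k₂} H| ≤ 1` for total order `≤ r`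
    (hHbd₁ : ∀ k : ℕ, k ≤ r → ∀ m : Fin k → Fin 2,
      ∀ p ∈ Set.Icc (0:ℝ) T ×ˢ Set.Icc (0:ℝ) T,
        |iteratedFDerivWithin ℝ k H (Set.Icc 0 T ×ˢ Set.Icc 0 T) p
            (fun j => dir2 (m j))| ≤ 1)
    -- bounds `|∂^{k₁+k₂} H| ≤ t^{-(k₁+k₂-r-ζ)}` for `r <` total order `≤ s`, `t ∈ (0,T]`
    (hHbd₂ : ∀ k : ℕ, r < k → k ≤ s → ∀ m : Fin k → Fin 2,
      ∀ p ∈ Set.Ioc (0:ℝ) T ×ˢ Set.Icc (0:ℝ) T,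
        |iteratedFDerivWithin ℝ k H (Set.Ioc 0 T ×ˢ Set.Icc 0 T) p
            (fun j => dir2 (m j))| ≤ p.1 ^ (-((k : ℝ) - r - ζ)))
    (f : ℝ → ℝ) (hf : MemQStar T 1 r s ζ f) :
    ∃ x : ℝ → ℝ,
      (ContinuousOn x (Set.Icc 0 T) ∧
        ∀ t ∈ Set.Icc (0:ℝ) T, x t - ∫ τ in (0:ℝ)..t, H (t, τ) * x τ = f t) ∧
      (∀ y : ℝ → ℝ, ContinuousOn y (Set.Icc 0 T) →
        (∀ t ∈ Set.Icc (0:ℝ) T, y t - ∫ τ in (0:ℝ)..t, H (t, τ) * y τ = f t) →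
        ∀ t ∈ Set.Icc (0:ℝ) T, y t = x t) ∧
      ∃ M : ℝ, 0 < M ∧ MemQStar T M r s ζ x := by
  obtain ⟨hfr, hfs, hfb1, hfb2⟩ := hf
  have hζ : 0 ≤ ζ ∧ ζ ≤ 1 := by
    rcases hsζ with ⟨-, -, h⟩ | ⟨-, -, h⟩
    · rw [h]; norm_num
    · have := Int.fract_nonneg γ
      have := Int.fract_lt_one γ
      constructor <;> linarith
  have hHb0 : ∀ p ∈ Icc (0:ℝ) T ×ˢ Icc (0:ℝ) T, |H p| ≤ 1 := by
    intro p hp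
    have := hHbd₁ 0 (Nat.zero_le _) (fun _ => 0) p hp
    rwa [iteratedFDerivWithin_zero_apply] at this
  obtain ⟨x, ⟨hx, hxe⟩, hu⟩ := aux_volterra hT hHr.continuousOn hHb0 hfr.continuousOn
  refine ⟨x, ⟨hx, hxe⟩, hu, ?_⟩
  have w1 := WOK_one hT
  have w2 := WOK_sw hT r hζ.1 hζ.2
  have swle : ∀ k ≤ r, ∀ t, sw r ζ k t = 1 := fun k hk t => by simp [sw, hk]
  have swgt : ∀ k, r < k → ∀ t, sw r ζ k t = t ^ (-((k : ℝ) - r - ζ)) := fun k hk t => by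
    simp only [sw, if_neg (not_le.2 hk)]
  -- regular part
  have a1 := BK.ofCD hT w1 hHr (fun k hk m p hp => hHbd₁ k hk m p hp) r 0 (by omega) Fin.elim0
  have b1 := BP.ofCD w1 hfr zero_le_one
    (fun k hk t ht => by rw [mul_one]; exact hfb1 k hk t ht) r 0 (by omega)
  have a2 := BK.ofCD hT w2 hHs (fun k hk m p hp => by
    rcases le_or_gt k r with h | h
    · rw [swle k h, iteratedFDerivWithin_congr_set (aux_congr_set hp.1.1)]
      exact hHbd₁ k h m p ⟨Ioc_subset_Icc_self hp.1, hp.2⟩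
    · rw [swgt k h]
      exact hHbd₂ k h hk m p hp) s 0 (by omega) Fin.elim0
  have b2 := BP.ofCD w2 hfs zero_le_one
    (fun k hk t ht => by
      rw [one_mul]
      rcases le_or_gt k r with h | h
      · rw [swle k h, iteratedDerivWithin_eq_iteratedFDerivWithin,
          iteratedFDerivWithin_congr_set (aux_congr_set1 ht.1),
          ← iteratedDerivWithin_eq_iteratedFDerivWithin]
        exact hfb1 k h t (Ioc_subset_Icc_self ht)
      · rw [swgt k h]
        have := hfb2 k h hk t ht
        rwa [one_mul] at this) s 0 (by omega)
  simp only [iteratedFDerivWithin_zero_apply, iteratedDerivWithin_zero] at a1 a2 b1 b2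
  obtain ⟨c1, C, hC, d1⟩ := (aux_boot hT w1 hx hxe a1 b1 r le_rfl).toCD w1
  obtain ⟨c2, D, hD, d2⟩ := (aux_boot hT w2 hx hxe a2 b2 s le_rfl).toCD w2
  refine ⟨C + D + 1, by positivity, c1, c2, fun k hk t ht => ?_, fun k hk hks t ht => ?_⟩
  · have := d1 k hk t ht
    linarith
  · have h1 := d2 k hks t ht
    rw [zero_add, swgt k hk] at h1
    have h2 : 0 ≤ t ^ (-((k : ℝ) - r - ζ)) := Real.rpow_nonneg ht.1.le _
    exact h1.trans (mul_le_mul_of_nonneg_right (by linarith) h2)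
end

section
/- Let T > 0, let r ≥ 1 be an integer and 0 < γ ≤ 1. Suppose the kernel H : [0,T] × [0,T] → ℝ is infinitely differentiable on {(t,τ) : 0 < t ≤ T, 0 ≤ τ ≤ T} and there exists A₁ > 0 such that |∂^{k₁+k₂}H/∂t^{k₁}∂τ^{k₂}(t,τ)| ≤ A₁^{k₁+k₂}(k₁+k₂)^{k₁+k₂} for 0 ≤ k₁ + k₂ ≤ r on [0,T]², and |∂^{k₁+k₂}H/∂t^{k₁}∂τ^{k₂}(t,τ)| ≤ A₁^{k₁+k₂}(k₁+k₂)^{k₁+k₂} · t^{−(k₁+k₂−r−1+γ)} for k₁ + k₂ > r and t ∈ (0,T], and suppose f ∈ B*_{r,γ}([0,T],A₂) for some A₂ > 0. Then the Volterra integral equation x(t) − ∫₀ᵗ H(t,τ)x(τ)dτ = f(t), 0 ≤ t ≤ T, has a unique continuous solution x on [0,T], and there exists a constant A > 0 such that x ∈ B*_{r,γ}([0,T],A). -/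
open Set MeasureTheory intervalIntegral

/-- The class `B*_{r,γ}([0,T], A)` (one-dimensional case): infinitely differentiable on
`(0,T]`, `r` times continuously differentiable on `[0,T]`, with the indicated bounds. -/
def MemBStar (T A : ℝ) (r : ℕ) (γ : ℝ) (f : ℝ → ℝ) : Prop :=
  ContDiffOn ℝ r f (Set.Icc 0 T) ∧
  ContDiffOn ℝ (⊤ : ℕ∞) f (Set.Ioc 0 T) ∧
  (∀ t ∈ Set.Icc (0:ℝ) T, |f t| ≤ A) ∧
  (∀ k : ℕ, 1 ≤ k → k ≤ r → ∀ t ∈ Set.Icc (0:ℝ) T,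
      |iteratedDerivWithin k f (Set.Icc 0 T) t| ≤ A ^ k * (k : ℝ) ^ k) ∧
  (∀ k : ℕ, r < k → ∀ t ∈ Set.Ioc (0:ℝ) T,
      |iteratedDerivWithin k f (Set.Ioc 0 T) t| ≤
        A ^ k * (k : ℝ) ^ k * t ^ (-((k : ℝ) - r - 1 + γ)))

lemma leib_global (g g' : ℝ → ℝ → ℝ) (hg : Continuous (Function.uncurry g))
    (hg' : Continuous (Function.uncurry g'))
    (hd : ∀ t τ, HasDerivAt (fun s => g s τ) (g' t τ) t) (t : ℝ) :
    HasDerivAt (fun t => ∫ τ in (0:ℝ)..t, g t τ) (g t t + ∫ τ in (0:ℝ)..t, g' t τ) t := by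
  have c1 : Continuous (fun p : ℝ × ℝ => ∫ τ in (0:ℝ)..p.2, g' p.1 τ) := by
    refine intervalIntegral.continuous_parametric_intervalIntegral_of_continuous
      (f := fun (p : ℝ × ℝ) τ => g' p.1 τ) (s := fun p => p.2) ?_ continuous_snd
    exact hg'.comp ((continuous_fst.comp continuous_fst).prodMk continuous_snd)
  have h2 : ∀ t u : ℝ, HasDerivAt (fun u => ∫ τ in (0:ℝ)..u, g t τ) (g t u) u := by
    intro t u
    have hc : Continuous (fun τ => g t τ) := hg.comp (continuous_const.prodMk continuous_id)
    exact intervalIntegral.integral_hasDerivAt_right (hc.intervalIntegrable _ _)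
      hc.aestronglyMeasurable.stronglyMeasurableAtFilter hc.continuousAt
  have h1 : ∀ t u : ℝ, HasDerivAt (fun t => ∫ τ in (0:ℝ)..u, g t τ)
      (∫ τ in (0:ℝ)..u, g' t τ) t := by
    intro t u
    obtain ⟨M, hM⟩ := ((isCompact_closedBall t 1).prod (isCompact_uIcc (a := (0:ℝ)) (b := u))).exists_bound_of_continuousOn hg'.continuousOn
    refine (intervalIntegral.hasDerivAt_integral_of_dominated_loc_of_deriv_le
      (bound := fun _ => M) (Metric.closedBall_mem_nhds t one_pos) ?_ ?_ ?_ ?_ ?_ ?_).2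
    · refine Filter.Eventually.of_forall fun s => ?_
      exact (hg.comp (continuous_const.prodMk continuous_id)).aestronglyMeasurable
    · exact (hg.comp (continuous_const.prodMk continuous_id)).intervalIntegrable _ _
    · exact (hg'.comp (continuous_const.prodMk continuous_id)).aestronglyMeasurable
    · refine Filter.Eventually.of_forall fun s hs x hx => ?_
      exact hM (x, s) ⟨hx, uIoc_subset_uIcc hs⟩
    · exact _root_.intervalIntegrable_const
    · exact Filter.Eventually.of_forall fun s hs x hx => hd x s
  have key := hasStrictFDerivAt_uncurry_coprod (𝕜 := ℝ) (u := (t, t))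
    (f := fun t u => ∫ τ in (0:ℝ)..u, g t τ)
    (f₁ := fun t u => ContinuousLinearMap.toSpanSingleton ℝ (∫ τ in (0:ℝ)..u, g' t τ))
    (f₂ := fun t u => ContinuousLinearMap.toSpanSingleton ℝ (g t u))
    (Filter.Eventually.of_forall fun v => (h1 v.1 v.2).hasFDerivAt)
    (Filter.Eventually.of_forall fun v => (h2 v.1 v.2).hasFDerivAt)
    (by
      have : Continuous (fun p : ℝ × ℝ => ContinuousLinearMap.toSpanSingleton ℝ (∫ τ in (0:ℝ)..p.2, g' p.1 τ)) :=
        (ContinuousLinearMap.toSpanSingletonCLE (𝕜 := ℝ) (E := ℝ)).continuous.comp c1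
      exact this.continuousAt)
    (by
      have : Continuous (fun p : ℝ × ℝ => ContinuousLinearMap.toSpanSingleton ℝ (g p.1 p.2)) := by
        have : Continuous (fun p : ℝ × ℝ => g p.1 p.2) := hg
        exact (ContinuousLinearMap.toSpanSingletonCLE (𝕜 := ℝ) (E := ℝ)).continuous.comp this
      exact this.continuousAt)
  have hdiag : HasDerivAt (fun s : ℝ => (s, s)) ((1:ℝ), (1:ℝ)) t :=
    (hasDerivAt_id t).prodMk (hasDerivAt_id t)
  have := key.hasFDerivAt.comp_hasDerivAt (f := fun s : ℝ => (s, s)) t hdiag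
  convert! this using 1
  simp [Function.HasUncurry.uncurry, add_comm]

lemma leib_Icc (a T : ℝ) (ha : 0 ≤ a) (haT : a < T) (G G' : ℝ → ℝ → ℝ)
    (hG : ContinuousOn (Function.uncurry G) (Icc a T ×ˢ Icc 0 T))
    (hG' : ContinuousOn (Function.uncurry G') (Icc a T ×ˢ Icc 0 T))
    (hd : ∀ t ∈ Icc a T, ∀ τ ∈ Icc 0 T, HasDerivWithinAt (fun s => G s τ) (G' t τ) (Icc a T) t)
    (x : ℝ → ℝ) (hx : Continuous x) (t : ℝ) (ht : t ∈ Icc a T) :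
    HasDerivWithinAt (fun t => ∫ τ in (0:ℝ)..t, G t τ * x τ)
      (G t t * x t + ∫ τ in (0:ℝ)..t, G' t τ * x τ) (Icc a T) t := by
  have hT : 0 ≤ T := ha.trans haT.le
  let P : ℝ → ℝ := fun s => projIcc a T haT.le s
  let Q : ℝ → ℝ := fun s => projIcc 0 T hT s
  have hP : Continuous P := continuous_subtype_val.comp continuous_projIcc
  have hQ : Continuous Q := continuous_subtype_val.comp continuous_projIcc
  have hPm : ∀ s, P s ∈ Icc a T := fun s => (projIcc a T haT.le s).2
  have hQm : ∀ s, Q s ∈ Icc 0 T := fun s => (projIcc 0 T hT s).2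
  have hPe : ∀ s ∈ Icc a T, P s = s := fun s hs => by simp [P, projIcc_of_mem haT.le hs]
  have hQe : ∀ s ∈ Icc 0 T, Q s = s := fun s hs => by simp [Q, projIcc_of_mem hT hs]
  have cG' : Continuous (fun p : ℝ × ℝ => G' (P p.1) (Q p.2)) :=
    hG'.comp_continuous (f := fun p : ℝ × ℝ => (P p.1, Q p.2)) (by fun_prop) (fun p => ⟨hPm _, hQm _⟩)
  have cGa : Continuous (fun τ : ℝ => G a (Q τ)) :=
    hG.comp_continuous (f := fun τ : ℝ => (a, Q τ)) (by fun_prop) (fun p => ⟨⟨le_rfl, haT.le⟩, hQm _⟩)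
  let Gc : ℝ → ℝ → ℝ := fun t τ => G a (Q τ) + ∫ s in a..t, G' (P s) (Q τ)
  have cGc : Continuous (Function.uncurry Gc) := by
    refine (cGa.comp continuous_snd).add ?_
    refine intervalIntegral.continuous_parametric_intervalIntegral_of_continuous
      (f := fun (p : ℝ × ℝ) s => G' (P s) (Q p.2)) (s := fun p => p.1) ?_ continuous_fst
    exact cG'.comp (f := fun p : (ℝ × ℝ) × ℝ => (p.2, p.1.2)) (by fun_prop)
  have dGc : ∀ t τ, HasDerivAt (fun s => Gc s τ) (G' (P t) (Q τ)) t := by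
    intro t τ
    have hc : Continuous (fun s => G' (P s) (Q τ)) := cG'.comp (continuous_id.prodMk continuous_const)
    exact (intervalIntegral.integral_hasDerivAt_right (hc.intervalIntegrable _ _)
      hc.aestronglyMeasurable.stronglyMeasurableAtFilter hc.continuousAt).const_add _
  have eGc : ∀ s ∈ Icc a T, ∀ τ ∈ Icc 0 T, Gc s τ = G s τ := by
    intro s hs τ hτ
    have hc : Continuous (fun s => G' (P s) (Q τ)) := cG'.comp (continuous_id.prodMk continuous_const)
    have := constant_of_has_deriv_right_zero (f := fun s => Gc s τ - G s τ) (a := a) (b := T) ?_ ?_ s hs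
    · have h0 : Gc a τ = G a τ := by simp [Gc, hQe τ hτ]
      simp only [h0, sub_self] at this
      linarith
    · intro u hu
      exact ((dGc u τ).continuousAt.continuousWithinAt).sub (hd u hu τ hτ).continuousWithinAt
    · intro u hu
      have hu' : u ∈ Icc a T := ⟨hu.1, hu.2.le⟩
      have h1 := (dGc u τ).hasDerivWithinAt (s := Icc a T)
      have := h1.sub (hd u hu' τ hτ)
      rw [hPe u hu', hQe τ hτ, sub_self] at this
      exact this.mono_of_mem_nhdsWithin (Icc_mem_nhdsGE_of_mem hu)
  have main := leib_global (fun t τ => Gc t τ * x τ) (fun t τ => G' (P t) (Q τ) * x τ)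
    (cGc.mul (hx.comp continuous_snd)) (cG'.mul (hx.comp continuous_snd))
    (fun t τ => (dGc t τ).mul_const _) t
  have sub : ∀ t ∈ Icc a T, ∀ τ ∈ uIcc 0 t, τ ∈ Icc 0 T := by
    intro t ht τ hτ
    rw [uIcc_of_le (ha.trans ht.1)] at hτ
    exact ⟨hτ.1, hτ.2.trans ht.2⟩
  have e2 : ∫ τ in (0:ℝ)..t, G' (P t) (Q τ) * x τ = ∫ τ in (0:ℝ)..t, G' t τ * x τ := by
    refine intervalIntegral.integral_congr fun τ hτ => ?_
    simp only [hPe t ht, hQe τ (sub t ht τ hτ)]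
  rw [e2] at main
  simp only [eGc t ht t ⟨ha.trans ht.1, ht.2⟩] at main
  refine main.hasDerivWithinAt.congr_of_mem ?_ ht
  intro s hs
  refine intervalIntegral.integral_congr fun τ hτ => ?_
  simp only [eGc s hs τ (sub s hs τ hτ)]

lemma volterra_exists (T : ℝ) (hT : 0 < T) (H : ℝ × ℝ → ℝ)
    (hH : ContinuousOn H (Icc 0 T ×ˢ Icc 0 T)) (f : ℝ → ℝ) (hf : ContinuousOn f (Icc 0 T)) :
    ∃ x : ℝ → ℝ, Continuous x ∧
      (∀ t ∈ Icc (0:ℝ) T, x t - ∫ τ in (0:ℝ)..t, H (t, τ) * x τ = f t) ∧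
      (∀ y : ℝ → ℝ, ContinuousOn y (Icc 0 T) →
        (∀ t ∈ Icc (0:ℝ) T, y t - ∫ τ in (0:ℝ)..t, H (t, τ) * y τ = f t) →
        ∀ t ∈ Icc (0:ℝ) T, y t = x t) := by
  let Q : ℝ → ℝ := fun s => projIcc 0 T hT.le s
  have hQ : Continuous Q := continuous_subtype_val.comp continuous_projIcc
  have hQm : ∀ s, Q s ∈ Icc 0 T := fun s => (projIcc 0 T hT.le s).2
  have hQe : ∀ s ∈ Icc 0 T, Q s = s := fun s hs => by simp [Q, projIcc_of_mem hT.le hs]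
  have cH : Continuous (fun p : ℝ × ℝ => H (Q p.1, Q p.2)) :=
    hH.comp_continuous (f := fun p : ℝ × ℝ => (Q p.1, Q p.2)) (by fun_prop)
      (fun p => ⟨hQm _, hQm _⟩)
  have cf : Continuous (fun t => f (Q t)) := hf.comp_continuous hQ hQm
  obtain ⟨M, hM⟩ := (isCompact_Icc.prod isCompact_Icc).exists_bound_of_continuousOn hH
  have hM0 : 0 ≤ M := (norm_nonneg _).trans (hM (0, 0) ⟨⟨le_rfl, hT.le⟩, ⟨le_rfl, hT.le⟩⟩)
  let lam : ℝ := 2 * M + 1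
  have hl : 0 < lam := by positivity
  have cInt : ∀ y : ℝ → ℝ, Continuous y → Continuous (fun t => ∫ τ in (0:ℝ)..t,
      H (Q t, Q τ) * Real.exp (-lam * (t - τ)) * y τ) := by
    intro y hy
    refine intervalIntegral.continuous_parametric_intervalIntegral_of_continuous
      (f := fun t τ => H (Q t, Q τ) * Real.exp (-lam * (t - τ)) * y τ) (s := fun p => p) ?_ continuous_id
    have : Continuous (fun p : ℝ × ℝ => H (Q p.1, Q p.2) * Real.exp (-lam * (p.1 - p.2)) * y p.2) :=
      (cH.mul (by fun_prop)).mul (hy.comp continuous_snd)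
    exact this
  let Ext : C(Icc (0:ℝ) T, ℝ) → ℝ → ℝ := fun y s => y (projIcc 0 T hT.le s)
  have cExt : ∀ y, Continuous (Ext y) := fun y => y.continuous.comp continuous_projIcc
  let Φ : C(Icc (0:ℝ) T, ℝ) → C(Icc (0:ℝ) T, ℝ) := fun y =>
    ⟨fun t => Real.exp (-lam * t) * f (Q t) + ∫ τ in (0:ℝ)..(t:ℝ),
      H (Q t, Q τ) * Real.exp (-lam * (t - τ)) * Ext y τ, by
      have h1 : Continuous (fun t : ℝ => Real.exp (-lam * t) * f (Q t) + ∫ τ in (0:ℝ)..(t:ℝ),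
        H (Q t, Q τ) * Real.exp (-lam * (t - τ)) * Ext y τ) :=
        (Continuous.mul (by fun_prop) cf).add (cInt _ (cExt y))
      exact h1.comp continuous_subtype_val⟩
  have iInt : ∀ y, ∀ t : ℝ, IntervalIntegrable (fun τ => H (Q t, Q τ) * Real.exp (-lam * (t - τ)) * Ext y τ) volume 0 t := by
    intro y t
    have := cExt y
    have h2 : Continuous (fun τ => H (Q t, Q τ)) := cH.comp (continuous_const.prodMk continuous_id)
    exact ((h2.mul (by fun_prop)).mul this).intervalIntegrable _ _
  have contr : ContractingWith (1/2 : NNReal) Φ := by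
    refine ⟨by
      rw [← NNReal.coe_lt_coe]; norm_num, LipschitzWith.of_dist_le_mul fun y z => ?_⟩
    rw [ContinuousMap.dist_le (by positivity)]
    intro t
    have ht := t.2
    simp only [Φ, ContinuousMap.coe_mk, dist_add_left]
    rw [Real.dist_eq, ← intervalIntegral.integral_sub (iInt _ _) (iInt _ _), ← Real.norm_eq_abs]
    have hexpI : ∫ τ in (0:ℝ)..(t:ℝ), M * dist y z * Real.exp (-lam * (t - τ))
        = M * dist y z * ((1 - Real.exp (-lam * t)) / lam) := by
      rw [intervalIntegral.integral_const_mul]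
      congr 1
      have hder : ∀ τ ∈ uIcc (0:ℝ) t, HasDerivAt (fun τ => Real.exp (-lam * (t - τ)) / lam)
          (Real.exp (-lam * (t - τ))) τ := by
        intro τ _
        have h1 : HasDerivAt (fun τ : ℝ => -lam * (t - τ)) lam τ := by
          have := ((hasDerivAt_id τ).const_sub (t:ℝ)).const_mul (-lam)
          simpa using this
        have := h1.exp.div_const lam
        rwa [mul_div_assoc, div_self hl.ne', mul_one] at this
      rw [intervalIntegral.integral_eq_sub_of_hasDerivAt hder
        (Continuous.intervalIntegrable (by fun_prop) _ _)]
      simp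
      ring
    have hb : ‖∫ τ in (0:ℝ)..(t:ℝ), (H (Q t, Q τ) * Real.exp (-lam * (t - τ)) * Ext y τ -
        H (Q t, Q τ) * Real.exp (-lam * (t - τ)) * Ext z τ)‖
        ≤ ∫ τ in (0:ℝ)..(t:ℝ), M * dist y z * Real.exp (-lam * (t - τ)) := by
      refine intervalIntegral.norm_integral_le_of_norm_le ht.1 ?_ (Continuous.intervalIntegrable (by fun_prop) _ _)
      refine Filter.Eventually.of_forall fun τ hτ => ?_
      rw [← mul_sub, norm_mul, norm_mul, Real.norm_eq_abs (Real.exp _), abs_of_pos (Real.exp_pos _),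
        mul_right_comm]
      refine mul_le_mul_of_nonneg_right ?_ (Real.exp_pos _).le
      refine mul_le_mul (hM _ ⟨hQm _, hQm _⟩) ?_ (norm_nonneg _) hM0
      rw [← dist_eq_norm]
      exact ContinuousMap.dist_apply_le_dist _
    refine hb.trans ?_
    rw [hexpI, mul_right_comm]
    refine mul_le_mul_of_nonneg_right ?_ dist_nonneg
    have he := Real.exp_pos (-lam * t)
    have hx : (1 - Real.exp (-lam * t)) / lam ≤ 1 / lam := by gcongr; linarith
    calc M * ((1 - Real.exp (-lam * t)) / lam) ≤ M * (1 / lam) := by gcongr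
      _ ≤ ((1/2 : NNReal) : ℝ) := by
        push_cast
        rw [mul_one_div, div_le_div_iff₀ hl (by norm_num)]
        simp only [lam]; linarith
  -- weight conversion: fixed points correspond to solutions
  have hconv2 : ∀ (y : ℝ → ℝ) (t : ℝ), t ∈ Icc 0 T → ∀ z : C(Icc (0:ℝ) T, ℝ),
      (∀ τ ∈ Icc 0 T, Ext z τ = Real.exp (-lam * τ) * y τ) →
      ∫ τ in (0:ℝ)..t, H (Q t, Q τ) * Real.exp (-lam * (t - τ)) * Ext z τ
       = Real.exp (-lam * t) * ∫ τ in (0:ℝ)..t, H (t, τ) * y τ := by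
    intro y t ht z hz
    rw [← intervalIntegral.integral_const_mul]
    refine intervalIntegral.integral_congr fun τ hτ => ?_
    rw [uIcc_of_le ht.1] at hτ
    have hτ' : τ ∈ Icc 0 T := ⟨hτ.1, hτ.2.trans ht.2⟩
    simp only [hz τ hτ', hQe t ht, hQe τ hτ']
    have : Real.exp (-lam * (t - τ)) * Real.exp (-lam * τ) = Real.exp (-lam * t) := by
      rw [← Real.exp_add]; congr 1; ring
    rw [← this]; ring
  let z := ContractingWith.fixedPoint Φ contr
  have hz : Φ z = z := contr.fixedPoint_isFixedPt
  let x : ℝ → ℝ := fun t => Real.exp (lam * t) * Ext z t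
  have hxz : ∀ τ, Ext z τ = Real.exp (-lam * τ) * x τ := by
    intro τ
    simp only [x]
    rw [← mul_assoc, ← Real.exp_add]; simp
  refine ⟨x, Continuous.mul (by fun_prop) (cExt z), ?_, ?_⟩
  · intro t ht
    have h1 : Ext (Φ z) t = Ext z t := by rw [hz]
    simp only [Ext, projIcc_of_mem hT.le ht] at h1
    simp only [Φ, ContinuousMap.coe_mk] at h1
    rw [hconv2 x t ht z (fun τ _ => hxz τ)] at h1
    have h2 := hxz t
    simp only [Ext, projIcc_of_mem hT.le ht] at h2
    rw [hQe t ht, h2, ← mul_add] at h1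
    have := mul_left_cancel₀ (Real.exp_pos _).ne' h1
    linarith
  · intro y hy hsol t ht
    let w : C(Icc (0:ℝ) T, ℝ) := ⟨fun t => Real.exp (-lam * t) * y t,
      Continuous.mul (by fun_prop) (continuousOn_iff_continuous_domRestrict.1 hy)⟩
    have hw : ∀ τ ∈ Icc 0 T, Ext w τ = Real.exp (-lam * τ) * y τ := by
      intro τ hτ
      simp [Ext, projIcc_of_mem hT.le hτ, w]
    have hfix : Function.IsFixedPt Φ w := by
      ext s
      simp only [Φ, ContinuousMap.coe_mk]
      rw [hconv2 y s s.2 w hw, hQe s s.2, ← hsol s s.2]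
      simp only [w, ContinuousMap.coe_mk]
      ring
    have hwz : w = z := contr.fixedPoint_unique hfix
    have h3 := hw t ht
    rw [hwz, hxz t] at h3
    exact (mul_left_cancel₀ (Real.exp_pos _).ne' h3).symm


/-- Mixed partial derivative of `H` along a word of coordinate directions. -/
noncomputable def GW (H : ℝ × ℝ → ℝ) (S : Set (ℝ × ℝ)) (n : ℕ) (m : Fin n → Fin 2) (p : ℝ × ℝ) : ℝ :=
  iteratedFDerivWithin ℝ n H S p (fun j => dir2 (m j))

lemma GW_contDiffOn {H : ℝ × ℝ → ℝ} {S : Set (ℝ × ℝ)} (hS : UniqueDiffOn ℝ S) {k n : ℕ}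
    (hH : ContDiffOn ℝ ((k + n : ℕ) : ℕ∞) H S) (m : Fin n → Fin 2) :
    ContDiffOn ℝ ((k : ℕ) : ℕ∞) (GW H S n m) S := by
  intro p hp
  have h1 := (hH p hp).iteratedFDerivWithin_right (m := ((k : ℕ) : ℕ∞)) (i := n) hS
    (by norm_cast) hp
  exact (ContinuousMultilinearMap.apply ℝ (fun _ : Fin n => ℝ × ℝ) ℝ
    (fun j => dir2 (m j))).contDiff.contDiffAt.comp_contDiffWithinAt p h1

lemma GW_hasFDeriv {H : ℝ × ℝ → ℝ} {S : Set (ℝ × ℝ)} (hS : UniqueDiffOn ℝ S) {n : ℕ}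
    (hH : ContDiffOn ℝ ((n + 1 : ℕ) : ℕ∞) H S) (m : Fin n → Fin 2) {p : ℝ × ℝ} (hp : p ∈ S) :
    ∃ L : ℝ × ℝ →L[ℝ] ℝ, HasFDerivWithinAt (GW H S n m) L S p ∧
      ∀ c, L (dir2 c) = GW H S (n + 1) (Fin.cons c m) p := by
  have h1 : DifferentiableOn ℝ (iteratedFDerivWithin ℝ n H S) S :=
    hH.differentiableOn_iteratedFDerivWithin (by norm_cast; simp) hS
  have h2 := (h1 p hp).hasFDerivWithinAt
  refine ⟨_, (ContinuousMultilinearMap.apply ℝ (fun _ : Fin n => ℝ × ℝ) ℝ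
    (fun j => dir2 (m j))).hasFDerivAt.comp_hasFDerivWithinAt p h2, ?_⟩
  intro c
  simp only [GW, iteratedFDerivWithin_succ_apply_left]
  rfl

/-- The intervals we use. -/
structure GoodSet (T : ℝ) (I : Set ℝ) : Prop where
  sub : I ⊆ Icc 0 T
  ud : UniqueDiffOn ℝ I
  loc : ∀ t ∈ I, ∃ a, 0 ≤ a ∧ a < T ∧ Icc a T ⊆ I ∧ t ∈ Icc a T ∧ Icc a T ∈ nhdsWithin t I

lemma goodSet_Icc {T : ℝ} (hT : 0 < T) : GoodSet T (Icc 0 T) where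
  sub := subset_rfl
  ud := uniqueDiffOn_Icc hT
  loc := fun _ ht => ⟨0, le_rfl, hT, subset_rfl, ht, self_mem_nhdsWithin⟩

lemma goodSet_Ioc {T : ℝ} (hT : 0 < T) : GoodSet T (Ioc 0 T) where
  sub := Ioc_subset_Icc_self
  ud := uniqueDiffOn_Ioc 0 T
  loc := fun t ht => by
    refine ⟨t / 2, by linarith [ht.1], by linarith [ht.1, ht.2], ?_, ⟨by linarith [ht.1], ht.2⟩, ?_⟩
    · intro s hs
      exact ⟨by linarith [ht.1, hs.1], hs.2⟩
    · rw [mem_nhdsWithin]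
      refine ⟨Ioi (t / 2), isOpen_Ioi, by simp only [mem_Ioi]; linarith [ht.1], ?_⟩
      rintro s ⟨hs1, hs2⟩
      exact ⟨le_of_lt hs1, hs2.2⟩

lemma GoodSet.udS {T : ℝ} {I : Set ℝ} (hT : 0 < T) (hI : GoodSet T I) : UniqueDiffOn ℝ (I ×ˢ Icc (0:ℝ) T) :=
  hI.ud.prod (uniqueDiffOn_Icc hT)

lemma GW_deriv_fst {T : ℝ} {I : Set ℝ} (hT : 0 < T) (hI : GoodSet T I) {H : ℝ × ℝ → ℝ} {n : ℕ}
    (hH : ContDiffOn ℝ ((n + 1 : ℕ) : ℕ∞) H (I ×ˢ Icc (0:ℝ) T)) (m : Fin n → Fin 2)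
    {t τ : ℝ} (ht : t ∈ I) (hτ : τ ∈ Icc 0 T) :
    HasDerivWithinAt (fun s => GW H (I ×ˢ Icc (0:ℝ) T) n m (s, τ))
      (GW H (I ×ˢ Icc (0:ℝ) T) (n + 1) (Fin.cons 0 m) (t, τ)) I t := by
  obtain ⟨L, hL, hLc⟩ := GW_hasFDeriv (hI.udS hT) hH m (p := (t, τ)) ⟨ht, hτ⟩
  have hp : HasDerivWithinAt (fun s : ℝ => (s, τ)) ((1:ℝ), (0:ℝ)) I t :=
    (hasDerivWithinAt_id t I).prodMk (hasDerivWithinAt_const t I τ)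
  have := hL.comp_hasDerivWithinAt (f := fun s : ℝ => (s, τ)) t hp (fun s hs => ⟨hs, hτ⟩)
  rw [← hLc 0]
  exact this

lemma GW_deriv_diag {T : ℝ} {I : Set ℝ} (hT : 0 < T) (hI : GoodSet T I) {H : ℝ × ℝ → ℝ} {n : ℕ}
    (hH : ContDiffOn ℝ ((n + 1 : ℕ) : ℕ∞) H (I ×ˢ Icc (0:ℝ) T)) (m : Fin n → Fin 2)
    {t : ℝ} (ht : t ∈ I) :
    HasDerivWithinAt (fun s => GW H (I ×ˢ Icc (0:ℝ) T) n m (s, s))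
      (GW H (I ×ˢ Icc (0:ℝ) T) (n + 1) (Fin.cons 0 m) (t, t) +
        GW H (I ×ˢ Icc (0:ℝ) T) (n + 1) (Fin.cons 1 m) (t, t)) I t := by
  obtain ⟨L, hL, hLc⟩ := GW_hasFDeriv (hI.udS hT) hH m (p := (t, t)) ⟨ht, hI.sub ht⟩
  have hp : HasDerivWithinAt (fun s : ℝ => (s, s)) ((1:ℝ), (1:ℝ)) I t :=
    (hasDerivWithinAt_id t I).prodMk (hasDerivWithinAt_id t I)
  have := hL.comp_hasDerivWithinAt (f := fun s : ℝ => (s, s)) t hp (fun s hs => ⟨hs, hI.sub hs⟩)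
  rw [← hLc 0, ← hLc 1, ← map_add]
  have e : dir2 0 + dir2 1 = ((1:ℝ), (1:ℝ)) := by simp [dir2]
  rw [e]
  exact this

lemma GW_diag_contDiffOn {T : ℝ} {I : Set ℝ} (hT : 0 < T) (hI : GoodSet T I) {H : ℝ × ℝ → ℝ}
    {k n : ℕ} (hH : ContDiffOn ℝ ((k + n : ℕ) : ℕ∞) H (I ×ˢ Icc (0:ℝ) T)) (m : Fin n → Fin 2) :
    ContDiffOn ℝ ((k : ℕ) : ℕ∞) (fun t => GW H (I ×ˢ Icc (0:ℝ) T) n m (t, t)) I :=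
  (GW_contDiffOn (hI.udS hT) hH m).comp (f := fun t : ℝ => (t, t)) (by fun_prop)
    (fun s hs => ⟨hs, hI.sub hs⟩)

/-- The integrals with differentiated kernel. -/
noncomputable def FJ (H : ℝ × ℝ → ℝ) (S : Set (ℝ × ℝ)) (x : ℝ → ℝ) (j : ℕ) (t : ℝ) : ℝ :=
  ∫ τ in (0:ℝ)..t, GW H S j (fun _ => 0) (t, τ) * x τ

lemma cons_zero_const (n : ℕ) :
    (Fin.cons 0 (fun _ => 0) : Fin (n + 1) → Fin 2) = fun _ => 0 := by
  funext i
  refine Fin.cases rfl (fun i => rfl) i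

lemma FJ_deriv {T : ℝ} {I : Set ℝ} (hT : 0 < T) (hI : GoodSet T I) {H : ℝ × ℝ → ℝ} {n : ℕ}
    (hH : ContDiffOn ℝ ((n + 1 : ℕ) : ℕ∞) H (I ×ˢ Icc (0:ℝ) T)) {x : ℝ → ℝ} (hx : Continuous x)
    {t : ℝ} (ht : t ∈ I) :
    HasDerivWithinAt (FJ H (I ×ˢ Icc (0:ℝ) T) x n)
      (GW H (I ×ˢ Icc (0:ℝ) T) n (fun _ => 0) (t, t) * x t + FJ H (I ×ˢ Icc (0:ℝ) T) x (n + 1) t) I t := by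
  obtain ⟨a, ha, haT, hsub, hta, hnh⟩ := hI.loc t ht
  have hss : Icc a T ×ˢ Icc 0 T ⊆ I ×ˢ Icc 0 T := prod_mono hsub subset_rfl
  refine (leib_Icc a T ha haT (fun t τ => GW H (I ×ˢ Icc (0:ℝ) T) n (fun _ => 0) (t, τ))
    (fun t τ => GW H (I ×ˢ Icc (0:ℝ) T) (n + 1) (fun _ => 0) (t, τ)) ?_ ?_ ?_ x hx t hta).mono_of_mem_nhdsWithin hnh
  · refine ContinuousOn.mono ?_ hss
    have := GW_contDiffOn (k := 1) (n := n) (hI.udS hT) (by rwa [add_comm]) (fun _ => 0)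
    exact this.continuousOn
  · refine ContinuousOn.mono ?_ hss
    have := GW_contDiffOn (k := 0) (n := n + 1) (hI.udS hT) (by rwa [zero_add]) (fun _ => 0)
    exact this.continuousOn
  · intro s hs τ hτ
    have := GW_deriv_fst hT hI hH (fun _ => 0) (hsub hs) hτ
    rw [cons_zero_const] at this
    exact this.mono hsub

lemma FJ_cont {T : ℝ} {I : Set ℝ} (hT : 0 < T) (hI : GoodSet T I) {H : ℝ × ℝ → ℝ} {n : ℕ}
    (hH : ContDiffOn ℝ ((n : ℕ) : ℕ∞) H (I ×ˢ Icc (0:ℝ) T)) {x : ℝ → ℝ} (hx : Continuous x) :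
    ContinuousOn (FJ H (I ×ˢ Icc (0:ℝ) T) x n) I := by
  intro t ht
  obtain ⟨a, ha, haT, hsub, hta, hnh⟩ := hI.loc t ht
  have hss : Icc a T ×ˢ Icc 0 T ⊆ I ×ˢ Icc 0 T := prod_mono hsub subset_rfl
  let P : ℝ → ℝ := fun s => projIcc a T haT.le s
  let Q : ℝ → ℝ := fun s => projIcc 0 T hT.le s
  have hP : Continuous P := continuous_subtype_val.comp continuous_projIcc
  have hQ : Continuous Q := continuous_subtype_val.comp continuous_projIcc
  have hPm : ∀ s, P s ∈ Icc a T := fun s => (projIcc a T haT.le s).2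
  have hQm : ∀ s, Q s ∈ Icc 0 T := fun s => (projIcc 0 T hT.le s).2
  have hPe : ∀ s ∈ Icc a T, P s = s := fun s hs => by simp [P, projIcc_of_mem haT.le hs]
  have hQe : ∀ s ∈ Icc 0 T, Q s = s := fun s hs => by simp [Q, projIcc_of_mem hT.le hs]
  have cG := (GW_contDiffOn (k := 0) (n := n) (hI.udS hT) (by rwa [zero_add]) (fun _ => 0)).continuousOn
  have cG' : Continuous (fun p : ℝ × ℝ => GW H (I ×ˢ Icc (0:ℝ) T) n (fun _ => 0) (P p.1, Q p.2)) :=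
    cG.comp_continuous (f := fun p : ℝ × ℝ => (P p.1, Q p.2)) (by fun_prop) (fun p => hss ⟨hPm _, hQm _⟩)
  have hc : Continuous (fun t => ∫ τ in (0:ℝ)..t,
      GW H (I ×ˢ Icc (0:ℝ) T) n (fun _ => 0) (P t, Q τ) * x τ) := by
    refine intervalIntegral.continuous_parametric_intervalIntegral_of_continuous
      (f := fun t τ => GW H (I ×ˢ Icc (0:ℝ) T) n (fun _ => 0) (P t, Q τ) * x τ) (s := fun p => p) ?_ continuous_id
    exact cG'.mul (hx.comp continuous_snd)
  refine ContinuousWithinAt.mono_of_mem_nhdsWithin ?_ hnh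
  refine hc.continuousWithinAt.congr_of_mem (s := Icc a T) ?_ hta
  intro s hs
  refine intervalIntegral.integral_congr fun τ hτ => ?_
  rw [uIcc_of_le (ha.trans hs.1)] at hτ
  simp only [hPe s hs, hQe τ ⟨hτ.1, hτ.2.trans hs.2⟩]

lemma smooth_all {T : ℝ} {I : Set ℝ} (hT : 0 < T) (hI : GoodSet T I) {H : ℝ × ℝ → ℝ} (N : ℕ∞)
    (hH : ∀ k : ℕ, (k : ℕ∞) ≤ N → ContDiffOn ℝ ((k : ℕ) : ℕ∞) H (I ×ˢ Icc (0:ℝ) T))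
    {x f : ℝ → ℝ} (hx : Continuous x)
    (hf : ∀ k : ℕ, (k : ℕ∞) ≤ N → ContDiffOn ℝ ((k : ℕ) : ℕ∞) f I)
    (hsol : ∀ t ∈ I, x t = f t + FJ H (I ×ˢ Icc (0:ℝ) T) x 0 t) (n : ℕ) :
    (∀ j : ℕ, ((j + n : ℕ) : ℕ∞) ≤ N → ContDiffOn ℝ ((n : ℕ) : ℕ∞) (FJ H (I ×ˢ Icc (0:ℝ) T) x j) I) ∧
    ((n : ℕ∞) ≤ N → ContDiffOn ℝ ((n : ℕ) : ℕ∞) x I) := by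
  induction n with
  | zero =>
    refine ⟨fun j hj => ?_, fun _ => ?_⟩
    · exact contDiffOn_zero.2 (FJ_cont hT hI (hH j hj) hx)
    · exact contDiffOn_zero.2 hx.continuousOn
  | succ n ih =>
    have key : ∀ j : ℕ, ((j + (n + 1) : ℕ) : ℕ∞) ≤ N →
        ContDiffOn ℝ ((n + 1 : ℕ) : ℕ∞) (FJ H (I ×ˢ Icc (0:ℝ) T) x j) I := by
      intro j hj
      have hle : ∀ k : ℕ, k ≤ j + (n + 1) → (k : ℕ∞) ≤ N := fun k hk =>
        le_trans (by exact_mod_cast hk) hj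
      have hder := fun t (ht : t ∈ I) => FJ_deriv hT hI (hH (j + 1) (hle _ (by omega))) hx ht
      have e : (((n + 1 : ℕ) : ℕ∞) : WithTop ℕ∞) = ((n : ℕ∞) : WithTop ℕ∞) + 1 := by norm_cast
      rw [e, contDiffOn_succ_iff_derivWithin hI.ud]
      refine ⟨fun t ht => (hder t ht).differentiableWithinAt, fun h => absurd h (by simp), ?_⟩
      have h1 := GW_diag_contDiffOn hT hI (k := n) (n := j) (hH _ (hle _ (by omega))) (fun _ => 0)
      have h2 := ih.1 (j + 1) (hle _ (by omega))
      have h3 := ih.2 (hle _ (by omega))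
      refine ((h1.mul h3).add h2).congr fun t ht => ?_
      exact (hder t ht).derivWithin (hI.ud t ht)
    refine ⟨key, fun hn => ?_⟩
    have := (hf (n + 1) hn).add (key 0 (by rwa [zero_add]))
    exact this.congr hsol


/-- The weight. -/
noncomputable def WT (r : ℕ) (γ : ℝ) (k : ℕ) (t : ℝ) : ℝ :=
  (min t 1) ^ (-(max 0 ((k : ℝ) - r - 1 + γ)))

lemma WT_one_le (r : ℕ) (γ : ℝ) (k : ℕ) {t : ℝ} (ht : 0 < t) : 1 ≤ WT r γ k t := by
  refine Real.one_le_rpow_of_pos_of_le_one_of_nonpos (lt_min ht one_pos) (min_le_right _ _) ?_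
  simp

lemma WT_mul {r : ℕ} {γ : ℝ} (hγ₀ : 0 < γ) (hγ₁ : γ ≤ 1) (a b : ℕ) {t : ℝ} (ht : 0 < t) :
    WT r γ a t * WT r γ b t ≤ WT r γ (a + b + 1) t := by
  have hu : 0 < min t 1 := lt_min ht one_pos
  simp only [WT]
  rw [← Real.rpow_add hu]
  refine Real.rpow_le_rpow_of_exponent_ge hu (min_le_right _ _) ?_
  have hr : (0:ℝ) ≤ r := Nat.cast_nonneg r
  have ha : (0:ℝ) ≤ a := Nat.cast_nonneg a
  have hb : (0:ℝ) ≤ b := Nat.cast_nonneg b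
  push_cast
  have h1 := le_max_left 0 ((a:ℝ) + b + 1 - r - 1 + γ)
  have h2 := le_max_right 0 ((a:ℝ) + b + 1 - r - 1 + γ)
  rcases max_cases 0 ((a:ℝ) - r - 1 + γ) with h | h <;>
  rcases max_cases 0 ((b:ℝ) - r - 1 + γ) with h' | h' <;> linarith

lemma WT_ge {r : ℕ} {γ : ℝ} (hγ₀ : 0 < γ) {k : ℕ} (hk : r < k) {t : ℝ} (ht : 0 < t) :
    t ^ (-((k : ℝ) - r - 1 + γ)) ≤ WT r γ k t := by
  have hk' : (r:ℝ) + 1 ≤ k := by exact_mod_cast hk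
  have he : 0 ≤ (k : ℝ) - r - 1 + γ := by linarith
  rw [WT, max_eq_right he]
  exact Real.rpow_le_rpow_of_nonpos (lt_min ht one_pos) (min_le_left _ _) (by linarith)

lemma WT_le {r : ℕ} {γ : ℝ} (hγ₀ : 0 < γ) (hγ₁ : γ ≤ 1) {k : ℕ} (hk : r < k) {t T : ℝ} (ht : 0 < t)
    (htT : t ≤ T) : WT r γ k t ≤ (max 1 T) ^ k * t ^ (-((k : ℝ) - r - 1 + γ)) := by
  have hk' : (r:ℝ) + 1 ≤ k := by exact_mod_cast hk
  have hr : (0:ℝ) ≤ r := Nat.cast_nonneg r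
  have he : 0 ≤ (k : ℝ) - r - 1 + γ := by linarith
  rw [WT, max_eq_right he]
  have hL : (1:ℝ) ≤ max 1 T := le_max_left _ _
  rcases le_total t 1 with h | h
  · rw [min_eq_left h]
    exact le_mul_of_one_le_left (Real.rpow_nonneg ht.le _) (one_le_pow₀ hL)
  · rw [min_eq_right h, Real.one_rpow, Real.rpow_neg ht.le, ← div_eq_mul_inv,
      one_le_div (Real.rpow_pos_of_pos ht _)]
    calc t ^ ((k : ℝ) - r - 1 + γ) ≤ t ^ (k : ℝ) :=
          Real.rpow_le_rpow_of_exponent_le h (by linarith)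
      _ = t ^ k := Real.rpow_natCast _ _
      _ ≤ (max 1 T) ^ k := pow_le_pow_left₀ ht.le (htT.trans (le_max_right _ _)) _

lemma pow_self_le (k : ℕ) : (k : ℝ) ^ k ≤ (Real.exp 1) ^ k * k.factorial := by
  have h := Real.pow_div_factorial_le_exp (k : ℝ) (Nat.cast_nonneg k) k
  rw [div_le_iff₀ (by positivity)] at h
  rwa [← Real.exp_nat_mul, mul_one]

lemma choose_fact (n i j : ℕ) (hi : i ≤ n) :
    n.choose i * (i + j).factorial * (n - i).factorial ≤ (n + j).factorial := by
  rw [← Nat.factorial_mul_ascFactorial i j, ← Nat.factorial_mul_ascFactorial n j,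
    ← Nat.choose_mul_factorial_mul_factorial hi]
  have : (i + 1).ascFactorial j ≤ (n + 1).ascFactorial j := by
    induction j with
    | zero => simp
    | succ j ih =>
      rw [Nat.ascFactorial_succ, Nat.ascFactorial_succ]
      exact Nat.mul_le_mul (by omega) ih
  calc _ = n.choose i * i.factorial * (n - i).factorial * (i + 1).ascFactorial j := by ring
    _ ≤ _ := Nat.mul_le_mul_left _ this

lemma diag_bound {T : ℝ} {I : Set ℝ} (hT : 0 < T) (hI : GoodSet T I) {H : ℝ × ℝ → ℝ}
    (hH : ∀ k : ℕ, ContDiffOn ℝ ((k : ℕ) : ℕ∞) H (I ×ˢ Icc (0:ℝ) T)) (M : ℕ → ℝ → ℝ)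
    (hM : ∀ n m, ∀ t ∈ I, ∀ τ ∈ Icc 0 T, |GW H (I ×ˢ Icc (0:ℝ) T) n m (t, τ)| ≤ M n t)
    (i : ℕ) : ∀ n (m : Fin n → Fin 2), ∀ t ∈ I,
      |iteratedDerivWithin i (fun t => GW H (I ×ˢ Icc (0:ℝ) T) n m (t, t)) I t| ≤ 2 ^ i * M (n + i) t := by
  induction i with
  | zero =>
    intro n m t ht
    simpa using hM n m t ht t (hI.sub ht)
  | succ i ih =>
    intro n m t ht
    have hc := fun c => GW_diag_contDiffOn hT hI (k := i) (hH (i + (n + 1))) (Fin.cons c m)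
    have e : EqOn (derivWithin (fun t => GW H (I ×ˢ Icc (0:ℝ) T) n m (t, t)) I)
        ((fun t => GW H (I ×ˢ Icc (0:ℝ) T) (n + 1) (Fin.cons 0 m) (t, t)) +
          (fun t => GW H (I ×ˢ Icc (0:ℝ) T) (n + 1) (Fin.cons 1 m) (t, t))) I := fun s hs =>
      (GW_deriv_diag hT hI (hH (n + 1)) m hs).derivWithin (hI.ud s hs)
    rw [iteratedDerivWithin_succ', iteratedDerivWithin_congr e ht,
      iteratedDerivWithin_add ht hI.ud (hc 0 t ht) (hc 1 t ht)]
    have h0 := ih (n + 1) (Fin.cons 0 m) t ht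
    have h1 := ih (n + 1) (Fin.cons 1 m) t ht
    rw [show n + (i + 1) = n + 1 + i by ring, pow_succ]
    refine (abs_add_le _ _).trans ?_
    linarith

lemma main_bound {T : ℝ} (hT : 0 < T) {r : ℕ} {γ : ℝ} (hγ₀ : 0 < γ) (hγ₁ : γ ≤ 1)
    {I : Set ℝ} (hI : GoodSet T I) (hpos : ∀ t ∈ I, 0 < t) {H : ℝ × ℝ → ℝ}
    (hH : ∀ k : ℕ, ContDiffOn ℝ ((k : ℕ) : ℕ∞) H (I ×ˢ Icc (0:ℝ) T))
    {x f : ℝ → ℝ} (hx : Continuous x)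
    (hf : ∀ k : ℕ, ContDiffOn ℝ ((k : ℕ) : ℕ∞) f I)
    (hsol : ∀ t ∈ I, x t = f t + FJ H (I ×ˢ Icc (0:ℝ) T) x 0 t)
    (D : ℝ) (hD : 0 < D)
    (hG : ∀ n m, ∀ t ∈ I, ∀ τ ∈ Icc 0 T,
      |GW H (I ×ˢ Icc (0:ℝ) T) n m (t, τ)| ≤ D ^ n * n.factorial * WT r γ n t)
    (Cf : ℝ) (hCf : 0 ≤ Cf)
    (hfb : ∀ n, ∀ t ∈ I, |iteratedDerivWithin n f I t| ≤ Cf * D ^ n * n.factorial * WT r γ n t)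
    (X : ℝ) (hX : ∀ t ∈ Icc 0 T, |x t| ≤ X) :
    ∃ C B : ℝ, 1 ≤ C ∧ 0 < B ∧ ∀ n, ∀ t ∈ I,
      |iteratedDerivWithin n x I t| ≤ C * B ^ n * n.factorial * WT r γ n t := by
  have hX0 : 0 ≤ X := (abs_nonneg _).trans (hX 0 ⟨le_rfl, hT.le⟩)
  set S := I ×ˢ Icc (0:ℝ) T with hS
  obtain ⟨E, hE⟩ : ∃ E, E = 2 * D := ⟨_, rfl⟩
  obtain ⟨CF, hCF⟩ : ∃ CF, CF = T * X + 1 := ⟨_, rfl⟩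
  obtain ⟨C, hC⟩ : ∃ C, C = Cf + CF + X := ⟨_, rfl⟩
  obtain ⟨B, hB⟩ : ∃ B, B = 2 * E + 2 * C := ⟨_, rfl⟩
  have hE0 : 0 < E := by linarith
  have hCF1 : 1 ≤ CF := by have := mul_nonneg hT.le hX0; linarith
  have hC1 : 1 ≤ C := by linarith
  have hB0 : 0 < B := by linarith
  have hDE : D ≤ E := by linarith
  have hEB : 2 * E ≤ B := by linarith
  have hW0 : ∀ n, ∀ t ∈ I, 0 < WT r γ n t := fun n t ht => one_pos.trans_le (WT_one_le r γ n (hpos t ht))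
  have hsm := smooth_all hT hI ⊤ (fun k _ => hH k) hx (fun k _ => hf k) hsol
  have sx : ∀ n : ℕ, ContDiffOn ℝ ((n : ℕ) : ℕ∞) x I := fun n => (hsm n).2 le_top
  have sF : ∀ j n : ℕ, ContDiffOn ℝ ((n : ℕ) : ℕ∞) (FJ H S x j) I := fun j n => (hsm n).1 j le_top
  have sh : ∀ j n : ℕ, ContDiffOn ℝ ((n : ℕ) : ℕ∞) (fun t => GW H S j (fun _ => 0) (t, t)) I :=
    fun j n => GW_diag_contDiffOn hT hI (hH (n + j)) _
  have hh : ∀ j i, ∀ t ∈ I, |iteratedDerivWithin i (fun t => GW H S j (fun _ => 0) (t, t)) I t|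
      ≤ E ^ (i + j) * (i + j).factorial * WT r γ (i + j) t := by
    intro j i t ht
    refine (diag_bound hT hI hH _ hG i j _ t ht).trans ?_
    rw [add_comm j i, ← mul_assoc, ← mul_assoc]
    refine mul_le_mul_of_nonneg_right ?_ (hW0 _ t ht).le
    refine mul_le_mul_of_nonneg_right ?_ (by positivity)
    rw [hE, mul_pow]
    refine mul_le_mul_of_nonneg_right ?_ (by positivity)
    exact pow_le_pow_right₀ (by norm_num) (by omega)
  have hFx : ∀ n, ∀ t ∈ I, |iteratedDerivWithin n (FJ H S x 0) I t| ≤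
      CF * B ^ n * E ^ 0 * (n + 0).factorial * WT r γ (n + 0) t →
      |iteratedDerivWithin n x I t| ≤ C * B ^ n * n.factorial * WT r γ n t := by
    intro n t ht hb
    have e : EqOn x (f + FJ H S x 0) I := hsol
    rw [iteratedDerivWithin_congr e ht, iteratedDerivWithin_add ht hI.ud (hf n t ht) (sF 0 n t ht)]
    refine (abs_add_le _ _).trans ?_
    have h1 := hfb n t ht
    have h2 : Cf * D ^ n * n.factorial * WT r γ n t ≤ Cf * B ^ n * n.factorial * WT r γ n t := by
      have := (hW0 n t ht).le
      have : D ^ n ≤ B ^ n := pow_le_pow_left₀ hD.le (by linarith) n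
      gcongr
    have h3 : 0 ≤ X * B ^ n * n.factorial * WT r γ n t := by
      have := (hW0 n t ht).le
      positivity
    simp only [pow_zero, mul_one, add_zero] at hb
    rw [hC, add_mul, add_mul, add_mul, add_mul, add_mul, add_mul]
    linarith
  have hF : ∀ n, ∀ j, ∀ t ∈ I, |iteratedDerivWithin n (FJ H S x j) I t| ≤
      CF * B ^ n * E ^ j * (n + j).factorial * WT r γ (n + j) t := by
    intro n
    induction n using Nat.strong_induction_on with
    | _ n ih =>
    rcases n with _ | n
    · intro j t ht
      have htT := hI.sub ht
      have hb : ∀ τ ∈ uIoc 0 t, ‖GW H S j (fun _ => 0) (t, τ) * x τ‖ ≤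
          E ^ j * j.factorial * WT r γ j t * X := by
        intro τ hτ
        rw [uIoc_of_le htT.1] at hτ
        have hτ' : τ ∈ Icc 0 T := ⟨hτ.1.le, hτ.2.trans htT.2⟩
        rw [norm_mul]
        have hw := (hW0 j t ht).le
        refine mul_le_mul ?_ (hX τ hτ') (norm_nonneg _) (by positivity)
        refine (hG j _ t ht τ hτ').trans ?_
        have : D ^ j ≤ E ^ j := pow_le_pow_left₀ hD.le hDE j
        gcongr
      have h1 := intervalIntegral.norm_integral_le_of_norm_le_const hb
      rw [sub_zero, abs_of_pos (hpos t ht)] at h1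
      simp only [iteratedDerivWithin_zero, pow_zero, mul_one, zero_add]
      refine h1.trans ?_
      have hw := (hW0 j t ht).le
      calc E ^ j * j.factorial * WT r γ j t * X * t ≤ E ^ j * j.factorial * WT r γ j t * X * T := by
            have := htT.2
            gcongr
        _ = (T * X) * (E ^ j * j.factorial * WT r γ j t) := by ring
        _ ≤ CF * (E ^ j * j.factorial * WT r γ j t) := by
            refine mul_le_mul_of_nonneg_right (by linarith) (by positivity)
        _ = _ := by ring
    · intro j t ht
      have e : EqOn (derivWithin (FJ H S x j) I)
          ((fun t => GW H S j (fun _ => 0) (t, t) * x t) + FJ H S x (j + 1)) I := fun s hs =>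
        (FJ_deriv hT hI (hH (j + 1)) hx hs).derivWithin (hI.ud s hs)
      rw [iteratedDerivWithin_succ', iteratedDerivWithin_congr e ht,
        iteratedDerivWithin_add ht hI.ud ((sh j n t ht).mul (sx n t ht)) (sF (j + 1) n t ht)]
      have h2 := ih n (by omega) (j + 1) t ht
      have hw := (hW0 (n + j + 1) t ht).le
      have h1 : |iteratedDerivWithin n (fun t => GW H S j (fun _ => 0) (t, t) * x t) I t| ≤
          2 * (C * (E ^ j * B ^ n * (n + j).factorial * WT r γ (n + j + 1) t)) := by
        have hl := norm_iteratedFDerivWithin_mul_le (sh j n) (sx n) hI.ud ht (n := n) le_rfl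
        simp only [norm_iteratedFDerivWithin_eq_norm_iteratedDerivWithin, Real.norm_eq_abs] at hl
        refine hl.trans ?_
        have hterm : ∀ i ∈ Finset.range (n + 1), (n.choose i : ℝ) *
            |iteratedDerivWithin i (fun t => GW H S j (fun _ => 0) (t, t)) I t| *
            |iteratedDerivWithin (n - i) x I t| ≤ (1 / 2 : ℝ) ^ i *
              (C * (E ^ j * B ^ n * (n + j).factorial * WT r γ (n + j + 1) t)) := by
          intro i hi
          have hin : i ≤ n := by simpa [Nat.lt_succ_iff] using hi
          have b1 := hh j i t ht
          have b2 := hFx (n - i) t ht (ih (n - i) (by omega) 0 t ht)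
          have bw : WT r γ (i + j) t * WT r γ (n - i) t ≤ WT r γ (n + j + 1) t := by
            have := WT_mul (r := r) hγ₀ hγ₁ (i + j) (n - i) (hpos t ht)
            rwa [show i + j + (n - i) + 1 = n + j + 1 by omega] at this
          have bf : (n.choose i : ℝ) * (i + j).factorial * (n - i).factorial ≤ (n + j).factorial := by
            exact_mod_cast choose_fact n i j hin
          have bp : E ^ i * B ^ (n - i) ≤ (1 / 2 : ℝ) ^ i * B ^ n := by
            have h3 : E ^ i ≤ (1 / 2 * B) ^ i := pow_le_pow_left₀ hE0.le (by linarith) i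
            calc E ^ i * B ^ (n - i) ≤ (1 / 2 * B) ^ i * B ^ (n - i) := by gcongr
              _ = (1 / 2 : ℝ) ^ i * (B ^ i * B ^ (n - i)) := by rw [mul_pow]; ring
              _ = _ := by rw [← pow_add, show i + (n - i) = n by omega]
          have w1 := (hW0 (i + j) t ht).le
          have w2 := (hW0 (n - i) t ht).le
          calc _ ≤ (n.choose i : ℝ) * (E ^ (i + j) * (i + j).factorial * WT r γ (i + j) t) *
                (C * B ^ (n - i) * (n - i).factorial * WT r γ (n - i) t) := by gcongr
            _ = C * E ^ j * (E ^ i * B ^ (n - i)) *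
                ((n.choose i : ℝ) * (i + j).factorial * (n - i).factorial) *
                (WT r γ (i + j) t * WT r γ (n - i) t) := by rw [pow_add]; ring
            _ ≤ C * E ^ j * ((1 / 2 : ℝ) ^ i * B ^ n) * (n + j).factorial * WT r γ (n + j + 1) t := by
                gcongr
            _ = _ := by ring
        refine (Finset.sum_le_sum hterm).trans ?_
        rw [← Finset.sum_mul]
        refine mul_le_mul_of_nonneg_right (sum_geometric_two_le _) (by positivity)
      refine (abs_add_le _ _).trans ((add_le_add h1 h2).trans ?_)
      rw [show n + (j + 1) = n + j + 1 by ring, show n + 1 + j = n + j + 1 by ring]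
      have hfac : ((n + j).factorial : ℝ) ≤ (n + j + 1).factorial := by
        exact_mod_cast Nat.factorial_le (by omega)
      calc 2 * (C * (E ^ j * B ^ n * (n + j).factorial * WT r γ (n + j + 1) t)) +
            CF * B ^ n * E ^ (j + 1) * (n + j + 1).factorial * WT r γ (n + j + 1) t
          ≤ 2 * (C * (E ^ j * B ^ n * (n + j + 1).factorial * WT r γ (n + j + 1) t)) +
            CF * B ^ n * E ^ (j + 1) * (n + j + 1).factorial * WT r γ (n + j + 1) t := by
            gcongr
        _ = (2 * C + CF * E) * (E ^ j * B ^ n * (n + j + 1).factorial * WT r γ (n + j + 1) t) := by ring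
        _ ≤ (CF * B) * (E ^ j * B ^ n * (n + j + 1).factorial * WT r γ (n + j + 1) t) := by
            refine mul_le_mul_of_nonneg_right ?_ (by positivity)
            rw [hB]
            nlinarith
        _ = _ := by ring
  exact ⟨C, B, hC1, hB0, fun n t ht => hFx n t ht (hF n 0 t ht)⟩


lemma iter1_eq {T : ℝ} (f : ℝ → ℝ) (k : ℕ) {t : ℝ} (ht : t ∈ Ioc 0 T) :
    iteratedDerivWithin k f (Ioc 0 T) t = iteratedDerivWithin k f (Icc 0 T) t := by
  have e : Ioc (0:ℝ) T = Icc 0 T ∩ Ioi 0 := by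
    ext s; simp only [mem_Ioc, mem_inter_iff, mem_Icc, mem_Ioi]
    exact ⟨fun h => ⟨⟨h.1.le, h.2⟩, h.1⟩, fun h => ⟨h.2, h.1.2⟩⟩
  rw [e, iteratedDerivWithin, iteratedDerivWithin, iteratedFDerivWithin_inter_open isOpen_Ioi ht.1]

lemma iter2_eq {T : ℝ} (H : ℝ × ℝ → ℝ) (k : ℕ) {p : ℝ × ℝ} (hp : p.1 ∈ Ioc 0 T) :
    iteratedFDerivWithin ℝ k H (Ioc 0 T ×ˢ Icc 0 T) p =
      iteratedFDerivWithin ℝ k H (Icc 0 T ×ˢ Icc 0 T) p := by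
  have e : Ioc (0:ℝ) T ×ˢ Icc (0:ℝ) T = (Icc 0 T ×ˢ Icc 0 T) ∩ (Ioi 0 ×ˢ univ) := by
    ext s; simp only [mem_Ioc, mem_inter_iff, mem_Icc, mem_Ioi, mem_prod, mem_univ]
    exact ⟨fun h => ⟨⟨⟨h.1.1.le, h.1.2⟩, h.2⟩, h.1.1, trivial⟩,
      fun h => ⟨⟨h.2.1, h.1.1.2⟩, h.1.2⟩⟩
  have hm : p ∈ Ioi (0:ℝ) ×ˢ (univ : Set ℝ) := ⟨hp.1, trivial⟩
  rw [e, iteratedFDerivWithin_inter_open (isOpen_Ioi.prod isOpen_univ) hm]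

theorem smoothness_BStar
    (T : ℝ) (hT : 0 < T) (r : ℕ) (γ : ℝ) (hr : 1 ≤ r) (hγ₀ : 0 < γ) (hγ₁ : γ ≤ 1)
    (H : ℝ × ℝ → ℝ) (A₁ : ℝ) (hA₁ : 0 < A₁)
    -- `H` is infinitely differentiable on `(0,T] × [0,T]`
    (hHs : ContDiffOn ℝ (⊤ : ℕ∞) H (Set.Ioc 0 T ×ˢ Set.Icc 0 T))
    -- and `r` times continuously differentiable on `[0,T]²`
    (hHr : ContDiffOn ℝ r H (Set.Icc 0 T ×ˢ Set.Icc 0 T))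
    -- bounds `|∂^{k₁+k₂} H| ≤ A₁^{k₁+k₂} (k₁+k₂)^{k₁+k₂}` for total order `≤ r` on `[0,T]²`
    (hHbd₁ : ∀ k : ℕ, k ≤ r → ∀ m : Fin k → Fin 2,
      ∀ p ∈ Set.Icc (0:ℝ) T ×ˢ Set.Icc (0:ℝ) T,
        |iteratedFDerivWithin ℝ k H (Set.Icc 0 T ×ˢ Set.Icc 0 T) p
            (fun j => dir2 (m j))| ≤ A₁ ^ k * (k : ℝ) ^ k)
    -- bounds for total order `> r` on `(0,T] × [0,T]`
    (hHbd₂ : ∀ k : ℕ, r < k → ∀ m : Fin k → Fin 2,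
      ∀ p ∈ Set.Ioc (0:ℝ) T ×ˢ Set.Icc (0:ℝ) T,
        |iteratedFDerivWithin ℝ k H (Set.Ioc 0 T ×ˢ Set.Icc 0 T) p
            (fun j => dir2 (m j))| ≤
          A₁ ^ k * (k : ℝ) ^ k * p.1 ^ (-((k : ℝ) - r - 1 + γ)))
    (f : ℝ → ℝ) (A₂ : ℝ) (hA₂ : 0 < A₂) (hf : MemBStar T A₂ r γ f) :
    ∃ x : ℝ → ℝ,
      (ContinuousOn x (Set.Icc 0 T) ∧
        ∀ t ∈ Set.Icc (0:ℝ) T, x t - ∫ τ in (0:ℝ)..t, H (t, τ) * x τ = f t) ∧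
      (∀ y : ℝ → ℝ, ContinuousOn y (Set.Icc 0 T) →
        (∀ t ∈ Set.Icc (0:ℝ) T, y t - ∫ τ in (0:ℝ)..t, H (t, τ) * y τ = f t) →
        ∀ t ∈ Set.Icc (0:ℝ) T, y t = x t) ∧
      ∃ A : ℝ, 0 < A ∧ MemBStar T A r γ x := by
  obtain ⟨hfr, hfs, hf0, hf1, hf2⟩ := hf
  obtain ⟨x, hx, hsol, huniq⟩ := volterra_exists T hT H hHr.continuousOn f hfr.continuousOn
  refine ⟨x, ⟨hx.continuousOn, hsol⟩, huniq, ?_⟩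
  have gI := goodSet_Icc hT
  have gO := goodSet_Ioc hT
  have hF0 : ∀ S t, FJ H S x 0 t = ∫ τ in (0:ℝ)..t, H (t, τ) * x τ := by
    intro S t
    simp [FJ, GW]
  have hHk : ∀ k : ℕ, ContDiffOn ℝ ((k : ℕ) : ℕ∞) H (Ioc (0:ℝ) T ×ˢ Icc (0:ℝ) T) := fun k =>
    hHs.of_le (by exact_mod_cast le_top)
  have hfk : ∀ k : ℕ, ContDiffOn ℝ ((k : ℕ) : ℕ∞) f (Ioc (0:ℝ) T) := fun k =>
    hfs.of_le (by exact_mod_cast le_top)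
  have hsolI : ∀ t ∈ Icc (0:ℝ) T, x t = f t + FJ H (Icc 0 T ×ˢ Icc 0 T) x 0 t := by
    intro t ht
    rw [hF0, ← hsol t ht]; ring
  have hsolO : ∀ t ∈ Ioc (0:ℝ) T, x t = f t + FJ H (Ioc 0 T ×ˢ Icc 0 T) x 0 t := by
    intro t ht
    rw [hF0, ← hsol t (Ioc_subset_Icc_self ht)]; ring
  have xr : ContDiffOn ℝ r x (Icc 0 T) := by
    refine (smooth_all hT gI (r : ℕ∞) (fun k hk => hHr.of_le ?_) hx (fun k hk => hfr.of_le ?_)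
      hsolI r).2 le_rfl
    · exact_mod_cast hk
    · exact_mod_cast hk
  have xs : ContDiffOn ℝ (⊤ : ℕ∞) x (Ioc 0 T) := by
    refine contDiffOn_infty.2 fun n => ?_
    exact (smooth_all hT gO ⊤ (fun k _ => hHk k) hx (fun k _ => hfk k) hsolO n).2 le_top
  obtain ⟨X, hX⟩ := isCompact_Icc.exists_bound_of_continuousOn (hx.continuousOn (s := Icc 0 T))
  have hX0 : 0 ≤ X := (norm_nonneg _).trans (hX 0 ⟨le_rfl, hT.le⟩)
  -- bounds on the high order derivatives
  obtain ⟨D, hDdef⟩ : ∃ D, D = (A₁ + A₂) * Real.exp 1 := ⟨_, rfl⟩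
  have hD : 0 < D := by rw [hDdef]; positivity
  have hconv : ∀ A : ℝ, 0 < A → A ≤ A₁ + A₂ → ∀ k : ℕ,
      A ^ k * (k : ℝ) ^ k ≤ D ^ k * k.factorial := by
    intro A hA hAle k
    rw [hDdef, mul_pow, mul_assoc]
    exact mul_le_mul (pow_le_pow_left₀ hA.le hAle k) (pow_self_le k) (by positivity) (by positivity)
  have hG : ∀ n m, ∀ t ∈ Ioc 0 T, ∀ τ ∈ Icc 0 T,
      |GW H (Ioc 0 T ×ˢ Icc (0:ℝ) T) n m (t, τ)| ≤ D ^ n * n.factorial * WT r γ n t := by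
    intro n m t ht τ hτ
    have hc := hconv A₁ hA₁ (by linarith) n
    rcases le_or_gt n r with hn | hn
    · rw [GW, iter2_eq H n (p := (t, τ)) ht]
      refine ((hHbd₁ n hn m (t, τ) ⟨Ioc_subset_Icc_self ht, hτ⟩).trans hc).trans ?_
      exact le_mul_of_one_le_right (by positivity) (WT_one_le r γ n ht.1)
    · refine (hHbd₂ n hn m (t, τ) ⟨ht, hτ⟩).trans ?_
      exact mul_le_mul hc (WT_ge hγ₀ hn ht.1) (Real.rpow_nonneg ht.1.le _) (by positivity)
  have hfb : ∀ n, ∀ t ∈ Ioc 0 T, |iteratedDerivWithin n f (Ioc 0 T) t| ≤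
      (A₂ + 1) * D ^ n * n.factorial * WT r γ n t := by
    intro n t ht
    have hc := hconv A₂ hA₂ (by linarith) n
    have hw := WT_one_le r γ n ht.1
    have hc' : D ^ n * n.factorial ≤ (A₂ + 1) * D ^ n * n.factorial := by
      rw [mul_assoc]
      exact le_mul_of_one_le_left (by positivity) (by linarith)
    rcases Nat.eq_zero_or_pos n with rfl | hn0
    · have := hf0 t (Ioc_subset_Icc_self ht)
      simp only [iteratedDerivWithin_zero, pow_zero, mul_one, Nat.factorial_zero, Nat.cast_one]
      nlinarith
    rcases le_or_gt n r with hn | hn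
    · rw [iter1_eq f n ht]
      refine ((hf1 n hn0 hn t (Ioc_subset_Icc_self ht)).trans (hc.trans hc')).trans ?_
      exact le_mul_of_one_le_right (by positivity) hw
    · refine (hf2 n hn t ht).trans ?_
      exact mul_le_mul (hc.trans hc') (WT_ge hγ₀ hn ht.1) (Real.rpow_nonneg ht.1.le _) (by positivity)
  obtain ⟨C, B, hC, hB, hxb⟩ := main_bound hT hγ₀ hγ₁ gO (fun t ht => ht.1) hHk hx hfk hsolO D hD hG
    (A₂ + 1) (by linarith) hfb X hX
  -- bounds on the low order derivatives, by compactness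
  have hlow : ∀ k : ℕ, ∃ M : ℝ, 0 ≤ M ∧ (k ≤ r → ∀ t ∈ Icc (0:ℝ) T,
      |iteratedDerivWithin k x (Icc 0 T) t| ≤ M) := by
    intro k
    by_cases hk : k ≤ r
    · have hcont := xr.continuousOn_iteratedDerivWithin (m := k) (by exact_mod_cast hk) gI.ud
      obtain ⟨M, hM⟩ := isCompact_Icc.exists_bound_of_continuousOn hcont
      exact ⟨M, (norm_nonneg _).trans (hM 0 ⟨le_rfl, hT.le⟩), fun _ => hM⟩
    · exact ⟨0, le_rfl, fun h => absurd h hk⟩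
  choose M hM0 hM using hlow
  have hsum0 : 0 ≤ ∑ k ∈ Finset.range (r + 1), M k := Finset.sum_nonneg fun k _ => hM0 k
  have hL : (1:ℝ) ≤ max 1 T := le_max_left _ _
  have hCBL : 0 < C * B * max 1 T := by positivity
  obtain ⟨A, hA⟩ : ∃ A, A = C * B * max 1 T + X + ∑ k ∈ Finset.range (r + 1), M k + 1 := ⟨_, rfl⟩
  have hA1 : 1 ≤ A := by linarith
  refine ⟨A, by linarith, xr, xs, ?_, ?_, ?_⟩
  · intro t ht
    exact (hX t ht).trans (by linarith)
  · intro k hk1 hkr t ht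
    refine (hM k hkr t ht).trans ?_
    have h1 : M k ≤ ∑ k ∈ Finset.range (r + 1), M k :=
      Finset.single_le_sum (f := M) (fun k _ => hM0 k) (Finset.mem_range.2 (by omega))
    have h2 : A ≤ A ^ k := le_self_pow₀ hA1 (by omega)
    have h3 : (1:ℝ) ≤ (k : ℝ) ^ k := one_le_pow₀ (by exact_mod_cast hk1)
    have h4 : A ^ k ≤ A ^ k * (k : ℝ) ^ k := le_mul_of_one_le_right (by positivity) h3
    linarith
  · intro k hk t ht
    refine (hxb k t ht).trans ?_
    have hw := WT_le hγ₀ hγ₁ hk ht.1 ht.2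
    have hp := Real.rpow_nonneg ht.1.le (-((k : ℝ) - r - 1 + γ))
    have hfac : (k.factorial : ℝ) ≤ (k : ℝ) ^ k := by exact_mod_cast Nat.factorial_le_pow k
    have hCk : C ≤ C ^ k := le_self_pow₀ hC (by omega)
    calc C * B ^ k * k.factorial * WT r γ k t
        ≤ C ^ k * B ^ k * (k : ℝ) ^ k * ((max 1 T) ^ k * t ^ (-((k : ℝ) - r - 1 + γ))) := by
          have := (one_pos.trans_le (WT_one_le r γ k ht.1)).le
          gcongr
      _ = (C * B * max 1 T) ^ k * (k : ℝ) ^ k * t ^ (-((k : ℝ) - r - 1 + γ)) := by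
          rw [mul_pow, mul_pow]; ring
      _ ≤ A ^ k * (k : ℝ) ^ k * t ^ (-((k : ℝ) - r - 1 + γ)) := by
          have : (C * B * max 1 T) ^ k ≤ A ^ k := pow_le_pow_left₀ hCBL.le (by linarith) k
          gcongr
end

section
/- Let T > 0, M > 0, let r ≥ 1 be an integer and γ > 0 a real number, and let s be as in the definition of Q*_{r,γ}. Regard X = Q*_{r,γ}([0,T],M) as a subset of the Banach space C[0,T] with the supremum norm. Then there exist constants c₁, c₂ > 0 and n₀ ∈ ℕ such that for all n ≥ n₀: c₁ n^{−s} ≤ d_n(X, C[0,T]) ≤ c₂ n^{−s} and c₁ n^{−s} ≤ δ_n(X) ≤ c₂ n^{−s}. -/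
open Set Metric

/-- The Kolmogorov `n`-width of a subset `X` of a real normed space `B`:
the infimum, over all linear subspaces `L ⊆ B` of dimension at most `n`, of
`sup_{x ∈ X} inf_{u ∈ L} ‖x − u‖`. -/
noncomputable def kolmogorovWidth {B : Type*} [NormedAddCommGroup B] [NormedSpace ℝ B]
    (n : ℕ) (X : Set B) : ℝ :=
  sInf { d : ℝ | ∃ L : Submodule ℝ B, FiniteDimensional ℝ L ∧
    Module.finrank ℝ L ≤ n ∧ d = ⨆ x : X, ⨅ u : L, ‖(x : B) - (u : B)‖ }

/-- The Babenko `n`-width of a subset `X` of a real normed space: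
the infimum, over all continuous maps `Π : X → ℝⁿ`, of
`sup_{x ∈ X} diam (Π⁻¹(Π x))`. -/
noncomputable def babenkoWidth {B : Type*} [NormedAddCommGroup B]
    (n : ℕ) (X : Set B) : ℝ :=
  sInf { d : ℝ | ∃ p : X → (Fin n → ℝ), Continuous p ∧
    d = ⨆ x : X, Metric.diam (Subtype.val '' (p ⁻¹' {p x})) }

open scoped ContDiff

/-- Polynomial extrapolation: a fixed affine combination of values near zero gives the value at one. -/
lemma extrapolation_det (m : ℕ) (t : ℕ → ℝ) (ht : Function.Injective t) :
    ∃ w : ℕ → ℝ, (∑ j ∈ Finset.range (m + 1), w j = 1) ∧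
      ∀ A : (Fin m → ℝ) →L[ℝ] (Fin m → ℝ),
        (ContinuousLinearMap.id ℝ (Fin m → ℝ) + A).det =
          ∑ j ∈ Finset.range (m + 1), w j * (ContinuousLinearMap.id ℝ (Fin m → ℝ) + t j • A).det := by
  have key : ∀ p : Polynomial ℝ, p.natDegree ≤ m →
      p.eval 1 = ∑ j ∈ Finset.range (m + 1),
        (Lagrange.basis (Finset.range (m + 1)) t j).eval 1 * p.eval (t j) := by
    intro p hp
    have h1 := Lagrange.eq_interpolate_of_eval_eq (s := Finset.range (m + 1)) (v := t) (f := p)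
      (fun j => p.eval (t j)) ht.injOn (by
        simp only [Finset.card_range]
        exact lt_of_le_of_lt Polynomial.degree_le_natDegree (by exact_mod_cast Nat.lt_succ_of_le hp))
      (fun i _ => rfl)
    conv_lhs => rw [h1]
    simp [Lagrange.interpolate_apply, Polynomial.eval_finsetSum, mul_comm]
  refine ⟨fun j => (Lagrange.basis (Finset.range (m + 1)) t j).eval 1, ?_, ?_⟩
  · have := key 1 (by simp)
    simpa using this.symm
  · intro A
    let B := LinearMap.toMatrix' (A : (Fin m → ℝ) →ₗ[ℝ] (Fin m → ℝ))
    have hdet : ∀ τ : ℝ, (ContinuousLinearMap.id ℝ (Fin m → ℝ) + τ • A).det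
        = Polynomial.eval τ (Matrix.det ((Polynomial.X : Polynomial ℝ) • B.map Polynomial.C
          + (1 : Matrix (Fin m) (Fin m) ℝ).map Polynomial.C)) := by
      intro τ
      rw [ContinuousLinearMap.det, ← LinearMap.det_toMatrix', ← Polynomial.coe_evalRingHom,
        RingHom.map_det]
      congr 1
      ext i j
      by_cases hij : i = j <;>
      simp [B, LinearMap.toMatrix'_apply, hij] <;> ring
    have h1 := hdet 1
    rw [one_smul] at h1
    rw [h1, key _ ((Polynomial.natDegree_det_X_add_C_le _ _).trans (by simp))]
    simp only [hdet]

/-- A `C^1` self-map of the unit cube sending faces to the corresponding faces is nondegenerate. -/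
lemma exists_det_ne_zero (m : ℕ) (F : (Fin m → ℝ) → (Fin m → ℝ)) (hF : ContDiff ℝ 1 F)
    (h0 : ∀ x ∈ Icc (0 : Fin m → ℝ) 1, ∀ i, x i = 0 → F x i = 0)
    (h1 : ∀ x ∈ Icc (0 : Fin m → ℝ) 1, ∀ i, x i = 1 → F x i = 1) :
    ∃ x ∈ Icc (0 : Fin m → ℝ) 1, (fderiv ℝ F x).det ≠ 0 := by
  by_contra! hcon
  set Q := Icc (0 : Fin m → ℝ) 1 with hQ
  have hQc : IsCompact Q := isCompact_Icc
  set u : (Fin m → ℝ) → (Fin m → ℝ) := fun x => F x - x with hu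
  have hud : ContDiff ℝ 1 u := hF.sub contDiff_id
  have hu0 : ∀ x ∈ Q, ∀ i, x i = 0 → u x i = 0 := fun x hx i hi => by simp [hu, h0 x hx i hi, hi]
  have hu1 : ∀ x ∈ Q, ∀ i, x i = 1 → u x i = 0 := fun x hx i hi => by simp [hu, h1 x hx i hi, hi]
  have huf : Continuous (fderiv ℝ u) := hud.continuous_fderiv (by norm_num)
  obtain ⟨K, hK0, hK⟩ : ∃ K : ℝ, 0 < K ∧ ∀ x ∈ Q, ‖fderiv ℝ u x‖ ≤ K := by
    obtain ⟨K, hK⟩ := hQc.exists_bound_of_continuousOn huf.continuousOn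
    exact ⟨max K 1, by positivity, fun x hx => (hK x hx).trans (le_max_left _ _)⟩
  have hlip : ∀ x ∈ Q, ∀ y ∈ Q, ‖u x - u y‖ ≤ K * ‖x - y‖ := fun x hx y hy =>
    (convex_Icc _ _).norm_image_sub_le_of_norm_fderiv_le
      (fun z _ => (hud.differentiable (by norm_num)) z) hK hy hx
  -- positivity of det near identity
  obtain ⟨δ, hδ, hdet⟩ : ∃ δ > 0, ∀ B : (Fin m → ℝ) →L[ℝ] (Fin m → ℝ), ‖B‖ < δ →
      0 < (ContinuousLinearMap.id ℝ (Fin m → ℝ) + B).det := by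
    have hc : Continuous fun B : (Fin m → ℝ) →L[ℝ] (Fin m → ℝ) =>
        (ContinuousLinearMap.id ℝ (Fin m → ℝ) + B).det :=
      ContinuousLinearMap.continuous_det.comp (continuous_const.add continuous_id)
    have : ∀ᶠ B in nhds (0 : (Fin m → ℝ) →L[ℝ] (Fin m → ℝ)),
        0 < (ContinuousLinearMap.id ℝ (Fin m → ℝ) + B).det := by
      apply hc.continuousAt.eventually_const_lt
      simp [ContinuousLinearMap.det]
    obtain ⟨δ, hδ, h⟩ := Metric.eventually_nhds_iff.1 this
    exact ⟨δ, hδ, fun B hB => h (by simpa using hB)⟩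
  have main : ∀ t : ℝ, 0 < t → t * K < 1 → t * K < δ →
      ∫ x in Q, (ContinuousLinearMap.id ℝ (Fin m → ℝ) + t • fderiv ℝ u x).det = 1 := by
    intro t ht htK htδ
    set f : (Fin m → ℝ) → (Fin m → ℝ) := fun x => x + t • u x with hf
    have hinj : InjOn f Q := by
      intro x hx y hy hxy
      by_contra hne
      have : x - y = - (t • (u x - u y)) := by
        have : x + t • u x = y + t • u y := hxy
        rw [smul_sub, neg_sub]
        linear_combination (exp := 1) this
      have h2 : ‖x - y‖ ≤ t * (K * ‖x - y‖) := by
        conv_lhs => rw [this]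
        rw [norm_neg, norm_smul, Real.norm_of_nonneg ht.le]
        gcongr
        exact hlip x hx y hy
      have : 0 < ‖x - y‖ := norm_pos_iff.2 (sub_ne_zero.2 hne)
      nlinarith
    have hcoord : ∀ x ∈ Q, ∀ i, |u x i| ≤ K * x i ∧ |u x i| ≤ K * (1 - x i) := by
      intro x hx i
      constructor
      · have hy : Function.update x i 0 ∈ Q := by
          constructor
          · intro j; by_cases h : j = i
            · subst h; simp
            · simpa [h] using hx.1 j
          · intro j; by_cases h : j = i
            · subst h; simp
            · simpa [h] using hx.2 j
        have h3 := hlip x hx _ hy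
        have h4 := (norm_le_pi_norm (u x - u (Function.update x i 0)) i).trans h3
        have h5 : ‖x - Function.update x i 0‖ ≤ x i := by
          rw [pi_norm_le_iff_of_nonneg (hx.1 i)]
          intro j
          by_cases h : j = i
          · subst h; simp [abs_of_nonneg (hx.1 j)]
          · simpa [h] using hx.1 i
        rw [Pi.sub_apply, hu0 _ hy i (by simp), sub_zero, Real.norm_eq_abs] at h4
        exact h4.trans (by gcongr)
      · have hy : Function.update x i 1 ∈ Q := by
          constructor
          · intro j; by_cases h : j = i
            · subst h; simp
            · simpa [h] using hx.1 j
          · intro j; by_cases h : j = i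
            · subst h; simp
            · simpa [h] using hx.2 j
        have hx1 : 0 ≤ 1 - x i := sub_nonneg.2 (hx.2 i)
        have h3 := hlip x hx _ hy
        have h4 := (norm_le_pi_norm (u x - u (Function.update x i 1)) i).trans h3
        have h5 : ‖x - Function.update x i 1‖ ≤ 1 - x i := by
          rw [pi_norm_le_iff_of_nonneg hx1]
          intro j
          by_cases h : j = i
          · subst h; simp [abs_sub_comm (x j), abs_of_nonneg hx1]
          · simpa [h] using hx1
        rw [Pi.sub_apply, hu1 _ hy i (by simp), sub_zero, Real.norm_eq_abs] at h4
        exact h4.trans (by gcongr)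
    have himg : f '' Q = Q := by
      apply Subset.antisymm
      · rintro _ ⟨x, hx, rfl⟩
        constructor
        · intro i
          have := (hcoord x hx i).1
          have h6 := neg_abs_le (u x i)
          have h7 := hx.1 i
          simp only [hf, Pi.add_apply, Pi.smul_apply, smul_eq_mul, Pi.zero_apply] at *
          nlinarith [mul_le_mul_of_nonneg_left this ht.le, mul_le_mul_of_nonneg_left h6 ht.le]
        · intro i
          have := (hcoord x hx i).2
          have h6 := le_abs_self (u x i)
          have h7 := hx.2 i
          simp only [hf, Pi.add_apply, Pi.smul_apply, smul_eq_mul, Pi.one_apply] at *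
          nlinarith [mul_le_mul_of_nonneg_left this ht.le, mul_le_mul_of_nonneg_left h6 ht.le]
      · intro y hy
        let cl : (Fin m → ℝ) → (Fin m → ℝ) := fun z i => max 0 (min 1 (z i))
        have hcl : ∀ z, cl z ∈ Q := fun z =>
          ⟨fun i => le_max_left _ _, fun i => max_le zero_le_one (min_le_left _ _)⟩
        let G : Q → Q := fun x => ⟨cl (y - t • u x), hcl _⟩
        have hG : ContractingWith (Real.toNNReal (t * K)) G := by
          refine ⟨by simpa using htK, LipschitzWith.of_dist_le_mul fun a b => ?_⟩
          rw [Real.coe_toNNReal _ (by positivity)]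
          simp only [Subtype.dist_eq, G]
          rw [dist_pi_le_iff (by positivity)]
          intro i
          have h8 : dist (cl (y - t • u a) i) (cl (y - t • u b) i)
              ≤ |(y - t • u a) i - (y - t • u b) i| := by
            simp only [cl, Real.dist_eq]
            refine (abs_max_sub_max_le_max _ _ _ _).trans ?_
            simp only [sub_self, abs_zero]
            refine max_le (abs_nonneg _) ((abs_min_sub_min_le_max _ _ _ _).trans ?_)
            simp
          refine h8.trans ?_
          have h9 := (norm_le_pi_norm (u a - u b) i).trans (hlip a a.2 b b.2)
          have : (y - t • u a) i - (y - t • u b) i = - (t * (u a - u b) i) := by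
            simp; ring
          rw [this, abs_neg, abs_mul, abs_of_pos ht, mul_assoc, dist_eq_norm]
          gcongr
          exact h9
        have : Nonempty Q := ⟨⟨y, hy⟩⟩
        have : CompleteSpace Q := hQc.isClosed.isComplete.completeSpace_coe
        have hfix := hG.fixedPoint_isFixedPt
        set x := ContractingWith.fixedPoint G hG
        have hx : ∀ i, (x : Fin m → ℝ) i = max 0 (min 1 (y i - t * u x i)) := by
          intro i
          have := congrArg (fun z : Q => (z : Fin m → ℝ) i) hfix
          simpa [G, cl] using this.symm
        refine ⟨x, x.2, ?_⟩
        funext i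
        have hxi := hx i
        have hy0 := hy.1 i
        have hy1 := hy.2 i
        simp only [Pi.zero_apply, Pi.one_apply] at hy0 hy1
        simp only [hf, Pi.add_apply, Pi.smul_apply, smul_eq_mul]
        rcases lt_or_ge 1 (y i - t * u x i) with hc | hc
        · rw [min_eq_left hc.le, max_eq_right zero_le_one] at hxi
          have := hu1 x x.2 i hxi
          rw [this] at hc; linarith
        · rw [min_eq_right hc] at hxi
          rcases lt_or_ge (y i - t * u x i) 0 with hd | hd
          · rw [max_eq_left hd.le] at hxi
            have := hu0 x x.2 i hxi
            rw [this] at hd; linarith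
          · rw [max_eq_right hd] at hxi
            linarith
    have hder : ∀ x ∈ Q, HasFDerivWithinAt f
        (ContinuousLinearMap.id ℝ (Fin m → ℝ) + t • fderiv ℝ u x) Q x := by
      intro x _
      exact ((hasFDerivAt_id x).add
        (((hud.differentiable (by norm_num)) x).hasFDerivAt.const_smul t)).hasFDerivWithinAt
    have hcv := MeasureTheory.integral_image_eq_integral_abs_det_fderiv_smul MeasureTheory.volume
      hQc.measurableSet hder hinj (fun _ => (1 : ℝ))
    rw [himg] at hcv
    have hvol : ∫ x in Q, (1 : ℝ) = 1 := by
      simp [hQ, Real.volume_Icc_pi, MeasureTheory.measureReal_def]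
    rw [hvol] at hcv
    rw [hcv]
    refine MeasureTheory.setIntegral_congr_fun hQc.measurableSet fun x hx => ?_
    have : 0 < (ContinuousLinearMap.id ℝ (Fin m → ℝ) + t • fderiv ℝ u x).det := by
      apply hdet
      rw [norm_smul, Real.norm_of_nonneg ht.le]
      exact lt_of_le_of_lt (mul_le_mul_of_nonneg_left (hK x hx) ht.le) htδ
    simp [abs_of_pos this]
  set t0 : ℝ := min 1 δ / (2 * K) with ht0
  have ht0p : 0 < t0 := by positivity
  have ht0K : t0 * K = min 1 δ / 2 := by rw [ht0]; field_simp
  set t : ℕ → ℝ := fun j => t0 / (j + 1) with htdef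
  have htinj : Function.Injective t := by
    intro a b hab
    simp only [htdef] at hab
    have ha : (0:ℝ) < a + 1 := by positivity
    have hb : (0:ℝ) < b + 1 := by positivity
    rw [div_eq_div_iff ha.ne' hb.ne'] at hab
    have := mul_left_cancel₀ ht0p.ne' hab
    exact_mod_cast (by linarith : (a:ℝ) = b)
  obtain ⟨w, hw1, hw⟩ := extrapolation_det m t htinj
  have htj : ∀ j, 0 < t j ∧ t j * K < 1 ∧ t j * K < δ := by
    intro j
    have hp : 0 < t j := by simp only [htdef]; positivity
    have hle : t j ≤ t0 := div_le_self ht0p.le (by simp)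
    have : t j * K ≤ min 1 δ / 2 := ht0K ▸ mul_le_mul_of_nonneg_right hle hK0.le
    have hm : 0 < min 1 δ := by positivity
    exact ⟨hp, by linarith [min_le_left 1 δ], by linarith [min_le_right 1 δ]⟩
  have hfin : ∫ x in Q, (ContinuousLinearMap.id ℝ (Fin m → ℝ) + fderiv ℝ u x).det = 1 := by
    have hfe := funext fun x => hw (fderiv ℝ u x)
    rw [hfe, MeasureTheory.integral_finsetSum]
    · simp_rw [MeasureTheory.integral_const_mul]
      rw [← hw1]
      refine Finset.sum_congr rfl fun j _ => ?_
      rw [main _ (htj j).1 (htj j).2.1 (htj j).2.2, mul_one]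
    · intro j _
      refine ContinuousOn.integrableOn_compact hQc (Continuous.continuousOn ?_)
      exact continuous_const.mul (ContinuousLinearMap.continuous_det.comp
        (continuous_const.add (huf.const_smul (t j))))
  have hz : ∫ x in Q, (ContinuousLinearMap.id ℝ (Fin m → ℝ) + fderiv ℝ u x).det = 0 := by
    rw [← MeasureTheory.integral_zero (Fin m → ℝ) ℝ (μ := MeasureTheory.volume.restrict Q)]
    refine MeasureTheory.setIntegral_congr_fun hQc.measurableSet fun x hx => ?_
    have : fderiv ℝ F x = ContinuousLinearMap.id ℝ (Fin m → ℝ) + fderiv ℝ u x := by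
      have h := (hF.differentiable (by norm_num) x).hasFDerivAt.sub (hasFDerivAt_id x)
      have h' : fderiv ℝ u x = fderiv ℝ F x - ContinuousLinearMap.id ℝ (Fin m → ℝ) := h.fderiv
      rw [h']; abel
    rw [← hcon x hx, this]
  rw [hfin] at hz
  exact one_ne_zero hz

/-- A Lebesgue-type theorem: a continuous map from the `(n+1)`-dimensional cube to `ℝⁿ` identifies two
points on opposite faces. -/
lemma exists_opposite_fiber (n : ℕ) (p : Icc (0 : Fin (n + 1) → ℝ) 1 → (Fin n → ℝ))
    (hp : Continuous p) :
    ∃ x y : Icc (0 : Fin (n + 1) → ℝ) 1, ∃ i, x.1 i = 0 ∧ y.1 i = 1 ∧ p x = p y := by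
  by_contra! hcon
  -- extension to the whole space
  let cl : (Fin (n + 1) → ℝ) → Icc (0 : Fin (n + 1) → ℝ) 1 := fun z =>
    ⟨fun i => (projIcc (0 : ℝ) 1 zero_le_one (z i) : ℝ),
      fun i => (projIcc (0 : ℝ) 1 zero_le_one (z i)).2.1,
      fun i => (projIcc (0 : ℝ) 1 zero_le_one (z i)).2.2⟩
  have hcl : UniformContinuous cl := by
    refine UniformContinuous.subtype_mk ?_ _
    rw [uniformContinuous_pi]
    intro i
    exact uniformContinuous_subtype_val.comp
      ((LipschitzWith.projIcc zero_le_one).uniformContinuous.comp (Pi.uniformContinuous_proj _ i))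
  have hcl_id : ∀ x : Icc (0 : Fin (n + 1) → ℝ) 1, cl x.1 = x := by
    intro x
    ext i
    have : x.1 i ∈ Icc (0 : ℝ) 1 := ⟨x.2.1 i, x.2.2 i⟩
    simp [cl, projIcc_of_mem zero_le_one this]
  have hpu : UniformContinuous (p ∘ cl) :=
    (CompactSpace.uniformContinuous_of_continuous hp).comp hcl
  -- separation
  obtain ⟨η, hη, hsep⟩ : ∃ η > 0, ∀ i, ∀ x y : Icc (0 : Fin (n + 1) → ℝ) 1,
      x.1 i = 0 → y.1 i = 1 → η ≤ dist (p x) (p y) := by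
    have h : ∀ i : Fin (n + 1), ∃ η > 0, ∀ x y : Icc (0 : Fin (n + 1) → ℝ) 1,
        x.1 i = 0 → y.1 i = 1 → η ≤ dist (p x) (p y) := by
      intro i
      let S : Set (Icc (0 : Fin (n + 1) → ℝ) 1 × Icc (0 : Fin (n + 1) → ℝ) 1) :=
        {z | z.1.1 i = 0 ∧ z.2.1 i = 1}
      have hS : IsCompact S := by
        apply IsClosed.isCompact
        refine IsClosed.inter (isClosed_eq ?_ continuous_const) (isClosed_eq ?_ continuous_const)
        · exact (continuous_apply i).comp (continuous_subtype_val.comp continuous_fst)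
        · exact (continuous_apply i).comp (continuous_subtype_val.comp continuous_snd)
      have hne : S.Nonempty := ⟨(⟨0, by simp⟩, ⟨1, by simp⟩), by simp [S]⟩
      obtain ⟨z, hz, hmin⟩ := hS.exists_isMinOn hne
        (f := fun z => dist (p z.1) (p z.2))
        ((hp.comp continuous_fst).dist (hp.comp continuous_snd)).continuousOn
      refine ⟨dist (p z.1) (p z.2), dist_pos.2 (hcon z.1 z.2 i hz.1 hz.2), fun x y hx hy => ?_⟩
      exact hmin (show (x, y) ∈ S from ⟨hx, hy⟩)
    choose η hη hs using h
    refine ⟨Finset.univ.inf' Finset.univ_nonempty η, ?_, fun i x y hx hy => ?_⟩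
    · simpa [Finset.lt_inf'_iff] using hη
    · exact (Finset.inf'_le _ (Finset.mem_univ i)).trans (hs i x y hx hy)
  obtain ⟨g, hg, hgd⟩ := hpu.exists_contDiff_dist_le (ε := η / 2) (by positivity)
  have hgd' : ∀ x : Icc (0 : Fin (n + 1) → ℝ) 1, dist (g x.1) (p x) < η / 2 := by
    intro x
    simpa [hcl_id] using hgd x.1
  -- Urysohn functions
  have hur : ∀ i : Fin (n + 1), ∃ φ : (Fin n → ℝ) → ℝ, ContDiff ℝ ∞ φ ∧
      (∀ x ∈ Icc (0 : Fin (n + 1) → ℝ) 1, x i = 0 → φ (g x) = 0) ∧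
      (∀ x ∈ Icc (0 : Fin (n + 1) → ℝ) 1, x i = 1 → φ (g x) = 1) := by
    intro i
    have hcl : ∀ c : ℝ, IsClosed (g '' (Icc (0 : Fin (n + 1) → ℝ) 1 ∩ {x | x i = c})) := by
      intro c
      exact ((isCompact_Icc.inter_right
        (isClosed_eq (continuous_apply i) continuous_const)).image hg.continuous).isClosed
    obtain ⟨φ, h0, h1, -⟩ := exists_contMDiffMap_zero_one_of_isClosed (n := (⊤ : ℕ∞))
      (modelWithCornersSelf ℝ (Fin n → ℝ)) (hcl 0) (hcl 1) (by
        rw [Set.disjoint_left]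
        rintro _ ⟨x, ⟨hx, hxi⟩, rfl⟩ ⟨y, ⟨hy, hyi⟩, hxy⟩
        have h1 := hsep i ⟨x, hx⟩ ⟨y, hy⟩ hxi hyi
        have h2 := hgd' ⟨x, hx⟩
        have h3 := hgd' ⟨y, hy⟩
        have h4 := dist_triangle_left (p ⟨x, hx⟩) (p ⟨y, hy⟩) (g x)
        simp only at h2 h3
        rw [hxy] at h3
        linarith)
    refine ⟨φ, φ.contMDiff.contDiff, fun x hx hxi => h0 ⟨x, ⟨hx, hxi⟩, rfl⟩,
      fun x hx hxi => h1 ⟨x, ⟨hx, hxi⟩, rfl⟩⟩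
  choose φ hφ hφ0 hφ1 using hur
  let Φ : (Fin n → ℝ) → (Fin (n + 1) → ℝ) := fun y i => φ i y
  have hΦ : ContDiff ℝ ∞ Φ := contDiff_pi.2 hφ
  obtain ⟨x, -, hx⟩ := exists_det_ne_zero (n + 1) (Φ ∘ g) ((hΦ.comp hg).of_le (by simp))
    (fun x hx i hi => hφ0 i x hx hi) (fun x hx i hi => hφ1 i x hx hi)
  apply hx
  rw [fderiv_comp x (hΦ.differentiable (by simp) _) (hg.differentiable (by simp) _)]
  by_contra hdet
  have hinj : Function.Injective ((fderiv ℝ Φ (g x)).comp (fderiv ℝ g x)) := by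
    have := LinearEquiv.injective (LinearMap.equivOfDetNeZero _ hdet)
    exact this
  have hinj2 : Function.Injective (fderiv ℝ g x : (Fin (n + 1) → ℝ) →ₗ[ℝ] (Fin n → ℝ)) :=
    Function.Injective.of_comp (f := fderiv ℝ Φ (g x)) (by exact hinj)
  have := LinearMap.finrank_le_finrank_of_injective hinj2
  simp at this

/-- Lower bound for the Kolmogorov width of a set containing a cube of disjoint bumps. -/
lemma kolmogorov_lower {K : Type*} [TopologicalSpace K] [CompactSpace K] (n : ℕ) (X : Set C(K, ℝ))
    (R a : ℝ) (hR : ∀ x ∈ X, ‖x‖ ≤ R) (ψ : Fin (n + 1) → C(K, ℝ)) (z : Fin (n + 1) → K)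
    (hψ : ∀ i j, ψ i (z j) = if i = j then a else 0)
    (hX : ∀ ε : Fin (n + 1) → ℝ, (∀ i, |ε i| ≤ 1) → ∑ i, ε i • ψ i ∈ X) :
    a ≤ kolmogorovWidth n X := by
  unfold kolmogorovWidth
  refine le_csInf ⟨_, ⊥, inferInstance, by simp, rfl⟩ ?_
  rintro d ⟨L, hfd, hL, rfl⟩
  -- evaluation on the nodes
  let ev : L →ₗ[ℝ] (Fin (n + 1) → ℝ) :=
    { toFun := fun u j => (u : C(K, ℝ)) (z j)
      map_add' := fun _ _ => rfl
      map_smul' := fun _ _ => rfl }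
  have hlt : LinearMap.range ev < ⊤ := by
    apply Submodule.lt_top_of_finrank_lt_finrank
    have := LinearMap.finrank_range_le ev
    simp; omega
  obtain ⟨l, hl0, hl⟩ := Submodule.exists_le_ker_of_lt_top _ hlt
  -- coordinates of the functional
  set lam : Fin (n + 1) → ℝ := fun i => l (Pi.single i 1) with hlam
  have hlv : ∀ v, l v = ∑ i, v i * lam i := by
    intro v
    conv_lhs => rw [LinearMap.pi_apply_eq_sum_univ l v]
    refine Finset.sum_congr rfl fun i _ => ?_
    rw [smul_eq_mul, hlam]
    congr 2
    ext j
    simp [Pi.single_apply, eq_comm]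
  have hpos : 0 < ∑ i, |lam i| := by
    refine lt_of_le_of_ne (Finset.sum_nonneg fun i _ => abs_nonneg _) fun h => hl0 ?_
    have h2 := (Finset.sum_eq_zero_iff_of_nonneg (fun i _ => abs_nonneg (lam i))).1 h.symm
    refine LinearMap.ext fun v => ?_
    rw [hlv, LinearMap.zero_apply]
    refine Finset.sum_eq_zero fun i hi => ?_
    rw [abs_eq_zero.1 (h2 i hi), mul_zero]
  let ε : Fin (n + 1) → ℝ := fun i => SignType.sign (lam i)
  have hε : ∀ i, |ε i| ≤ 1 := by
    intro i
    simp only [ε]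
    rcases lt_trichotomy (lam i) 0 with h | h | h <;> simp [h]
  set x : C(K, ℝ) := ∑ i, ε i • ψ i with hx
  have hxz : ∀ j, x (z j) = ε j * a := by
    intro j
    simp [hx, hψ]
  have hxX : x ∈ X := hX ε hε
  have hbdd : BddAbove (range fun x : X => ⨅ u : L, ‖(x : C(K, ℝ)) - (u : C(K, ℝ))‖) := by
    refine ⟨R, ?_⟩
    rintro _ ⟨y, rfl⟩
    refine (ciInf_le ⟨0, ?_⟩ (0 : L)).trans ?_
    · rintro _ ⟨u, rfl⟩; exact norm_nonneg _
    · simpa using hR y y.2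
  refine le_trans ?_ (le_ciSup hbdd ⟨x, hxX⟩)
  refine le_ciInf fun u => ?_
  have hu0 : l (ev u) = 0 := hl ⟨u, rfl⟩
  rw [hlv] at hu0
  have h1 : ∑ i, (x (z i) - (u : C(K, ℝ)) (z i)) * lam i = a * ∑ i, |lam i| := by
    simp only [sub_mul, Finset.sum_sub_distrib]
    have : ∑ i, (u : C(K, ℝ)) (z i) * lam i = 0 := hu0
    rw [this, sub_zero, Finset.mul_sum]
    refine Finset.sum_congr rfl fun i _ => ?_
    rw [hxz, mul_right_comm, mul_comm]
    congr 1
    simp [ε, sign_mul_self]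
  have h2 : ∑ i, (x (z i) - (u : C(K, ℝ)) (z i)) * lam i
      ≤ ‖x - (u : C(K, ℝ))‖ * ∑ i, |lam i| := by
    rw [Finset.mul_sum]
    refine Finset.sum_le_sum fun i _ => (le_abs_self _).trans ?_
    rw [abs_mul]
    gcongr
    exact (x - (u : C(K, ℝ))).norm_coe_le_norm (z i)
  rw [h1] at h2
  exact le_of_mul_le_mul_right h2 hpos

/-- Lower bound for the Babenko width of a set containing a cube of disjoint bumps. -/
lemma babenko_lower {K : Type*} [TopologicalSpace K] [CompactSpace K] (n : ℕ) (X : Set C(K, ℝ))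
    (R a : ℝ) (ha : 0 ≤ a) (hR : ∀ x ∈ X, ‖x‖ ≤ R) (ψ : Fin (n + 1) → C(K, ℝ)) (z : Fin (n + 1) → K)
    (hψ : ∀ i j, ψ i (z j) = if i = j then a else 0)
    (hX : ∀ ε : Fin (n + 1) → ℝ, (∀ i, |ε i| ≤ 1) → ∑ i, ε i • ψ i ∈ X) :
    a ≤ babenkoWidth n X := by
  unfold babenkoWidth
  refine le_csInf ⟨_, fun _ => 0, continuous_const, rfl⟩ ?_
  rintro d ⟨p, hp, rfl⟩
  let Ψ : Icc (0 : Fin (n + 1) → ℝ) 1 → X := fun e => ⟨∑ i, e.1 i • ψ i, hX _ fun i => by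
    rw [abs_of_nonneg (e.2.1 i)]; exact e.2.2 i⟩
  have hΨ : Continuous Ψ := by
    refine Continuous.subtype_mk ?_ _
    refine continuous_finsetSum _ fun i _ => ?_
    exact ((continuous_apply i).comp continuous_subtype_val).smul continuous_const
  obtain ⟨x, y, i, hx, hy, hxy⟩ := exists_opposite_fiber n (p ∘ Ψ) (hp.comp hΨ)
  have hXb : Bornology.IsBounded X := isBounded_iff_forall_norm_le.2 ⟨R, hR⟩
  have hsub : ∀ x : X, Subtype.val '' (p ⁻¹' {p x}) ⊆ X := by
    rintro x _ ⟨w, -, rfl⟩; exact w.2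
  have hbdd : BddAbove (range fun x : X => Metric.diam (Subtype.val '' (p ⁻¹' {p x}))) := by
    refine ⟨Metric.diam X, ?_⟩
    rintro _ ⟨x, rfl⟩
    exact Metric.diam_mono (hsub x) hXb
  refine le_trans ?_ (le_ciSup hbdd (Ψ x))
  have h1 : dist (Ψ y : C(K, ℝ)) (Ψ x) ≤ Metric.diam (Subtype.val '' (p ⁻¹' {p (Ψ x)})) := by
    refine Metric.dist_le_diam_of_mem (hXb.subset (hsub _)) ⟨Ψ y, ?_, rfl⟩ ⟨Ψ x, rfl, rfl⟩
    exact hxy.symm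
  refine le_trans ?_ h1
  have h2 := ContinuousMap.dist_apply_le_dist (f := (Ψ y : C(K, ℝ))) (g := (Ψ x : C(K, ℝ))) (z i)
  have h3 : ∀ e, (Ψ e : C(K, ℝ)) (z i) = e.1 i * a := by
    intro e
    simp [Ψ, hψ]
  rw [h3, h3, hx, hy, Real.dist_eq] at h2
  simpa [abs_of_nonneg ha] using h2

/-- Uniform bound for the derivatives of a fixed bump function. -/
lemma exists_bump (s : ℕ) : ∃ b : ℝ → ℝ, ContDiff ℝ ∞ b ∧ b 0 = 1 ∧
    (∀ k x, 1 / 3 < |x| → iteratedDeriv k b x = 0) ∧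
    ∃ B : ℝ, 0 < B ∧ ∀ k ≤ s, ∀ x, |iteratedDeriv k b x| ≤ B := by
  let b : ContDiffBump (0 : ℝ) := ⟨1 / 4, 1 / 3, by norm_num, by norm_num⟩
  have hb : ContDiff ℝ ∞ b := b.contDiff
  have hzero : ∀ k x, 1 / 3 < |x| → iteratedDeriv k b x = 0 := by
    intro k x hx
    by_contra h
    have h1 : iteratedFDeriv ℝ k b x ≠ 0 := by
      intro h2
      apply h
      rw [iteratedDeriv_eq_iteratedFDeriv, h2]; simp
    have h3 := support_iteratedFDeriv_subset (𝕜 := ℝ) (f := b) k (Function.mem_support.2 h1)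
    rw [b.tsupport_eq] at h3
    simp [b] at h3
    linarith
  have hbd : ∀ k, ∃ B : ℝ, ∀ x, |iteratedDeriv k b x| ≤ B := by
    intro k
    have hc : Continuous (iteratedDeriv k b) := hb.continuous_iteratedDeriv k (by exact_mod_cast le_top)
    obtain ⟨B, hB⟩ := (isCompact_Icc (a := (-1 : ℝ)) (b := 1)).exists_bound_of_continuousOn
      hc.continuousOn
    refine ⟨max B 0, fun x => ?_⟩
    by_cases hx : |x| ≤ 1
    · exact (hB x (abs_le.1 hx)).trans (le_max_left _ _)
    · rw [hzero k x (by linarith [not_le.1 hx]), abs_zero]; exact le_max_right _ _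
  choose B hB using hbd
  refine ⟨b, hb, ?_, hzero, 1 + ∑ k ∈ Finset.range (s + 1), |B k|, by positivity, ?_⟩
  · exact b.one_of_mem_closedBall (by simp [b])
  · intro k hk x
    have h1 : |B k| ≤ ∑ k ∈ Finset.range (s + 1), |B k| :=
      Finset.single_le_sum (f := fun k => |B k|) (fun i _ => abs_nonneg _)
        (Finset.mem_range.2 (by omega))
    linarith [hB k x, le_abs_self (B k)]

/-- The class contains cubes of disjoint bumps of height of order `n^{-s}`. -/
lemma exists_cube (T M : ℝ) (hT : 0 < T) (hM : 0 < M) (r s : ℕ) (ζ : ℝ) (hζ0 : 0 ≤ ζ) (hζ1 : ζ ≤ 1)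
    (hrs : r ≤ s) (X : Set C(Set.Icc (0:ℝ) T, ℝ))
    (hX : X = { g : C(Set.Icc (0:ℝ) T, ℝ) |
      ∃ f : ℝ → ℝ, MemQStar T M r s ζ f ∧ ∀ t : Set.Icc (0:ℝ) T, g t = f t }) :
    ∃ c : ℝ, 0 < c ∧ ∀ n : ℕ, ∃ (ψ : Fin (n + 1) → C(Set.Icc (0:ℝ) T, ℝ))
      (z : Fin (n + 1) → Set.Icc (0:ℝ) T),
      (∀ i j, ψ i (z j) = if i = j then c / ((n : ℝ) + 1) ^ s else 0) ∧
      ∀ ε : Fin (n + 1) → ℝ, (∀ i, |ε i| ≤ 1) → ∑ i, ε i • ψ i ∈ X := by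
  obtain ⟨b, hb, hb0, hbz, B, hB0, hB⟩ := exists_bump s
  set W : ℝ := max 1 T with hW
  have hW1 : 1 ≤ W := le_max_left _ _
  have hWT : T ≤ W := le_max_right _ _
  have hW0 : 0 < W := by linarith
  set A : ℝ := M / (B * W ^ s * W ^ s) with hA
  have hA0 : 0 < A := by positivity
  refine ⟨A * T ^ s, by positivity, fun n => ?_⟩
  have hn : (0 : ℝ) < (n : ℝ) + 1 := by positivity
  set h : ℝ := T / ((n : ℝ) + 1) with hh
  have hh0 : 0 < h := by positivity
  have hhT : h ≤ T := div_le_self hT.le (by simp)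
  let q : Fin (n + 1) → ℝ → ℝ := fun i t => t / h - ((i : ℝ) + 1 / 2)
  have hsep : ∀ (i j : Fin (n + 1)) (t : ℝ), |q i t| ≤ 1 / 3 → |q j t| ≤ 1 / 3 → i = j := by
    intro i j t hi hj
    rw [abs_le] at hi hj
    simp only [q] at hi hj
    have h1 : ((i : ℕ) : ℝ) < (j : ℕ) + 1 := by linarith
    have h2 : ((j : ℕ) : ℝ) < (i : ℕ) + 1 := by linarith
    have h1' : (i : ℕ) < j + 1 := by exact_mod_cast h1
    have h2' : (j : ℕ) < i + 1 := by exact_mod_cast h2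
    exact Fin.ext (by omega)
  have hqz : ∀ i j : Fin (n + 1), q i (((j : ℝ) + 1 / 2) * h) = (j : ℝ) - i := by
    intro i j
    simp only [q]
    field_simp
    ring
  let ψ : Fin (n + 1) → C(Set.Icc (0:ℝ) T, ℝ) := fun i =>
    ⟨fun t => A * h ^ s * b (q i t), by
      have := hb.continuous
      simp only [q]
      fun_prop⟩
  let z : Fin (n + 1) → Set.Icc (0:ℝ) T := fun j => ⟨((j : ℝ) + 1 / 2) * h, by
    constructor
    · positivity
    · have : ((j : ℕ) : ℝ) + 1 ≤ (n : ℝ) + 1 := by exact_mod_cast j.2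
      rw [hh, mul_div_assoc', div_le_iff₀ hn]
      nlinarith⟩
  refine ⟨ψ, z, ?_, ?_⟩
  · intro i j
    show A * h ^ s * b (q i (((j : ℝ) + 1 / 2) * h)) = _
    rw [hqz]
    split_ifs with hij
    · subst hij
      rw [sub_self, hb0, hh, div_pow]
      ring
    · have : b ((j : ℝ) - i) = 0 := by
        have h1 := hbz 0 ((j : ℝ) - i) (by
          have h2 : (1 : ℤ) ≤ |((j : ℕ) : ℤ) - (i : ℕ)| := by
            apply Int.one_le_abs
            intro h3
            apply hij
            apply Fin.ext
            omega
          have h4 : (1 : ℝ) ≤ |((j : ℕ) : ℝ) - (i : ℕ)| := by exact_mod_cast h2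
          linarith)
        simpa using h1
      rw [this, mul_zero]
  · intro ε hε
    rw [hX]
    let g : ℕ → ℝ → ℝ := fun k t => A * h ^ s * (h⁻¹) ^ k * ∑ i, ε i * iteratedDeriv k b (q i t)
    have hiter : ∀ k, iteratedDeriv k (g 0) = g k := by
      intro k
      induction k with
      | zero => simp
      | succ k ih =>
        rw [iteratedDeriv_succ, ih]
        funext t
        apply HasDerivAt.deriv
        have hd : ∀ i : Fin (n + 1), HasDerivAt (fun t => ε i * iteratedDeriv k b (q i t))
            (ε i * (iteratedDeriv (k + 1) b (q i t) * h⁻¹)) t := by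
          intro i
          refine HasDerivAt.const_mul _ ?_
          have h1 : HasDerivAt (iteratedDeriv k b) (iteratedDeriv (k + 1) b (q i t)) (q i t) := by
            rw [iteratedDeriv_succ]
            exact ((hb.differentiable_iteratedDeriv k (by exact_mod_cast WithTop.coe_lt_top k)) _).hasDerivAt
          have h2 : HasDerivAt (q i) (h⁻¹) t := by
            simp only [q]
            simpa using ((hasDerivAt_id t).div_const h).sub_const ((i : ℝ) + 1 / 2)
          exact h1.comp t h2
        have h3 := (HasDerivAt.fun_sum (u := Finset.univ) fun i _ => hd i).const_mul
          (A * h ^ s * (h⁻¹) ^ k)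
        refine h3.congr_deriv ?_
        simp only [g, Finset.mul_sum]
        refine Finset.sum_congr rfl fun i _ => ?_
        ring
    have hgs : ContDiff ℝ ∞ (g 0) := by
      simp only [g, q, iteratedDeriv_zero]
      refine contDiff_const.mul (ContDiff.sum fun i _ => contDiff_const.mul (hb.comp ?_))
      exact (contDiff_id.div_const h).sub contDiff_const
    have hsum : ∀ k ≤ s, ∀ t, |∑ i, ε i * iteratedDeriv k b (q i t)| ≤ B := by
      intro k hk t
      by_cases hex : ∃ i, |q i t| ≤ 1 / 3
      · obtain ⟨i, hi⟩ := hex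
        rw [Finset.sum_eq_single i]
        · rw [abs_mul]
          calc |ε i| * |iteratedDeriv k b (q i t)| ≤ 1 * B := by
                gcongr
                · exact hε i
                · exact hB k hk _
            _ = B := one_mul B
        · intro j _ hj
          rw [hbz k _ (not_le.1 fun hle => hj (hsep _ _ t hle hi)), mul_zero]
        · simp
      · push Not at hex
        rw [Finset.sum_eq_zero fun i _ => by rw [hbz k _ (hex i), mul_zero]]
        simpa using hB0.le
    have hbound : ∀ k ≤ s, ∀ t, |g k t| ≤ M / W ^ s := by
      intro k hk t
      simp only [g]
      rw [abs_mul, abs_of_pos (by positivity)]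
      have h1 : h ^ s * (h⁻¹) ^ k ≤ W ^ s := by
        have : h ^ s * (h⁻¹) ^ k = h ^ (s - k) := by
          rw [inv_pow, pow_sub₀ _ hh0.ne' hk]
        rw [this]
        calc h ^ (s - k) ≤ W ^ (s - k) := by gcongr; linarith
          _ ≤ W ^ s := pow_le_pow_right₀ hW1 (by omega)
      calc A * h ^ s * (h⁻¹) ^ k * |∑ i, ε i * iteratedDeriv k b (q i t)|
          = A * (h ^ s * (h⁻¹) ^ k) * |∑ i, ε i * iteratedDeriv k b (q i t)| := by ring
        _ ≤ A * W ^ s * B := by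
            gcongr
            exact hsum k hk t
        _ = M / W ^ s := by rw [hA]; field_simp
    refine ⟨g 0, ⟨?_, ?_, ?_, ?_⟩, ?_⟩
    · exact (hgs.of_le (by exact_mod_cast le_top)).contDiffOn
    · exact (hgs.of_le (by exact_mod_cast le_top)).contDiffOn
    · intro k hk t ht
      rw [iteratedDerivWithin_eq_iteratedDeriv (uniqueDiffOn_Icc hT)
        (hgs.of_le (by exact_mod_cast le_top)).contDiffAt ht, hiter]
      exact (hbound k (hk.trans hrs) t).trans (div_le_self hM.le (one_le_pow₀ hW1))
    · intro k hk hks t ht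
      rw [iteratedDerivWithin_eq_iteratedDeriv (uniqueDiffOn_Ioc 0 T)
        (hgs.of_le (by exact_mod_cast le_top)).contDiffAt ht, hiter]
      refine (hbound k hks t).trans ?_
      rw [div_eq_mul_inv]
      gcongr
      have hkr : (r : ℝ) + 1 ≤ k := by exact_mod_cast hk
      have hks' : (k : ℝ) ≤ s := by exact_mod_cast hks
      have hr0 : (0 : ℝ) ≤ r := by positivity
      calc (W ^ s)⁻¹ = W ^ (-(s : ℝ)) := by rw [Real.rpow_neg hW0.le, Real.rpow_natCast]
        _ ≤ W ^ (-((k : ℝ) - r - ζ)) := Real.rpow_le_rpow_of_exponent_le hW1 (by linarith)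
        _ ≤ t ^ (-((k : ℝ) - r - ζ)) :=
            Real.rpow_le_rpow_of_nonpos ht.1 (ht.2.trans hWT) (by linarith)
    · intro t
      simp only [ContinuousMap.coe_sum, ContinuousMap.coe_smul, Finset.sum_apply, Pi.smul_apply,
        smul_eq_mul, g, pow_zero, mul_one, iteratedDeriv_zero, Finset.mul_sum]
      refine Finset.sum_congr rfl fun i _ => ?_
      show ε i * (A * h ^ s * b (q i t)) = _
      ring

/-- Equidistant nodes in `[a, b]`. -/
noncomputable def eqNode (s : ℕ) (a b : ℝ) (j : ℕ) : ℝ := a + (b - a) * (j / ((s : ℝ) - 1))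

lemma eqNode_zero (s : ℕ) (a b : ℝ) : eqNode s a b 0 = a := by simp [eqNode]

lemma eqNode_last (s : ℕ) (hs : 2 ≤ s) (a b : ℝ) : eqNode s a b (s - 1) = b := by
  have h : (2 : ℝ) ≤ s := by exact_mod_cast hs
  have h1 : ((s - 1 : ℕ) : ℝ) = (s : ℝ) - 1 := by
    rw [Nat.cast_sub (by omega)]; simp
  rw [eqNode, h1, div_self (by linarith)]
  ring

lemma eqNode_mem (s : ℕ) (hs : 2 ≤ s) (a b : ℝ) (hab : a ≤ b) (j : ℕ) (hj : j < s) :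
    eqNode s a b j ∈ Icc a b := by
  have h : (2 : ℝ) ≤ s := by exact_mod_cast hs
  have hj' : (j : ℝ) + 1 ≤ s := by exact_mod_cast hj
  have h0 : 0 ≤ (j : ℝ) / ((s : ℝ) - 1) := div_nonneg (by positivity) (by linarith)
  have h1 : (j : ℝ) / ((s : ℝ) - 1) ≤ 1 := by rw [div_le_one (by linarith)]; linarith
  constructor <;> rw [eqNode] <;> nlinarith

lemma eqNode_injective (s : ℕ) (hs : 2 ≤ s) (a b : ℝ) (hab : a < b) :
    Function.Injective (eqNode s a b) := by
  intro i j hij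
  have h : (2 : ℝ) ≤ s := by exact_mod_cast hs
  have h1 : (s : ℝ) - 1 ≠ 0 := by linarith
  have h2 : b - a ≠ 0 := by linarith
  simp only [eqNode, add_right_inj] at hij
  have h3 := mul_left_cancel₀ h2 hij
  rw [div_left_inj' h1] at h3
  exact_mod_cast h3

/-- Stability of Lagrange interpolation at equidistant nodes. -/
lemma interp_error (s : ℕ) (hs : 2 ≤ s) (a b : ℝ) (hab : a < b) (f : ℝ → ℝ) (Q : Polynomial ℝ)
    (hQ : Q ∈ Polynomial.degreeLT ℝ s) (δ : ℝ)
    (hf : ∀ x ∈ Icc a b, |f x - Q.eval x| ≤ δ) :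
    ∃ P ∈ Polynomial.degreeLT ℝ s, (∀ j < s, P.eval (eqNode s a b j) = f (eqNode s a b j)) ∧
      ∀ x ∈ Icc a b, |f x - P.eval x| ≤ (1 + s * s ^ s) * δ := by
  set v := eqNode s a b with hv
  have hinj : Set.InjOn v (Finset.range s : Finset ℕ) := (eqNode_injective s hs a b hab).injOn
  have hs1 : (2 : ℝ) ≤ s := by exact_mod_cast hs
  have hδ : 0 ≤ δ := (abs_nonneg _).trans (hf a ⟨le_rfl, hab.le⟩)
  refine ⟨Lagrange.interpolate (Finset.range s) v (fun j => f (v j)), ?_, ?_, ?_⟩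
  · rw [Polynomial.mem_degreeLT]
    simpa using Lagrange.degree_interpolate_lt (fun j => f (v j)) hinj
  · intro j hj
    exact Lagrange.eval_interpolate_at_node _ hinj (Finset.mem_range.2 hj)
  · intro x hx
    have hQi : Q = Lagrange.interpolate (Finset.range s) v (fun j => Q.eval (v j)) :=
      Lagrange.eq_interpolate hinj (by simpa using Polynomial.mem_degreeLT.1 hQ)
    have hbasis : ∀ j ∈ Finset.range s, |(Lagrange.basis (Finset.range s) v j).eval x| ≤ (s : ℝ) ^ s := by
      intro j hj
      rw [Lagrange.basis, Polynomial.eval_prod, Finset.abs_prod]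
      have hle : ∀ i ∈ (Finset.range s).erase j,
          |(Lagrange.basisDivisor (v j) (v i)).eval x| ≤ (s : ℝ) := by
        intro i hi
        have hij : i ≠ j := Finset.ne_of_mem_erase hi
        have hi' := Finset.mem_range.1 (Finset.mem_of_mem_erase hi)
        simp only [Lagrange.basisDivisor, Polynomial.eval_mul, Polynomial.eval_C,
          Polynomial.eval_sub, Polynomial.eval_X]
        have hm := eqNode_mem s hs a b hab.le i hi'
        have h1 : |x - v i| ≤ b - a := by
          rw [abs_le]; constructor <;> linarith [hx.1, hx.2, hm.1, hm.2]
        have h2 : (b - a) / s ≤ |v j - v i| := by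
          have h3 : v j - v i = (b - a) * (((j : ℝ) - i) / ((s : ℝ) - 1)) := by
            simp only [hv, eqNode]; ring
          have h4 : (1 : ℝ) ≤ |(j : ℝ) - i| := by
            have : (1 : ℤ) ≤ |(j : ℤ) - i| := by
              apply Int.one_le_abs; omega
            exact_mod_cast this
          rw [h3, abs_mul, abs_div, abs_of_pos (by linarith : 0 < b - a),
            abs_of_pos (by linarith : 0 < (s : ℝ) - 1), div_eq_mul_one_div]
          gcongr
          · linarith
          · linarith
        rw [abs_mul, abs_inv]
        have h5 : 0 < (b - a) / s := div_pos (by linarith) (by linarith)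
        have h6 : |v j - v i|⁻¹ ≤ ((b - a) / s)⁻¹ := by gcongr
        calc |v j - v i|⁻¹ * |x - v i| ≤ ((b - a) / s)⁻¹ * (b - a) := by gcongr
          _ = s := by
            have : b - a ≠ 0 := by linarith
            field_simp
      calc ∏ i ∈ (Finset.range s).erase j, |(Lagrange.basisDivisor (v j) (v i)).eval x|
          ≤ ∏ i ∈ (Finset.range s).erase j, (s : ℝ) :=
            Finset.prod_le_prod (fun _ _ => abs_nonneg _) hle
        _ = (s : ℝ) ^ (s - 1) := by
            rw [Finset.prod_const, Finset.card_erase_of_mem hj, Finset.card_range]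
        _ ≤ (s : ℝ) ^ s := pow_le_pow_right₀ (by linarith) (by omega)
    have hdiff : |Q.eval x - (Lagrange.interpolate (Finset.range s) v (fun j => f (v j))).eval x|
        ≤ s * s ^ s * δ := by
      conv_lhs => rw [hQi]
      rw [Lagrange.interpolate_apply, Lagrange.interpolate_apply, Polynomial.eval_finsetSum,
        Polynomial.eval_finsetSum, ← Finset.sum_sub_distrib]
      refine (Finset.abs_sum_le_sum_abs _ _).trans ?_
      calc _ ≤ ∑ j ∈ Finset.range s, (s : ℝ) ^ s * δ := by
            refine Finset.sum_le_sum fun j hj => ?_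
            simp only [Polynomial.eval_mul, Polynomial.eval_C]
            rw [← sub_mul, abs_mul, mul_comm, abs_sub_comm]
            gcongr
            · exact hbasis j hj
            · exact hf _ (eqNode_mem s hs a b hab.le j (Finset.mem_range.1 hj))
        _ = s * s ^ s * δ := by simp; ring
    have := abs_sub_le (f x) (Q.eval x)
      ((Lagrange.interpolate (Finset.range s) v (fun j => f (v j))).eval x)
    have := hf x hx
    linarith

/-- Taylor approximation by a polynomial. -/
lemma taylor_poly (a b C : ℝ) (hab : a < b) (m : ℕ) (f : ℝ → ℝ)
    (hf : ContDiffOn ℝ (m + 1 : ℕ) f (Icc a b))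
    (hC : ∀ y ∈ Icc a b, |iteratedDerivWithin (m + 1) f (Icc a b) y| ≤ C) :
    ∃ Q ∈ Polynomial.degreeLT ℝ (m + 1), ∀ x ∈ Icc a b, |f x - Q.eval x| ≤ C * (b - a) ^ (m + 1) := by
  have hC0 : 0 ≤ C := (abs_nonneg _).trans (hC a ⟨le_rfl, hab.le⟩)
  refine ⟨∑ k ∈ Finset.range (m + 1), Polynomial.C ((k.factorial : ℝ)⁻¹ *
    iteratedDerivWithin k f (Icc a b) a) * (Polynomial.X - Polynomial.C a) ^ k, ?_, ?_⟩
  · refine Submodule.sum_mem _ fun k hk => ?_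
    rw [Polynomial.C_mul']
    refine Submodule.smul_mem _ _ ?_
    rw [Polynomial.mem_degreeLT, Polynomial.degree_pow, Polynomial.degree_X_sub_C, nsmul_one]
    exact_mod_cast Finset.mem_range.1 hk
  · intro x hx
    have h := taylor_mean_remainder_bound hab.le (n := m) (by exact_mod_cast hf) hx hC
    have he : taylorWithinEval f m (Icc a b) a x = (∑ k ∈ Finset.range (m + 1),
        Polynomial.C ((k.factorial : ℝ)⁻¹ * iteratedDerivWithin k f (Icc a b) a) *
          (Polynomial.X - Polynomial.C a) ^ k).eval x := by
      rw [taylor_within_apply, Polynomial.eval_finsetSum]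
      refine Finset.sum_congr rfl fun k _ => ?_
      simp
      ring
    rw [he, Real.norm_eq_abs] at h
    refine h.trans ?_
    have hx0 : 0 ≤ x - a := by linarith [hx.1]
    calc C * (x - a) ^ (m + 1) / m.factorial ≤ C * (x - a) ^ (m + 1) :=
          div_le_self (by positivity) (by exact_mod_cast Nat.one_le_iff_ne_zero.2 (Nat.factorial_ne_zero m))
      _ ≤ C * (b - a) ^ (m + 1) := by
          gcongr
          exact hx.2

/-- Local polynomial approximation on the graded mesh. -/
lemma mesh_error (T M : ℝ) (hT : 0 < T) (hM : 0 < M) (r s : ℕ) (ζ : ℝ) (hr : 1 ≤ r) (hrs : r < s)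
    (hζ0 : 0 ≤ ζ) (hζ1 : ζ ≤ 1) :
    ∃ E : ℝ, 0 < E ∧ ∀ f : ℝ → ℝ, MemQStar T M r s ζ f → ∀ N k : ℕ, k < N →
      ∃ Q ∈ Polynomial.degreeLT ℝ s, ∀ x ∈ Icc (T * ((k : ℝ) / N) ^ s) (T * (((k : ℝ) + 1) / N) ^ s),
        |f x - Q.eval x| ≤ E / (N : ℝ) ^ s := by
  set β : ℝ := (s : ℝ) - r - ζ with hβ
  have hr' : (1 : ℝ) ≤ r := by exact_mod_cast hr
  have hrs' : (r : ℝ) + 1 ≤ s := by exact_mod_cast hrs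
  have hβ0 : 0 ≤ β := by linarith
  have hβs : β ≤ (s : ℝ) - 1 := by linarith
  set E2 : ℝ := M * T ^ (-β) * (T * (s * 2 ^ (s - 1))) ^ s with hE2
  have hE2p : 0 < E2 := by
    have : (0 : ℝ) < s := by linarith
    positivity
  refine ⟨M * T ^ r + E2, by positivity, fun f hf N k hk => ?_⟩
  obtain ⟨hf1, hf2, hf3, hf4⟩ := hf
  have hN : 0 < N := by omega
  have hN' : (0 : ℝ) < N := by exact_mod_cast hN
  have hN1 : (1 : ℝ) ≤ N := by exact_mod_cast hN
  have hk1 : ((k : ℝ) + 1) / N ≤ 1 := by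
    rw [div_le_one hN']; exact_mod_cast hk
  set a := T * ((k : ℝ) / N) ^ s with ha
  set b := T * (((k : ℝ) + 1) / N) ^ s with hb
  have hs0 : s ≠ 0 := by omega
  have hab : a < b := by
    rw [ha, hb]
    gcongr
    linarith
  have hbT : b ≤ T := by
    rw [hb]
    exact mul_le_of_le_one_right hT.le (pow_le_one₀ (by positivity) hk1)
  rcases Nat.eq_zero_or_pos k with hk0 | hkpos
  · -- first interval
    have ha0 : a = 0 := by rw [ha, hk0]; simp [hs0]
    obtain ⟨m, rfl⟩ : ∃ m, r = m + 1 := ⟨r - 1, by omega⟩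
    have hsub : Icc a b ⊆ Icc 0 T := Icc_subset_Icc ha0.ge hbT
    obtain ⟨Q, hQ, hQe⟩ := taylor_poly a b M hab m f (hf1.mono hsub) (by
      intro y hy
      have := iteratedFDerivWithin_subset (𝕜 := ℝ) hsub (uniqueDiffOn_Icc hab) (uniqueDiffOn_Icc hT)
        hf1 hy
      rw [iteratedDerivWithin, this]
      exact hf3 (m + 1) le_rfl y (hsub hy))
    refine ⟨Q, Polynomial.degreeLT_mono (by omega) hQ, fun x hx => (hQe x hx).trans ?_⟩
    have hb' : b - a = T * (1 / N) ^ s := by rw [ha0, hb, hk0]; simp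
    rw [hb', mul_pow]
    have h1 : (((1 : ℝ) / N) ^ s) ^ (m + 1) ≤ (1 / N) ^ s := by
      apply pow_le_of_le_one (by positivity) _ (by omega)
      exact pow_le_one₀ (by positivity) (by rw [div_le_one hN']; exact hN1)
    calc M * (T ^ (m + 1) * (((1 : ℝ) / N) ^ s) ^ (m + 1)) ≤ M * (T ^ (m + 1) * (1 / N) ^ s) := by
          gcongr
      _ = M * T ^ (m + 1) / N ^ s := by rw [div_pow, one_pow]; ring
      _ ≤ (M * T ^ (m + 1) + E2) / N ^ s := by gcongr; linarith
  · have hkp : (1 : ℝ) ≤ k := by exact_mod_cast hkpos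
    have hkp0 : (0 : ℝ) < k := by linarith
    have ha0 : 0 < a := by positivity
    have hsub : Icc a b ⊆ Ioc 0 T := fun y hy => ⟨ha0.trans_le hy.1, hy.2.trans hbT⟩
    have hsm : s - 1 + 1 = s := by omega
    obtain ⟨Q, hQ, hQe⟩ := taylor_poly a b (M * a ^ (-β)) hab (s - 1) f
      (by rw [hsm]; exact hf2.mono hsub) (by
      rw [hsm]
      intro y hy
      have := iteratedFDerivWithin_subset (𝕜 := ℝ) hsub (uniqueDiffOn_Icc hab) (uniqueDiffOn_Ioc 0 T)
        hf2 hy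
      rw [iteratedDerivWithin, this]
      refine (hf4 s hrs le_rfl y (hsub hy)).trans ?_
      gcongr ?_ * ?_
      exact Real.rpow_le_rpow_of_nonpos ha0 hy.1 (by linarith))
    rw [hsm] at hQ hQe
    refine ⟨Q, hQ, fun x hx => (hQe x hx).trans ?_⟩
    -- length of the interval
    have hlen : b - a ≤ T * (s * 2 ^ (s - 1)) * ((k : ℝ) ^ (s - 1) / N ^ s) := by
      have h1 : ((k : ℝ) + 1) ^ s - (k : ℝ) ^ s ≤ s * ((k : ℝ) + 1) ^ (s - 1) := by
        have h2 := (Commute.all ((k : ℝ) + 1) (k : ℝ)).geom_sum₂_mul s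
        rw [← h2]
        have : ∑ i ∈ Finset.range s, ((k : ℝ) + 1) ^ i * (k : ℝ) ^ (s - 1 - i)
            ≤ ∑ i ∈ Finset.range s, ((k : ℝ) + 1) ^ (s - 1) := by
          refine Finset.sum_le_sum fun i hi => ?_
          have hi' := Finset.mem_range.1 hi
          calc ((k : ℝ) + 1) ^ i * (k : ℝ) ^ (s - 1 - i)
              ≤ ((k : ℝ) + 1) ^ i * ((k : ℝ) + 1) ^ (s - 1 - i) := by gcongr; linarith
            _ = ((k : ℝ) + 1) ^ (s - 1) := by rw [← pow_add]; congr 1; omega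
        simp at this
        linarith
      have h3 : ((k : ℝ) + 1) ^ (s - 1) ≤ 2 ^ (s - 1) * (k : ℝ) ^ (s - 1) := by
        rw [← mul_pow]; gcongr; linarith
      have h4 : b - a = T * ((((k : ℝ) + 1) ^ s - (k : ℝ) ^ s) / N ^ s) := by
        rw [ha, hb, div_pow, div_pow]; ring
      rw [h4]
      calc T * ((((k : ℝ) + 1) ^ s - (k : ℝ) ^ s) / N ^ s)
          ≤ T * ((s * (2 ^ (s - 1) * (k : ℝ) ^ (s - 1))) / N ^ s) := by
            gcongr
            exact h1.trans (by gcongr)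
        _ = _ := by ring
    have hapow : a ^ (-β) ≤ T ^ (-β) * ((N : ℝ) ^ s / (k : ℝ) ^ s) ^ (s - 1) := by
      have hq : 0 < (k : ℝ) / N := by positivity
      have hq1 : (k : ℝ) / N ≤ 1 := by
        rw [div_le_one hN']; exact_mod_cast hk.le
      rw [ha, Real.mul_rpow hT.le (by positivity)]
      gcongr
      have h5 : (((k : ℝ) / N) ^ s) ^ (-β) ≤ (((k : ℝ) / N) ^ s) ^ (-((s - 1 : ℕ) : ℝ)) := by
        apply Real.rpow_le_rpow_of_exponent_ge (by positivity) (pow_le_one₀ hq.le hq1)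
        rw [Nat.cast_sub (by omega)]; simp; linarith
      refine h5.trans (le_of_eq ?_)
      rw [Real.rpow_neg (by positivity), Real.rpow_natCast, ← inv_pow, div_pow, inv_div]
    have hba : 0 ≤ b - a := by linarith
    calc M * a ^ (-β) * (b - a) ^ s
        ≤ M * (T ^ (-β) * ((N : ℝ) ^ s / (k : ℝ) ^ s) ^ (s - 1)) *
          (T * (s * 2 ^ (s - 1)) * ((k : ℝ) ^ (s - 1) / N ^ s)) ^ s := by gcongr
      _ = E2 * (((N : ℝ) ^ s / (k : ℝ) ^ s) ^ (s - 1) * ((k : ℝ) ^ (s - 1) / N ^ s) ^ s) := by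
          rw [hE2, mul_pow _ ((k : ℝ) ^ (s - 1) / N ^ s) s]; ring
      _ = E2 / N ^ s := by
          have h6 : ((N : ℝ) ^ s) ^ s = ((N : ℝ) ^ s) ^ (s - 1) * (N : ℝ) ^ s := by
            rw [← pow_succ, hsm]
          have h7 : ((k : ℝ) ^ (s - 1)) ^ s = ((k : ℝ) ^ s) ^ (s - 1) := by
            rw [← pow_mul, ← pow_mul, mul_comm]
          rw [div_pow, div_pow, h6, h7]
          field_simp
      _ ≤ (M * T ^ r + E2) / N ^ s := by
          gcongr
          have : 0 < M * T ^ r := by positivity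
          linarith

lemma mesh_cover (τ : ℕ → ℝ) (N : ℕ) (hN : 0 < N) (t : ℝ) (ht : t ∈ Icc (τ 0) (τ N)) :
    ∃ k < N, t ∈ Icc (τ k) (τ (k + 1)) := by
  induction N with
  | zero => omega
  | succ N ih =>
    rcases le_total (τ N) t with h | h
    · exact ⟨N, by omega, h, ht.2⟩
    · rcases Nat.eq_zero_or_pos N with h0 | h0
      · subst h0
        exact ⟨0, by omega, ht⟩
      · obtain ⟨k, hk, hkt⟩ := ih h0 ⟨ht.1, h⟩
        exact ⟨k, by omega, hkt⟩

/-- Upper bounds for both widths from piecewise polynomial interpolation. -/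
lemma widths_upper (T : ℝ) (hT : 0 < T) (s : ℕ) (hs : 2 ≤ s) (X : Set C(Icc (0:ℝ) T, ℝ))
    (τ : ℕ → ℝ) (hτ : StrictMono τ) (N : ℕ) (hN : 0 < N) (hτ0 : τ 0 = 0) (hτN : τ N = T) (e : ℝ)
    (he : 0 ≤ e)
    (H : ∀ x ∈ X, ∀ k < N, ∃ P ∈ Polynomial.degreeLT ℝ s,
      (∀ j < s, P.eval (eqNode s (τ k) (τ (k + 1)) j) =
        x (projIcc 0 T hT.le (eqNode s (τ k) (τ (k + 1)) j))) ∧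
      ∀ t : Icc (0:ℝ) T, (t : ℝ) ∈ Icc (τ k) (τ (k + 1)) → |x t - P.eval (t : ℝ)| ≤ e)
    (n : ℕ) (hn : N * s ≤ n) :
    kolmogorovWidth n X ≤ e ∧ babenkoWidth n X ≤ 2 * e := by
  have hcov : ∀ t : Icc (0:ℝ) T, ∃ k < N, (t : ℝ) ∈ Icc (τ k) (τ (k + 1)) := fun t =>
    mesh_cover τ N hN t (by rw [hτ0, hτN]; exact t.2)
  have huniq : ∀ k < N, ∀ P ∈ Polynomial.degreeLT ℝ s, ∀ Q ∈ Polynomial.degreeLT ℝ s,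
      (∀ j < s, P.eval (eqNode s (τ k) (τ (k + 1)) j) = Q.eval (eqNode s (τ k) (τ (k + 1)) j)) →
      P = Q := by
    intro k _ P hP Q hQ h
    refine Polynomial.eq_of_degrees_lt_of_eval_index_eq (Finset.range s)
      (v := eqNode s (τ k) (τ (k + 1)))
      (eqNode_injective s hs _ _ (hτ (Nat.lt_succ_self k))).injOn ?_ ?_ ?_
    · simpa using Polynomial.mem_degreeLT.1 hP
    · simpa using Polynomial.mem_degreeLT.1 hQ
    · intro j hj
      exact h j (Finset.mem_range.1 hj)
  have hnodeK : ∀ k < N, ∀ j < s, eqNode s (τ k) (τ (k + 1)) j ∈ Icc (0 : ℝ) T ∧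
      eqNode s (τ k) (τ (k + 1)) j ∈ Icc (τ k) (τ (k + 1)) := by
    intro k hk j hj
    have h := eqNode_mem s hs _ _ (hτ (Nat.lt_succ_self k)).le j hj
    refine ⟨⟨?_, ?_⟩, h⟩
    · rw [← hτ0]; exact (hτ.monotone (Nat.zero_le k)).trans h.1
    · rw [← hτN]; exact h.2.trans (hτ.monotone hk)
  constructor
  · -- Kolmogorov
    let L : Submodule ℝ C(Icc (0:ℝ) T, ℝ) :=
      { carrier := {g | ∀ k < N, ∃ P ∈ Polynomial.degreeLT ℝ s,
          ∀ t : Icc (0:ℝ) T, (t : ℝ) ∈ Icc (τ k) (τ (k + 1)) → g t = P.eval (t : ℝ)}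
        add_mem' := by
          intro g g' hg hg' k hk
          obtain ⟨P, hP, hPe⟩ := hg k hk
          obtain ⟨P', hP', hPe'⟩ := hg' k hk
          refine ⟨P + P', Submodule.add_mem _ hP hP', fun t ht => ?_⟩
          simp [hPe t ht, hPe' t ht]
        zero_mem' := fun k _ => ⟨0, Submodule.zero_mem _, fun t _ => by simp⟩
        smul_mem' := by
          intro c g hg k hk
          obtain ⟨P, hP, hPe⟩ := hg k hk
          refine ⟨c • P, Submodule.smul_mem _ _ hP, fun t ht => ?_⟩
          simp [hPe t ht] }
    let ev : L →ₗ[ℝ] (Fin N × Fin s → ℝ) :=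
      { toFun := fun u q => (u : C(Icc (0:ℝ) T, ℝ))
          (projIcc 0 T hT.le (eqNode s (τ q.1) (τ (q.1 + 1)) q.2))
        map_add' := fun _ _ => rfl
        map_smul' := fun _ _ => rfl }
    have hev : Function.Injective ev := by
      rw [← LinearMap.ker_eq_bot, LinearMap.ker_eq_bot']
      intro g hg
      apply Subtype.ext
      ext t
      obtain ⟨k, hk, hkt⟩ := hcov t
      obtain ⟨P, hP, hPe⟩ := g.2 k hk
      have hP0 : P = 0 := by
        refine huniq k hk P hP 0 (Submodule.zero_mem _) fun j hj => ?_
        have h1 := congrFun hg (⟨k, hk⟩, ⟨j, hj⟩)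
        have hm := hnodeK k hk j hj
        have h2 := hPe ⟨_, hm.1⟩ hm.2
        simp only [ev, LinearMap.coe_mk, AddHom.coe_mk, projIcc_of_mem hT.le hm.1] at h1
        rw [Polynomial.eval_zero]
        rw [← h2]
        exact h1
      rw [hPe t hkt, hP0]
      simp
    have hfd : FiniteDimensional ℝ L := FiniteDimensional.of_injective ev hev
    have hrank : Module.finrank ℝ L ≤ n := by
      refine (LinearMap.finrank_le_finrank_of_injective hev).trans ?_
      simpa using hn
    unfold kolmogorovWidth
    refine csInf_le_of_le ⟨0, ?_⟩ ⟨L, hfd, hrank, rfl⟩ ?_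
    · rintro d ⟨L', -, -, rfl⟩
      exact Real.iSup_nonneg fun x => Real.iInf_nonneg fun u => norm_nonneg _
    refine Real.iSup_le (fun x => ?_) he
    choose P hP hPn hPe using H x x.2
    choose κ hκ hκt using hcov
    -- agreement at the knots
    have hend : ∀ k (hk : k < N) (t : Icc (0:ℝ) T), ((t : ℝ) = τ k ∨ (t : ℝ) = τ (k + 1)) →
        (P k hk).eval (t : ℝ) = (x : C(Icc (0:ℝ) T, ℝ)) t := by
      intro k hk t ht
      rcases ht with ht | ht
      · have := hPn k hk 0 (by omega)
        rw [eqNode_zero, ← ht, projIcc_val] at this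
        exact this
      · have := hPn k hk (s - 1) (by omega)
        rw [eqNode_last s hs, ← ht, projIcc_val] at this
        exact this
    have hover : ∀ k (hk : k < N) k' (hk' : k' < N) (t : Icc (0:ℝ) T), k < k' →
        (t : ℝ) ∈ Icc (τ k) (τ (k + 1)) → (t : ℝ) ∈ Icc (τ k') (τ (k' + 1)) →
        (P k hk).eval (t : ℝ) = (P k' hk').eval (t : ℝ) := by
      intro k hk k' hk' t hlt h1 h2
      have h3 : τ (k + 1) ≤ τ k' := hτ.monotone hlt
      rw [hend k hk t (Or.inr (le_antisymm h1.2 (h3.trans h2.1))),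
        hend k' hk' t (Or.inl (le_antisymm (h1.2.trans h3) h2.1))]
    let G : Icc (0:ℝ) T → ℝ := fun t => (P (κ t) (hκ t)).eval (t : ℝ)
    have hG : ∀ k (hk : k < N) (t : Icc (0:ℝ) T), (t : ℝ) ∈ Icc (τ k) (τ (k + 1)) →
        G t = (P k hk).eval (t : ℝ) := by
      intro k hk t ht
      rcases lt_trichotomy (κ t) k with h | h | h
      · exact hover _ _ _ _ t h (hκt t) ht
      · subst h; rfl
      · exact (hover _ _ _ _ t h ht (hκt t)).symm
    have hGc : Continuous G := by
      refine LocallyFinite.continuous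
        (f := fun k : Fin N => {t : Icc (0:ℝ) T | (t : ℝ) ∈ Icc (τ k) (τ (k + 1))})
        (locallyFinite_of_finite _) ?_ ?_ ?_
      · rw [eq_univ_iff_forall]
        intro t
        exact mem_iUnion.2 ⟨⟨κ t, hκ t⟩, hκt t⟩
      · intro k
        exact isClosed_Icc.preimage continuous_subtype_val
      · intro k
        have hc : Continuous fun t : Icc (0:ℝ) T => (P k k.2).eval (t : ℝ) :=
          (P k k.2).continuous.comp continuous_subtype_val
        exact hc.continuousOn.congr fun t ht => hG k k.2 t ht
    have hGL : (⟨G, hGc⟩ : C(Icc (0:ℝ) T, ℝ)) ∈ L := fun k hk =>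
      ⟨P k hk, hP k hk, fun t ht => hG k hk t ht⟩
    refine (ciInf_le ⟨0, ?_⟩ (⟨_, hGL⟩ : L)).trans ?_
    · rintro _ ⟨u, rfl⟩; exact norm_nonneg _
    · rw [ContinuousMap.norm_le _ he]
      intro t
      exact hPe (κ t) (hκ t) t (hκt t)
  · -- Babenko
    let p : X → (Fin n → ℝ) := fun x q => (x : C(Icc (0:ℝ) T, ℝ))
      (projIcc 0 T hT.le (eqNode s (τ (q / s)) (τ (q / s + 1)) (q % s : ℕ)))
    have hp : Continuous p := by
      refine continuous_pi fun q => ?_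
      exact (continuous_eval_const _).comp continuous_subtype_val
    unfold babenkoWidth
    refine csInf_le_of_le ⟨0, ?_⟩ ⟨p, hp, rfl⟩ ?_
    · rintro d ⟨p', -, rfl⟩
      exact Real.iSup_nonneg fun x => Metric.diam_nonneg
    refine Real.iSup_le (fun x => ?_) (by positivity)
    refine Metric.diam_le_of_forall_dist_le (by positivity) ?_
    rintro _ ⟨y, hy, rfl⟩ _ ⟨w, hw, rfl⟩
    have hyw : p y = p w := by
      rw [mem_preimage, mem_singleton_iff] at hy hw
      rw [hy, hw]
    rw [ContinuousMap.dist_le (by positivity)]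
    intro t
    obtain ⟨k, hk, hkt⟩ := hcov t
    obtain ⟨P, hP, hPn, hPe⟩ := H y y.2 k hk
    obtain ⟨P', hP', hPn', hPe'⟩ := H w w.2 k hk
    have hPP : P = P' := by
      refine huniq k hk P hP P' hP' fun j hj => ?_
      rw [hPn j hj, hPn' j hj]
      have hlt : s * k + j < n := by
        have : s * (k + 1) ≤ N * s := by rw [mul_comm]; exact Nat.mul_le_mul_right s hk
        rw [mul_add] at this
        omega
      have h1 := congrFun hyw ⟨s * k + j, hlt⟩
      have hd : (s * k + j) / s = k := by
        rw [Nat.mul_add_div (by omega), Nat.div_eq_of_lt hj, add_zero]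
      have hm : (s * k + j) % s = j := by
        rw [Nat.mul_add_mod, Nat.mod_eq_of_lt hj]
      simp only [p, hd, hm] at h1
      exact h1
    have h1 := hPe t hkt
    have h2 := hPe' t hkt
    rw [hPP] at h1
    rw [Real.dist_eq]
    have h3 := abs_sub_le ((y : C(Icc (0:ℝ) T, ℝ)) t) (P'.eval (t : ℝ)) ((w : C(Icc (0:ℝ) T, ℝ)) t)
    rw [abs_sub_comm (P'.eval (t : ℝ))] at h3
    linarith

theorem widths_QStar_one_dim
    (T M : ℝ) (hT : 0 < T) (hM : 0 < M) (r s : ℕ) (γ ζ : ℝ) (hr : 1 ≤ r) (hγ : 0 < γ)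
    (hsζ : ((∃ n : ℤ, γ = n) ∧ (s : ℝ) = r + γ ∧ ζ = 0) ∨
           ((¬ ∃ n : ℤ, γ = n) ∧ (s : ℝ) = r + ⌊γ⌋ + 1 ∧ ζ = 1 - Int.fract γ))
    (X : Set C(Set.Icc (0:ℝ) T, ℝ))
    (hX : X = { g : C(Set.Icc (0:ℝ) T, ℝ) |
      ∃ f : ℝ → ℝ, MemQStar T M r s ζ f ∧ ∀ t : Set.Icc (0:ℝ) T, g t = f t }) :
    ∃ c₁ c₂ : ℝ, 0 < c₁ ∧ 0 < c₂ ∧ ∃ n₀ : ℕ, ∀ n : ℕ, n₀ ≤ n →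
      (c₁ * (n : ℝ) ^ (-(s : ℝ)) ≤ kolmogorovWidth n X ∧
        kolmogorovWidth n X ≤ c₂ * (n : ℝ) ^ (-(s : ℝ))) ∧
      (c₁ * (n : ℝ) ^ (-(s : ℝ)) ≤ babenkoWidth n X ∧
        babenkoWidth n X ≤ c₂ * (n : ℝ) ^ (-(s : ℝ))) := by
  have hpar : 0 ≤ ζ ∧ ζ ≤ 1 ∧ r < s := by
    rcases hsζ with ⟨-, h2, h3⟩ | ⟨-, h2, h3⟩
    · refine ⟨h3.ge, by linarith, ?_⟩
      have : (r : ℝ) < s := by linarith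
      exact_mod_cast this
    · refine ⟨by linarith [Int.fract_lt_one γ], by linarith [Int.fract_nonneg γ], ?_⟩
      have h4 : (0 : ℝ) ≤ (⌊γ⌋ : ℝ) := by exact_mod_cast Int.floor_nonneg.2 hγ.le
      have : (r : ℝ) < s := by linarith
      exact_mod_cast this
  obtain ⟨hζ0, hζ1, hrs⟩ := hpar
  have hs2 : 2 ≤ s := by omega
  have hsR : (2 : ℝ) ≤ s := by exact_mod_cast hs2
  -- boundedness
  have hbd : ∀ x ∈ X, ‖x‖ ≤ M := by
    intro x hx
    rw [hX] at hx
    obtain ⟨f, hf, hxf⟩ := hx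
    rw [ContinuousMap.norm_le _ hM.le]
    intro t
    rw [hxf t]
    simpa using hf.2.2.1 0 (Nat.zero_le r) t t.2
  obtain ⟨c, hc, hcube⟩ := exists_cube T M hT hM r s ζ hζ0 hζ1 hrs.le X hX
  obtain ⟨E, hE, hmesh⟩ := mesh_error T M hT hM r s ζ hr hrs hζ0 hζ1
  set D : ℝ := (1 + s * s ^ s) * E with hD
  have hD0 : 0 < D := by positivity
  refine ⟨c / 2 ^ s, 2 * (D * (2 * s) ^ s), by positivity, by positivity, s, fun n hn => ?_⟩
  have hn1 : 1 ≤ n := by omega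
  have hnR : (1 : ℝ) ≤ n := by exact_mod_cast hn1
  have hn0 : (0 : ℝ) < n := by linarith
  have hrp : (n : ℝ) ^ (-(s : ℝ)) = 1 / (n : ℝ) ^ s := by
    rw [Real.rpow_neg hn0.le, Real.rpow_natCast, one_div]
  rw [hrp]
  -- lower bounds
  obtain ⟨ψ, z, hψ, hψX⟩ := hcube n
  have hlow : c / 2 ^ s * (1 / (n : ℝ) ^ s) ≤ c / ((n : ℝ) + 1) ^ s := by
    rw [div_mul_div_comm, mul_one, ← mul_pow]
    gcongr
    linarith
  have hk := kolmogorov_lower n X M _ hbd ψ z hψ hψX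
  have hb := babenko_lower n X M _ (by positivity) hbd ψ z hψ hψX
  -- upper bounds
  set N := n / s with hN
  have hN0 : 0 < N := Nat.div_pos hn (by omega)
  have hNR : (0 : ℝ) < N := by exact_mod_cast hN0
  have hNn : N * s ≤ n := Nat.div_mul_le_self n s
  have hnN : (n : ℝ) ≤ N * (2 * s) := by
    have h1 : n < s * (N + 1) := by
      rw [hN]; exact Nat.lt_mul_div_succ n (by omega)
    have h2 : s * (N + 1) ≤ N * (2 * s) := by nlinarith
    exact_mod_cast (h1.le.trans h2)
  have hup := widths_upper T hT s hs2 X (fun k => T * ((k : ℝ) / N) ^ s) (by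
      intro i j hij
      have : (i : ℝ) < j := by exact_mod_cast hij
      have hs0 : s ≠ 0 := by omega
      simp only
      gcongr) N hN0 (by simp; omega) (by simp [hNR.ne']) (D / (N : ℝ) ^ s) (by positivity) (by
      intro x hx k hk
      rw [hX] at hx
      obtain ⟨f, hf, hxf⟩ := hx
      obtain ⟨Q, hQ, hQe⟩ := hmesh f hf N k hk
      have hab : T * ((k : ℝ) / N) ^ s < T * (((k : ℝ) + 1) / N) ^ s := by
        have hs0 : s ≠ 0 := by omega
        gcongr
        linarith
      obtain ⟨P, hP, hPn, hPe⟩ := interp_error s hs2 _ _ hab f Q hQ _ hQe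
      refine ⟨P, hP, ?_, ?_⟩
      · intro j hj
        push_cast
        rw [hPn j hj, hxf]
        congr 1
        have hm := eqNode_mem s hs2 _ _ hab.le j hj
        have hk1 : ((k : ℝ) + 1) / N ≤ 1 := by
          rw [div_le_one hNR]; exact_mod_cast hk
        have hbT : T * (((k : ℝ) + 1) / N) ^ s ≤ T :=
          mul_le_of_le_one_right hT.le (pow_le_one₀ (by positivity) hk1)
        have ha0 : 0 ≤ T * ((k : ℝ) / N) ^ s := by positivity
        rw [projIcc_of_mem hT.le ⟨ha0.trans hm.1, hm.2.trans hbT⟩]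
      · intro t ht
        push_cast at ht
        rw [hxf]
        refine (hPe t ht).trans (le_of_eq ?_)
        rw [hD]; ring) n hNn
  have hfin : D / (N : ℝ) ^ s ≤ D * (2 * s) ^ s * (1 / (n : ℝ) ^ s) := by
    rw [mul_one_div, div_le_div_iff₀ (by positivity) (by positivity)]
    have h9 : (n : ℝ) ^ s ≤ ((N : ℝ) * (2 * s)) ^ s := by
      gcongr
    calc D * (n : ℝ) ^ s ≤ D * ((N : ℝ) * (2 * s)) ^ s := mul_le_mul_of_nonneg_left h9 (by positivity)
      _ = D * (2 * s) ^ s * (N : ℝ) ^ s := by rw [mul_pow]; ring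
  have hp : 0 ≤ D * (2 * s) ^ s * (1 / (n : ℝ) ^ s) := by positivity
  refine ⟨⟨hlow.trans hk, hup.1.trans ?_⟩, hlow.trans hb, hup.2.trans ?_⟩
  · linarith
  · linarith
end
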